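/- Let X be a complex Banach space of dimension at least 2 and let L be a Lie algebra of compact operators on X (a linear subspace of B(X), closed under the commutator [A,B] = AB − BA, all of whose elements are compact). If L has submultiplicative spectrum, i.e. σ(AB) ⊆ {αβ : α ∈ σ(A), β ∈ σ(B)} for all A, B ∈ L, then L is reducible: there exists a closed subspace M of X with M ≠ {0} and M ≠ X such that A(M) ⊆ M for every A ∈ L. -/

import Mathlib

open Filter Topology

namespace LieReducible

set_option linter.unusedSectionVars false

section Growth

variable {A : Type*} [NormedRing A]

/-- `SpectralBound r a` says that the powers of `a` grow at most like `θ ^ n` for every `θ > r`;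
in a Banach algebra this means that the spectral radius of `a` is at most `r`. -/
def SpectralBound (r : ℝ) (a : A) : Prop :=
  ∀ θ, r < θ → ∃ C, ∀ n : ℕ, ‖a ^ n‖ ≤ C * θ ^ n

theorem SpectralBound.mono {r s : ℝ} {a : A} (h : SpectralBound r a) (hrs : r ≤ s) :
    SpectralBound s a := fun θ hθ => h θ (hrs.trans_lt hθ)

theorem spectralBound_of_forall_gt {r : ℝ} {a : A} (h : ∀ s, r < s → SpectralBound s a) :
    SpectralBound r a := fun θ hθ => by
  obtain ⟨s, h1, h2⟩ := exists_between hθ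
  exact h s h1 θ h2

theorem exists_bound_of_eventually {E : Type*} [SeminormedAddCommGroup E] {f : ℕ → E} {θ : ℝ}
    (hθ : 0 < θ) (h : ∀ᶠ n in atTop, ‖f n‖ ≤ θ ^ n) : ∃ C, ∀ n, ‖f n‖ ≤ C * θ ^ n := by
  have hO : f =O[atTop] fun n => θ ^ n := by
    refine Asymptotics.IsBigO.of_bound 1 ?_
    filter_upwards [h] with n hn
    simpa [abs_of_pos hθ] using hn
  obtain ⟨C, -, hC⟩ := Asymptotics.bound_of_isBigO_nat_atTop hO
  refine ⟨C, fun n => ?_⟩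
  have := hC (x := n) (by positivity)
  simpa [abs_of_pos hθ] using this

variable [NormedAlgebra ℂ A]

theorem SpectralBound.norm_le [CompleteSpace A] {r : ℝ} {a : A} (hr : 0 ≤ r)
    (h : SpectralBound r a) {μ : ℂ} (hμ : μ ∈ spectrum ℂ a) : ‖μ‖ ≤ r := by
  refine le_of_forall_gt_imp_ge_of_dense fun θ hθ => ?_
  obtain ⟨C, hC⟩ := h θ hθ
  have hθ0 : 0 < θ := hr.trans_lt hθ
  by_contra! hlt
  have hb : ∀ n : ℕ, (‖μ‖ / θ) ^ n ≤ C * ‖(1 : A)‖ := fun n => by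
    have h1 := spectrum.norm_le_norm_mul_of_mem (spectrum.pow_mem_pow a n hμ)
    rw [norm_pow] at h1
    rw [div_pow, div_le_iff₀ (by positivity)]
    nlinarith [mul_le_mul_of_nonneg_right (hC n) (norm_nonneg (1 : A))]
  have ht := tendsto_pow_atTop_atTop_of_one_lt ((one_lt_div hθ0).2 hlt)
  obtain ⟨n, hn⟩ := (ht.eventually_gt_atTop (C * ‖(1 : A)‖)).exists
  exact absurd (hb n) (not_le.2 hn)

theorem spectralBound_of_spectrum [CompleteSpace A] {r : ℝ} {a : A} (hr : 0 ≤ r)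
    (h : ∀ μ ∈ spectrum ℂ a, ‖μ‖ ≤ r) : SpectralBound r a := by
  intro θ hθ
  have hθ0 : 0 < θ := hr.trans_lt hθ
  refine exists_bound_of_eventually hθ0 ?_
  have hsr : spectralRadius ℂ a < ENNReal.ofReal θ := by
    refine lt_of_le_of_lt ?_ ((ENNReal.ofReal_lt_ofReal_iff hθ0).2 hθ)
    refine iSup₂_le fun μ hμ => ?_
    rw [← ENNReal.ofReal_coe_nnreal, coe_nnnorm]
    exact ENNReal.ofReal_le_ofReal (h μ hμ)
  have ht := spectrum.pow_nnnorm_pow_one_div_tendsto_nhds_spectralRadius a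
  filter_upwards [ht.eventually_lt_const hsr, eventually_gt_atTop 0] with n hn hn0
  have h1 : ((‖a ^ n‖₊ : ENNReal)) ≤ ENNReal.ofReal θ ^ n := by
    have := ENNReal.rpow_le_rpow hn.le (Nat.cast_nonneg (α := ℝ) n)
    rwa [← ENNReal.rpow_mul, one_div, inv_mul_cancel₀ (by positivity), ENNReal.rpow_one,
      ENNReal.rpow_natCast] at this
  rw [← ENNReal.ofReal_pow hθ0.le, ← ENNReal.ofReal_coe_nnreal, coe_nnnorm] at h1
  exact (ENNReal.ofReal_le_ofReal_iff (by positivity)).1 h1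

end Growth

section Riesz

variable {X : Type*} [NormedAddCommGroup X] [NormedSpace ℂ X]

theorem sub_smul_one_apply (T : X →L[ℂ] X) (μ : ℂ) (x : X) :
    (T - μ • 1 : X →L[ℂ] X) x = T x - μ • x := by simp

theorem finiteDimensional_ker_sub [CompleteSpace X] {T : X →L[ℂ] X} (hT : IsCompactOperator T)
    {μ : ℂ} (hμ : μ ≠ 0) : FiniteDimensional ℂ (T - μ • 1 : X →L[ℂ] X).ker := by
  set N := (T - μ • 1 : X →L[ℂ] X).ker with hN
  have hTN : ∀ v ∈ N, T v = μ • v := fun v hv => by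
    have : (T - μ • 1 : X →L[ℂ] X) v = 0 := hv
    simpa [sub_eq_zero] using this
  have hc := hT.restrict (V := N) (f := (T : X →ₗ[ℂ] X))
    (fun v hv => by rw [ContinuousLinearMap.coe_coe, hTN v hv]; exact N.smul_mem _ hv)
    (ContinuousLinearMap.isClosed_ker _)
  have h2 := hc.smul μ⁻¹
  refine FiniteDimensional.of_isCompactOperator_id (𝕜 := ℂ) ?_
  have hid : (id : N → N) = μ⁻¹ • ⇑((T : X →ₗ[ℂ] X).restrict
      (fun v hv => by rw [ContinuousLinearMap.coe_coe, hTN v hv]; exact N.smul_mem _ hv) :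
        N →ₗ[ℂ] N) := by
    refine funext fun v => Subtype.ext ?_
    simp [hTN v v.2, hμ]
  rw [hid]
  exact h2

theorem exists_antilipschitz_on {T : X →L[ℂ] X} (hT : IsCompactOperator T)
    {μ : ℂ} (hμ : μ ≠ 0) {Z : Submodule ℂ X} (hZ : IsClosed (Z : Set X))
    (hinj : ∀ z ∈ Z, T z = μ • z → z = 0) :
    ∃ c > 0, ∀ z ∈ Z, c * ‖z‖ ≤ ‖(T - μ • 1 : X →L[ℂ] X) z‖ := by
  by_contra! hcon
  set S : X →L[ℂ] X := T - μ • 1 with hS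
  have hex : ∀ n : ℕ, ∃ z ∈ Z, ‖z‖ = 1 ∧ ‖S z‖ < 1 / ((n : ℝ) + 1) := fun n => by
    obtain ⟨z, hzZ, hz⟩ := hcon (1 / ((n : ℝ) + 1)) (by positivity)
    have hz0 : 0 < ‖z‖ := by
      by_contra! h0
      have : ‖z‖ = 0 := le_antisymm h0 (norm_nonneg _)
      rw [this] at hz
      exact absurd hz (by simp)
    refine ⟨((‖z‖⁻¹ : ℝ) : ℂ) • z, Z.smul_mem _ hzZ, ?_, ?_⟩
    · rw [norm_smul]; simp [hz0.ne']
    · rw [map_smul, norm_smul]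
      simp only [Complex.norm_real, norm_inv, norm_norm]
      rw [inv_mul_lt_iff₀ hz0, mul_comm]; exact hz
  choose z hzZ hz1 hzS using hex
  obtain ⟨K, hK, hK'⟩ := hT.image_closedBall_subset_compact 1
  obtain ⟨y, -, ψ, hψ, hy⟩ := hK.tendsto_subseq (x := fun n => T (z n))
    (fun n => hK' ⟨z n, by simp [hz1], rfl⟩)
  have hS0 : Tendsto (fun n => S (z n)) atTop (𝓝 0) :=
    squeeze_zero_norm (fun n => (hzS n).le) tendsto_one_div_add_atTop_nhds_zero_nat
  have hlim : Tendsto (fun n => z (ψ n)) atTop (𝓝 (μ⁻¹ • y)) := by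
    have h1 := (hy.sub (hS0.comp hψ.tendsto_atTop)).const_smul μ⁻¹
    simp only [sub_zero] at h1
    refine h1.congr fun n => ?_
    simp [hS, smul_smul, hμ]
  have hmem : μ⁻¹ • y ∈ Z := hZ.mem_of_tendsto hlim (Eventually.of_forall fun n => hzZ _)
  have hn1 : ‖μ⁻¹ • y‖ = 1 :=
    tendsto_nhds_unique hlim.norm (by simp [hz1])
  have h0 : S (μ⁻¹ • y) = 0 :=
    tendsto_nhds_unique ((S.continuous.tendsto _).comp hlim) (hS0.comp hψ.tendsto_atTop)
  have := hinj _ hmem (by simpa only [hS, sub_smul_one_apply, sub_eq_zero] using h0)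
  simp [this] at hn1

variable [CompleteSpace X]

theorem exists_closed_complement_ker {T : X →L[ℂ] X} (hT : IsCompactOperator T)
    {μ : ℂ} (hμ : μ ≠ 0) :
    ∃ p : X →L[ℂ] X, (∀ x, T (p x) = μ • p x) ∧ ∀ x, T x = μ • x → p x = x := by
  have := finiteDimensional_ker_sub hT hμ
  obtain ⟨p, hp⟩ := Submodule.ClosedComplemented.of_finiteDimensional
    (T - μ • 1 : X →L[ℂ] X).ker
  refine ⟨(Submodule.subtypeL _).comp p, fun x => ?_, fun x hx => ?_⟩
  · have : (T - μ • 1 : X →L[ℂ] X) (p x) = 0 := (p x).2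
    rw [sub_smul_one_apply, sub_eq_zero] at this
    exact this
  · have hm : (T - μ • 1 : X →L[ℂ] X) x = 0 := by rw [sub_smul_one_apply, hx, sub_self]
    exact congrArg Subtype.val (hp ⟨x, hm⟩)

theorem exists_bddBelow_section {T : X →L[ℂ] X} (hT : IsCompactOperator T)
    {μ : ℂ} (hμ : μ ≠ 0) : ∃ Z : Submodule ℂ X, IsClosed (Z : Set X) ∧
      (∃ c > 0, ∀ z ∈ Z, c * ‖z‖ ≤ ‖(T - μ • 1 : X →L[ℂ] X) z‖) ∧
      ∀ x, ∃ z ∈ Z, (T - μ • 1 : X →L[ℂ] X) z = (T - μ • 1 : X →L[ℂ] X) x := by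
  obtain ⟨p, hp1, hp2⟩ := exists_closed_complement_ker hT hμ
  refine ⟨p.ker, p.isClosed_ker, exists_antilipschitz_on hT hμ p.isClosed_ker ?_, fun x => ?_⟩
  · intro z hz h
    rw [← hp2 z h]; exact hz
  · refine ⟨x - p x, ?_, ?_⟩
    · simp only [LinearMap.mem_ker, ContinuousLinearMap.coe_coe, map_sub]
      rw [hp2 (p x) (hp1 x), sub_self]
    · rw [map_sub, sub_eq_self, sub_smul_one_apply, hp1, sub_self]

theorem isClosed_range_sub {T : X →L[ℂ] X} (hT : IsCompactOperator T)
    {μ : ℂ} (hμ : μ ≠ 0) : IsClosed (Set.range (T - μ • 1 : X →L[ℂ] X)) := by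
  obtain ⟨Z, hZ, ⟨c, hc, hcZ⟩, hsec⟩ := exists_bddBelow_section hT hμ
  set S : X →L[ℂ] X := T - μ • 1
  have hr : Set.range S = Set.range (S.comp Z.subtypeL) := by
    refine Set.Subset.antisymm ?_ ?_
    · rintro _ ⟨x, rfl⟩
      obtain ⟨z, hz, h⟩ := hsec x
      exact ⟨⟨z, hz⟩, h⟩
    · rintro _ ⟨z, rfl⟩
      exact ⟨z, rfl⟩
  have : CompleteSpace Z := hZ.completeSpace_coe
  rw [hr]
  refine AntilipschitzWith.isClosed_range (K := ⟨c⁻¹, by positivity⟩) ?_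
    (S.comp Z.subtypeL).uniformContinuous
  refine AddMonoidHomClass.antilipschitz_of_bound _ fun z => ?_
  have := hcZ z z.2
  change ‖(z : X)‖ ≤ c⁻¹ * ‖S z‖
  rw [le_inv_mul_iff₀ hc]; exact this

theorem surjective_of_injective_sub {T : X →L[ℂ] X} (hT : IsCompactOperator T)
    {μ : ℂ} (hμ : μ ≠ 0) (hs : Function.Injective (T - μ • 1 : X →L[ℂ] X)) :
    Function.Surjective (T - μ • 1 : X →L[ℂ] X) := by
  rcases hT.hasEigenvalue_or_mem_resolventSet hμ with h | h
  · obtain ⟨v, hv⟩ := h.exists_hasEigenvector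
    refine absurd (hs (a₁ := v) (a₂ := 0) ?_) hv.2
    rw [map_zero, sub_smul_one_apply, sub_eq_zero]
    exact hv.apply_eq_smul
  · rw [spectrum.mem_resolventSet_iff] at h
    obtain ⟨u, hu⟩ := h
    intro y
    refine ⟨-((↑u⁻¹ : X →L[ℂ] X) y), ?_⟩
    have h1 : (algebraMap ℂ (X →L[ℂ] X) μ - T) ((↑u⁻¹ : X →L[ℂ] X) y) = y := by
      rw [← hu]
      exact congrArg (fun f : X →L[ℂ] X => f y) u.mul_inv
    rw [sub_smul_one_apply, map_neg, smul_neg]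
    simpa [Algebra.algebraMap_eq_smul_one, sub_eq_add_neg, add_comm] using h1

theorem injective_of_surjective_sub {T : X →L[ℂ] X} (hT : IsCompactOperator T)
    {μ : ℂ} (hμ : μ ≠ 0) (hs : Function.Surjective (T - μ • 1 : X →L[ℂ] X)) :
    Function.Injective (T - μ • 1 : X →L[ℂ] X) := by
  obtain ⟨Z, hZ, ⟨c, hc, hcZ⟩, hsec⟩ := exists_bddBelow_section hT hμ
  set S : X →L[ℂ] X := T - μ • 1 with hSdef
  have : CompleteSpace Z := hZ.completeSpace_coe
  have hker : (S.comp Z.subtypeL).ker = ⊥ := by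
    refine LinearMap.ker_eq_bot'.2 fun z hz => ?_
    have h1 := hcZ z z.2
    have h2 : S z = 0 := hz
    rw [h2, norm_zero] at h1
    have : ‖(z : X)‖ = 0 := le_antisymm (by nlinarith [norm_nonneg (z : X)]) (norm_nonneg _)
    exact Subtype.ext (norm_eq_zero.1 this)
  have hran : (S.comp Z.subtypeL).range = ⊤ := by
    refine LinearMap.range_eq_top.2 fun y => ?_
    obtain ⟨x, rfl⟩ := hs y
    obtain ⟨z, hz, h⟩ := hsec x
    exact ⟨⟨z, hz⟩, h⟩
  set e := ContinuousLinearEquiv.ofBijective (S.comp Z.subtypeL) hker hran with he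
  set B : X →L[ℂ] X := Z.subtypeL.comp e.symm.toContinuousLinearMap with hB
  have hSB : ∀ x, S (B x) = x := fun x => e.apply_symm_apply x
  have hBinj : Function.Injective B := fun x y h => by rw [← hSB x, ← hSB y, h]
  have hTB : IsCompactOperator (μ⁻¹ • T.comp B : X →L[ℂ] X) := (hT.comp_clm B).smul μ⁻¹
  have hBeq : B = μ⁻¹ • T.comp B - μ⁻¹ • (1 : X →L[ℂ] X) := by
    ext x
    have h := hSB x
    rw [hSdef, sub_smul_one_apply] at h
    rw [sub_smul_one_apply]
    nth_rw 3 [← h]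
    simp [smul_sub, smul_smul, hμ]
  have hBs : Function.Surjective B := by
    rw [hBeq]
    refine surjective_of_injective_sub hTB (inv_ne_zero hμ) ?_
    rw [← hBeq]
    exact hBinj
  intro x y hxy
  obtain ⟨a, rfl⟩ := hBs x
  obtain ⟨b, rfl⟩ := hBs y
  rw [hSB, hSB] at hxy
  rw [hxy]

end Riesz

section SmallRestriction

variable {X : Type*} [NormedAddCommGroup X] [NormedSpace ℂ X]

theorem not_strictAnti_chain {T : X →L[ℂ] X} (hT : IsCompactOperator T) {ε : ℝ} (hε : 0 < ε)
    (V : ℕ → Submodule ℂ X) (μ : ℕ → ℂ) (hV : ∀ n, IsClosed (V n : Set X))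
    (hlt : ∀ n, V (n + 1) < V n) (hμ : ∀ n, ε ≤ ‖μ n‖)
    (hmap : ∀ n, ∀ x ∈ V n, T x - μ n • x ∈ V (n + 1)) : False := by
  have hanti : Antitone V := antitone_nat_of_succ_le fun n => (hlt n).le
  have hinv : ∀ n, ∀ x ∈ V n, T x ∈ V n := fun n x hx => by
    have := (V n).add_mem ((hlt n).le (hmap n x hx)) ((V n).smul_mem (μ n) hx)
    simpa using this
  have hex : ∀ n, ∃ x ∈ V n, ‖x‖ ≤ 3 ∧ ∀ y ∈ V (n + 1), 1 ≤ ‖x - y‖ := fun n => by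
    have h₁ : IsClosed ((V (n + 1)).comap (V n).subtype : Set (V n)) :=
      (hV (n + 1)).preimage continuous_subtype_val
    have h₂ : ∃ x : V n, x ∉ (V (n + 1)).comap (V n).subtype := by
      obtain ⟨x, hx, hx'⟩ := SetLike.exists_of_lt (hlt n)
      exact ⟨⟨x, hx⟩, hx'⟩
    obtain ⟨⟨x, hx⟩, hxn, hxy⟩ := riesz_lemma_of_norm_lt (c := (2 : ℂ)) (R := 3)
      (by norm_num) (by norm_num) h₁ h₂
    exact ⟨x, hx, hxn, fun y hy => hxy ⟨y, (hlt n).le hy⟩ hy⟩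
  choose x hxV hx3 hxd using hex
  obtain ⟨K, hK, hK'⟩ := hT.image_closedBall_subset_compact 3
  obtain ⟨y, -, ψ, hψ, hy⟩ := hK.tendsto_subseq (x := fun n => T (x n))
    (fun n => hK' ⟨x n, by simp [hx3], rfl⟩)
  have hsep : ∀ i j, i < j → ε ≤ ‖T (x i) - T (x j)‖ := fun i j hij => by
    have hμ0 : μ i ≠ 0 := by
      intro h
      have := hμ i
      rw [h, norm_zero] at this
      exact absurd this (not_le.2 hε)
    have hmem : (μ i)⁻¹ • (T (x j) - (T (x i) - μ i • x i)) ∈ V (i + 1) :=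
      (V (i + 1)).smul_mem _ ((V (i + 1)).sub_mem
        (hanti hij (hinv j _ (hxV j))) (hmap i _ (hxV i)))
    have h1 := hxd i _ hmem
    have h2 : T (x i) - T (x j) =
        μ i • (x i - (μ i)⁻¹ • (T (x j) - (T (x i) - μ i • x i))) := by
      rw [smul_sub, smul_smul, mul_inv_cancel₀ hμ0, one_smul]
      abel
    rw [h2, norm_smul]
    nlinarith [hμ i, norm_nonneg (μ i)]
  have hc := hy.cauchySeq
  rw [Metric.cauchySeq_iff] at hc
  obtain ⟨N, hN⟩ := hc ε hε
  have h1 := hN N le_rfl (N + 1) (Nat.le_succ N)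
  have h2 := hsep (ψ N) (ψ (N + 1)) (hψ (Nat.lt_succ_self N))
  rw [dist_eq_norm] at h1
  exact absurd h1 (not_lt.2 h2)

variable [CompleteSpace X]

open Polynomial in
theorem exists_small_restriction {T : X →L[ℂ] X} (hT : IsCompactOperator T) {ε : ℝ}
    (hε : 0 < ε) :
    ∃ (q : ℂ[X]) (R : Submodule ℂ X) (hR : ∀ x ∈ R, T x ∈ R),
      (∀ z, q.eval z = 0 → ε ≤ ‖z‖) ∧ IsClosed (R : Set X) ∧
      R = (aeval T q : X →L[ℂ] X).range ∧
      ∀ μ ∈ spectrum ℂ (T.restrict hR), ‖μ‖ < ε := by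
  by_contra! hcon
  have hinv : ∀ (q : ℂ[X]), ∀ x ∈ (aeval T q : X →L[ℂ] X).range,
      T x ∈ (aeval T q : X →L[ℂ] X).range := by
    rintro q _ ⟨x, rfl⟩
    refine ⟨T x, ?_⟩
    have h : aeval T q * T = T * aeval T q := by
      have := congrArg (aeval T) (mul_comm q Polynomial.X)
      simpa using this
    exact congrArg (fun f : X →L[ℂ] X => f x) h
  have hrange : ∀ (q : ℂ[X]) (μ : ℂ), (aeval T (q * (Polynomial.X - C μ)) : X →L[ℂ] X).range =
      Submodule.map ((T - μ • 1 : X →L[ℂ] X) : X →ₗ[ℂ] X) (aeval T q : X →L[ℂ] X).range := by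
    intro q μ
    have h : aeval T (q * (Polynomial.X - C μ)) = (T - μ • 1 : X →L[ℂ] X) * aeval T q := by
      rw [mul_comm, map_mul, map_sub, aeval_X, aeval_C, Algebra.algebraMap_eq_smul_one]
    rw [h]
    exact LinearMap.range_comp _ _
  let Good := {q : ℂ[X] // (∀ z, q.eval z = 0 → ε ≤ ‖z‖) ∧
    IsClosed ((aeval T q : X →L[ℂ] X).range : Set X)}
  have hstep : ∀ q : Good, ∃ μ : ℂ, ε ≤ ‖μ‖ ∧
      IsClosed ((aeval T (q.1 * (Polynomial.X - C μ)) : X →L[ℂ] X).range : Set X) ∧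
      (aeval T (q.1 * (Polynomial.X - C μ)) : X →L[ℂ] X).range <
        (aeval T q.1 : X →L[ℂ] X).range := by
    rintro ⟨q, hq, hcl⟩
    set R := (aeval T q : X →L[ℂ] X).range with hRdef
    obtain ⟨μ, hμs, hμ⟩ := hcon q R (hinv q) hq hcl rfl
    have hμ0 : μ ≠ 0 := norm_pos_iff.1 (hε.trans_le hμ)
    have : CompleteSpace R := hcl.completeSpace_coe
    have hTR : IsCompactOperator (T.restrict (hinv q)) := hT.restrict (f := (T : X →ₗ[ℂ] X))
      (hinv q) hcl
    have hev := (hTR.hasEigenvalue_iff_mem_spectrum hμ0).2 hμs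
    have hmap : ((Submodule.map ((T - μ • 1 : X →L[ℂ] X) : X →ₗ[ℂ] X) R : Submodule ℂ X) : Set X)
        = Subtype.val '' Set.range (T.restrict (hinv q) - μ • 1 : R →L[ℂ] R) := by
      ext y
      constructor
      · rintro ⟨x, hx, rfl⟩
        exact ⟨_, ⟨⟨x, hx⟩, rfl⟩, by simp⟩
      · rintro ⟨_, ⟨⟨x, hx⟩, rfl⟩, rfl⟩
        exact ⟨x, hx, by simp⟩
    refine ⟨μ, hμ, ?_, ?_⟩
    · rw [hrange, hmap]
      exact hcl.isClosedEmbedding_subtypeVal.isClosedMap _ (isClosed_range_sub hTR hμ0)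
    · rw [hrange]
      refine lt_of_le_of_ne ?_ fun heq => ?_
      · rintro _ ⟨x, hx, rfl⟩
        have := R.sub_mem (hinv q x hx) (R.smul_mem μ hx)
        rwa [← sub_smul_one_apply] at this
      · have hsurj : Function.Surjective (T.restrict (hinv q) - μ • 1 : R →L[ℂ] R) := by
          intro y
          have hy : (y : X) ∈ Subtype.val '' Set.range
              (T.restrict (hinv q) - μ • 1 : R →L[ℂ] R) := by
            rw [← hmap, heq]; exact y.2
          obtain ⟨y', hy', h⟩ := hy
          rwa [← Subtype.ext h]
        have hinj := injective_of_surjective_sub hTR hμ0 hsurj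
        obtain ⟨v, hv⟩ := hev.exists_hasEigenvector
        refine absurd (hinj (a₁ := v) (a₂ := 0) ?_) hv.2
        rw [map_zero, sub_smul_one_apply, sub_eq_zero]
        exact hv.apply_eq_smul
  choose μ hμ hcl hlt using hstep
  let next : Good → Good := fun q => ⟨q.1 * (Polynomial.X - C (μ q)), by
    refine ⟨fun z hz => ?_, hcl q⟩
    rw [eval_mul, mul_eq_zero] at hz
    rcases hz with hz | hz
    · exact q.2.1 z hz
    · have : z = μ q := by simpa [sub_eq_zero] using hz
      rw [this]; exact hμ q⟩
  let q0 : Good := ⟨1, by simp, by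
    have : ((aeval T (1 : ℂ[X]) : X →L[ℂ] X).range : Set X) = Set.univ := by
      rw [map_one]
      exact Set.range_eq_univ.2 fun x => ⟨x, rfl⟩
    rw [this]; exact isClosed_univ⟩
  let Q : ℕ → Good := fun n => next^[n] q0
  have hQ : ∀ n, Q (n + 1) = next (Q n) := fun n => Function.iterate_succ_apply' _ _ _
  refine not_strictAnti_chain hT hε (fun n => (aeval T (Q n).1 : X →L[ℂ] X).range)
    (fun n => μ (Q n)) (fun n => (Q n).2.2) (fun n => ?_) (fun n => hμ _) (fun n x hx => ?_)
  · simp only [hQ]; exact hlt (Q n)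
  · simp only [hQ]
    change _ ∈ (aeval T ((Q n).1 * (Polynomial.X - C (μ (Q n)))) : X →L[ℂ] X).range
    rw [hrange]
    exact ⟨x, hx, by simp⟩

end SmallRestriction

theorem isUnit_one_sub_smul_iff {A : Type*} [Ring A] [Algebra ℂ A] {a : A} {w : ℂ} (hw : w ≠ 0) :
    IsUnit (1 - w • a) ↔ w⁻¹ ∉ spectrum ℂ a := by
  rw [spectrum.notMem_iff]
  have h : 1 - w • a = (Units.mk0 w hw) • (algebraMap ℂ A w⁻¹ - a) := by
    rw [Units.smul_def, Units.val_mk0, smul_sub, Algebra.algebraMap_eq_smul_one, smul_smul,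
      mul_inv_cancel₀ hw, one_smul]
  rw [h, isUnit_smul_iff]

theorem SpectralBound.isUnit_one_sub {A : Type*} [NormedRing A] [NormedAlgebra ℂ A]
    [CompleteSpace A] {r : ℝ} {a : A} (hr : 0 ≤ r) (h : SpectralBound r a) {w : ℂ}
    (hw : ‖w‖ * r < 1) : IsUnit (1 - w • a) := by
  rcases eq_or_ne w 0 with rfl | hw0
  · simp
  · rw [isUnit_one_sub_smul_iff hw0]
    intro hmem
    have h1 := h.norm_le hr hmem
    have hpos : 0 < ‖w‖ := norm_pos_iff.2 hw0
    rw [norm_inv, inv_le_iff_one_le_mul₀ hpos, mul_comm] at h1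
    linarith

section

variable {X : Type*} [NormedAddCommGroup X] [NormedSpace ℂ X]

theorem aeval_apply_of_apply_eq_smul {T : X →L[ℂ] X} {μ : ℂ} {v : X} (h : T v = μ • v)
    (q : Polynomial ℂ) : (Polynomial.aeval T q) v = q.eval μ • v := by
  induction q using Polynomial.induction_on with
  | C a => simp [Algebra.algebraMap_eq_smul_one]
  | add p q hp hq => simp [hp, hq, add_smul]
  | monomial n a ih =>
    rw [pow_succ, ← mul_assoc, map_mul, Polynomial.aeval_X]
    change (Polynomial.aeval T (Polynomial.C a * Polynomial.X ^ n)) (T v) = _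
    rw [h, map_smul, ih, smul_smul, Polynomial.eval_mul_X, mul_comm]

theorem mem_spectrum_of_apply_eq_smul {T : X →L[ℂ] X} {μ : ℂ} {v : X} (hv : v ≠ 0)
    (h : T v = μ • v) : μ ∈ spectrum ℂ T := by
  rw [spectrum.mem_iff]
  rintro ⟨u, hu⟩
  have h0 : (algebraMap ℂ (X →L[ℂ] X) μ - T) v = 0 := by
    simp [Algebra.algebraMap_eq_smul_one, h]
  rw [← hu] at h0
  have h1 : (↑u⁻¹ * ↑u : X →L[ℂ] X) v = v := by rw [u.inv_mul]; rfl
  change (↑u⁻¹ : X →L[ℂ] X) ((u : X →L[ℂ] X) v) = v at h1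
  rw [h0, map_zero] at h1
  exact hv h1.symm

variable [CompleteSpace X]

theorem exists_eigenvector {T : X →L[ℂ] X} (hT : IsCompactOperator T) {μ : ℂ} (hμ : μ ≠ 0)
    (h : μ ∈ spectrum ℂ T) : ∃ v ≠ 0, T v = μ • v := by
  obtain ⟨v, hv⟩ := ((hT.hasEigenvalue_iff_mem_spectrum hμ).2 h).exists_hasEigenvector
  exact ⟨v, hv.2, hv.apply_eq_smul⟩

theorem finite_spectrum_of_le_norm {T : X →L[ℂ] X} (hT : IsCompactOperator T) {ε : ℝ}
    (hε : 0 < ε) : {μ ∈ spectrum ℂ T | ε ≤ ‖μ‖}.Finite := by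
  obtain ⟨q, R, hR, hq, hcl, hran, hspec⟩ := exists_small_restriction hT hε
  have hq0 : q ≠ 0 := by
    rintro rfl
    have := hq 0 (by simp)
    simp only [norm_zero] at this
    exact absurd this (not_le.2 hε)
  refine (q.roots.toFinset.finite_toSet).subset ?_
  rintro μ ⟨hμ, hμε⟩
  have hμ0 : μ ≠ 0 := norm_pos_iff.1 (hε.trans_le hμε)
  obtain ⟨v, hv0, hv⟩ := exists_eigenvector hT hμ0 hμ
  simp only [Finset.mem_coe, Multiset.mem_toFinset, Polynomial.mem_roots hq0,
    Polynomial.IsRoot.def]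
  by_contra hne
  have hvR : v ∈ R := by
    rw [hran]
    refine ⟨(q.eval μ)⁻¹ • v, ?_⟩
    rw [map_smul, ContinuousLinearMap.coe_coe, aeval_apply_of_apply_eq_smul hv, smul_smul,
      inv_mul_cancel₀ hne, one_smul]
  have : CompleteSpace R := hcl.completeSpace_coe
  have hmem : μ ∈ spectrum ℂ (T.restrict hR) := by
    refine mem_spectrum_of_apply_eq_smul (v := ⟨v, hvR⟩) (fun h => hv0 (congrArg Subtype.val h)) ?_
    exact Subtype.ext hv
  exact absurd (hspec μ hmem) (not_lt.2 hμε)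

theorem SpectralBound.of_tendsto {ι : Type*} {l : Filter ι} [l.NeBot] {u : ι → X →L[ℂ] X}
    {e : X →L[ℂ] X} (he : IsCompactOperator e) (hu : Tendsto u l (𝓝 e)) {r : ℝ} (hr : 0 ≤ r)
    (h : ∀ᶠ j in l, SpectralBound r (u j)) : SpectralBound r e := by
  refine spectralBound_of_spectrum hr fun μ hμ => ?_
  by_contra! hlt
  have hμ0 : μ ≠ 0 := norm_pos_iff.1 (hr.trans_lt hlt)
  obtain ⟨v, hv0, hv⟩ := exists_eigenvector he hμ0 hμ
  obtain ⟨ε, hε1, hε2⟩ := exists_between hlt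
  have hε : 0 < ε := hr.trans_lt hε1
  obtain ⟨s, ⟨hs1, hs2⟩, hs⟩ := ((Set.Ioo_infinite hε2).sdiff
    ((finite_spectrum_of_le_norm he hε).image (fun z => ‖z‖))).nonempty
  have hs0 : 0 < s := hε.trans hs1
  have hunit : ∀ w ∈ Metric.sphere (0 : ℂ) s⁻¹, IsUnit (1 - w • e) := fun w hw => by
    rw [mem_sphere_zero_iff_norm] at hw
    have hw0 : w ≠ 0 := norm_pos_iff.1 (by rw [hw]; positivity)
    rw [isUnit_one_sub_smul_iff hw0]
    intro hmem
    have hn : ‖w⁻¹‖ = s := by rw [norm_inv, hw, inv_inv]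
    exact hs ⟨w⁻¹, ⟨hmem, by rw [hn]; exact hs1.le⟩, hn⟩
  have hcont : ∀ w ∈ Metric.sphere (0 : ℂ) s⁻¹, ContinuousAt
      (fun p : (X →L[ℂ] X) × ℂ => Ring.inverse (1 - p.2 • p.1)) (e, w) := fun w hw =>
    ContinuousAt.comp (f := fun p : (X →L[ℂ] X) × ℂ => 1 - p.2 • p.1) (x := (e, w))
      (g := Ring.inverse) (differentiableAt_inverse (𝕜 := ℂ) (hunit w hw)).continuousAt
      (by fun_prop)
  obtain ⟨M, hM⟩ : ∃ M, ∀ w ∈ Metric.sphere (0 : ℂ) s⁻¹, ‖Ring.inverse (1 - w • e)‖ < M := by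
    have hc : ContinuousOn (fun w : ℂ => Ring.inverse (1 - w • e)) (Metric.sphere (0 : ℂ) s⁻¹) :=
      fun w hw => (ContinuousAt.comp (f := fun w : ℂ => (e, w)) (hcont w hw)
        (by fun_prop)).continuousWithinAt
    obtain ⟨M, hM⟩ := (isCompact_sphere (0 : ℂ) s⁻¹).exists_bound_of_continuousOn hc
    exact ⟨M + 1, fun w hw => (hM w hw).trans_lt (lt_add_one M)⟩
  have hev : ∀ᶠ a in 𝓝 e, ∀ w ∈ Metric.sphere (0 : ℂ) s⁻¹, ‖Ring.inverse (1 - w • a)‖ < M :=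
    (isCompact_sphere (0 : ℂ) s⁻¹).eventually_forall_of_forall_eventually fun w hw =>
      (hcont w hw).norm.eventually_lt_const (hM w hw)
  have hw1 : ‖μ⁻¹‖ < s⁻¹ := by
    rw [norm_inv]
    exact inv_strictAnti₀ hs0 hs2
  have hkey : ∀ᶠ j in l, ‖v‖ ≤ M * ‖v - μ⁻¹ • u j v‖ := by
    filter_upwards [h, hu.eventually hev] with j hj1 hj2
    have hU : ∀ w ∈ Metric.closedBall (0 : ℂ) s⁻¹, IsUnit (1 - w • u j) := fun w hw => by
      refine hj1.isUnit_one_sub hr ?_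
      rw [mem_closedBall_zero_iff] at hw
      calc ‖w‖ * r ≤ s⁻¹ * r := by gcongr
        _ < 1 := by rw [inv_mul_lt_one₀ hs0]; linarith
    have hd : DifferentiableOn ℂ (fun w : ℂ => Ring.inverse (1 - w • u j))
        (Metric.closedBall (0 : ℂ) s⁻¹) := fun w hw =>
      (DifferentiableAt.inverse (h := fun w : ℂ => 1 - w • u j) (by fun_prop)
        (hU w hw)).differentiableWithinAt
    have hb : ‖Ring.inverse (1 - μ⁻¹ • u j)‖ ≤ M := by
      refine Complex.norm_le_of_forall_mem_frontier_norm_le (U := Metric.ball (0 : ℂ) s⁻¹)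
        (f := fun w : ℂ => Ring.inverse (1 - w • u j)) Metric.isBounded_ball
        (DifferentiableOn.diffContOnCl ?_) (fun z hz => ?_) (subset_closure (by simpa using hw1))
      · exact hd.mono Metric.closure_ball_subset_closedBall
      · exact (hj2 z (Metric.frontier_ball_subset_sphere hz)).le
    have hv2 : Ring.inverse (1 - μ⁻¹ • u j) ((1 - μ⁻¹ • u j : X →L[ℂ] X) v) = v :=
      congrArg (fun f : X →L[ℂ] X => f v)
        (Ring.inverse_mul_cancel _ (hU _ (mem_closedBall_zero_iff.2 hw1.le)))
    calc ‖v‖ = ‖Ring.inverse (1 - μ⁻¹ • u j) ((1 - μ⁻¹ • u j : X →L[ℂ] X) v)‖ := by rw [hv2]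
      _ ≤ M * ‖(1 - μ⁻¹ • u j : X →L[ℂ] X) v‖ := ContinuousLinearMap.le_of_opNorm_le _ hb _
      _ = _ := by simp
  have hlim : Tendsto (fun j => M * ‖v - μ⁻¹ • u j v‖) l (𝓝 (M * ‖v - μ⁻¹ • e v‖)) := by
    have h1 : Tendsto (fun j => u j v) l (𝓝 (e v)) :=
      ((ContinuousLinearMap.apply ℂ X v).continuous.tendsto e).comp hu
    exact ((h1.const_smul μ⁻¹).const_sub v).norm.const_mul M
  have := ge_of_tendsto hlim hkey
  rw [hv, smul_smul, inv_mul_cancel₀ hμ0, one_smul, sub_self, norm_zero, mul_zero] at this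
  exact hv0 (norm_le_zero_iff.1 this)

end

theorem SpectralBound.eventually {A : Type*} [NormedRing A] [NormedAlgebra ℂ A]
    [CompleteSpace A] {r s : ℝ} {a : A} (hr : 0 ≤ r) (h : SpectralBound r a) (hs : r < s) :
    ∀ᶠ b in 𝓝 a, SpectralBound s b := by
  have hsub : Metric.ball (0 : ℂ) s ∈ 𝓝ˢ (spectrum ℂ a) :=
    Metric.isOpen_ball.mem_nhdsSet.2 fun μ hμ =>
      mem_ball_zero_iff.2 ((h.norm_le hr hμ).trans_lt hs)
  filter_upwards [upperHemicontinuous_spectrum ℂ A a _ hsub] with b hb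
  refine spectralBound_of_spectrum (hr.trans hs.le) fun μ hμ => ?_
  exact (mem_ball_zero_iff.1 (subset_of_mem_nhdsSet hb hμ)).le

section

variable {X : Type*} [NormedAddCommGroup X] [NormedSpace ℂ X]

/-- A Lie algebra of compact operators on which the spectral radius is submultiplicative. -/
structure SubmulLie (L : Submodule ℂ (X →L[ℂ] X)) : Prop where
  lie : ∀ A ∈ L, ∀ B ∈ L, A * B - B * A ∈ L
  compact : ∀ A ∈ L, IsCompactOperator A
  submul : ∀ A ∈ L, ∀ B ∈ L, ∀ r s : ℝ, 0 ≤ r → 0 ≤ s → SpectralBound r A → SpectralBound s B →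
    SpectralBound (r * s) (A * B)

/-- There are no closed invariant subspaces besides the two trivial ones. -/
def Irreducible (L : Submodule ℂ (X →L[ℂ] X)) : Prop :=
  ∀ M : Submodule ℂ X, IsClosed (M : Set X) → (∀ A ∈ L, ∀ x ∈ M, A x ∈ M) → M = ⊥ ∨ M = ⊤

theorem Irreducible.mono {L L' : Submodule ℂ (X →L[ℂ] X)} (h : Irreducible L) (hle : L ≤ L') :
    Irreducible L' := fun M hM hinv => h M hM fun A hA => hinv A (hle hA)

variable [CompleteSpace X]

theorem submulLie_topologicalClosure {L : Submodule ℂ (X →L[ℂ] X)}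
    (hLie : ∀ A ∈ L, ∀ B ∈ L, A * B - B * A ∈ L)
    (hcompact : ∀ A ∈ L, IsCompactOperator A)
    (hsubmul : ∀ A ∈ L, ∀ B ∈ L, ∀ mu ∈ spectrum ℂ (A * B),
      ∃ α ∈ spectrum ℂ A, ∃ β ∈ spectrum ℂ B, mu = α * β) :
    SubmulLie L.topologicalClosure := by
  have hcomp : ∀ A ∈ L.topologicalClosure, IsCompactOperator A := fun A hA =>
    closure_minimal (t := {f : X →L[ℂ] X | IsCompactOperator f}) (fun B hB => hcompact B hB)
      isClosed_setOfPred_isCompactOperator hA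
  refine ⟨fun A hA B hB => ?_, hcomp, fun A hA B hB r s hr hs hrA hsB => ?_⟩
  · exact map_mem_closure₂ (f := fun A B : X →L[ℂ] X => A * B - B * A) (by fun_prop) hA hB hLie
  · refine spectralBound_of_forall_gt fun c hc => ?_
    have hlim : Tendsto (fun ε : ℝ => (r + ε) * (s + ε)) (𝓝[>] 0) (𝓝 (r * s)) := by
      have : Continuous fun ε : ℝ => (r + ε) * (s + ε) := by fun_prop
      simpa using (this.tendsto 0).mono_left nhdsWithin_le_nhds
    obtain ⟨ε, hεc, hε⟩ := ((hlim.eventually_lt_const hc).and self_mem_nhdsWithin).exists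
    replace hε : 0 < ε := hε
    have hmem : (A, B) ∈ closure ((L : Set (X →L[ℂ] X)) ×ˢ (L : Set (X →L[ℂ] X))) := by
      rw [closure_prod_eq]
      exact ⟨hA, hB⟩
    have := mem_closure_iff_nhdsWithin_neBot.1 hmem
    refine SpectralBound.of_tendsto (l := 𝓝[(L : Set (X →L[ℂ] X)) ×ˢ (L : Set (X →L[ℂ] X))] (A, B))
      (u := fun p => p.1 * p.2) ((hcomp A hA).comp_clm B) ?_ ((mul_nonneg hr hs).trans hc.le) ?_
    · exact ((continuous_fst.mul continuous_snd).tendsto (A, B)).mono_left nhdsWithin_le_nhds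
    · have hevA := (continuous_fst.tendsto (A, B)).eventually
        (hrA.eventually hr (lt_add_of_pos_right r hε))
      have hevB := (continuous_snd.tendsto (A, B)).eventually
        (hsB.eventually hs (lt_add_of_pos_right s hε))
      filter_upwards [nhdsWithin_le_nhds hevA, nhdsWithin_le_nhds hevB, self_mem_nhdsWithin]
        with p h1 h2 h3
      refine (spectralBound_of_spectrum (r := (r + ε) * (s + ε)) (by positivity)
        fun μ hμ => ?_).mono hεc.le
      obtain ⟨α, hα, β, hβ, rfl⟩ := hsubmul _ h3.1 _ h3.2 μ hμ
      rw [norm_mul]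
      have := h1.norm_le (by positivity) hα
      have := h2.norm_le (by positivity) hβ
      gcongr

end

section

variable {X : Type*} [NormedAddCommGroup X] [NormedSpace ℂ X]

theorem adjoin_commutator_mem {A : Type*} [Ring A] [Algebra ℂ A] {I : Set A} {C : A}
    (h : ∀ B ∈ I, C * B - B * C ∈ I) {B : A} (hB : B ∈ NonUnitalAlgebra.adjoin ℂ I) :
    C * B - B * C ∈ NonUnitalAlgebra.adjoin ℂ I := by
  induction hB using NonUnitalAlgebra.adjoin_induction with
  | mem x hx => exact NonUnitalAlgebra.subset_adjoin ℂ (h x hx)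
  | add x y _ _ hx hy =>
    have : C * (x + y) - (x + y) * C = (C * x - x * C) + (C * y - y * C) := by noncomm_ring
    rw [this]
    exact add_mem hx hy
  | zero => simp
  | mul x y hx hy ihx ihy =>
    have : C * (x * y) - (x * y) * C = (C * x - x * C) * y + x * (C * y - y * C) := by noncomm_ring
    rw [this]
    exact add_mem (mul_mem ihx hy) (mul_mem hx ihy)
  | smul r x _ hx =>
    rw [mul_smul_comm, smul_mul_assoc, ← smul_sub]
    exact SMulMemClass.smul_mem r hx

theorem mul_prod_mul_eq_mul_foldr {A : Type*} [Ring A] {S : Set A} {E : A} {k : ℕ}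
    (hk : ∀ w : List A, (∀ C ∈ w, C ∈ S) → w.length < k → E * w.prod * E = 0) (l w : List A)
    (hl : ∀ C ∈ l, C ∈ S) (hw : ∀ C ∈ w, C ∈ S) (hlen : w.length + l.length ≤ k) :
    E * w.prod * l.foldr (fun C G => C * G - G * C) E = E * (w ++ l).prod * E := by
  induction l generalizing w with
  | nil => simp
  | cons C l ih =>
    simp only [List.length_cons] at hlen
    have h1 := ih (w ++ [C]) (fun D hD => hl D (by simp [hD]))
      (fun D hD => by
        rcases List.mem_append.1 hD with h | h
        · exact hw D h
        · rw [List.mem_singleton.1 h]; exact hl C (by simp))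
      (by simp; omega)
    have h2 := ih w (fun D hD => hl D (by simp [hD])) hw (by omega)
    rw [hk (w ++ l) (fun D hD => by
        rcases List.mem_append.1 hD with h | h
        · exact hw D h
        · exact hl D (by simp [h])) (by simp; omega)] at h2
    rw [List.foldr_cons, mul_sub, ← mul_assoc, ← mul_assoc, h2, zero_mul, sub_zero]
    simpa [mul_assoc] using h1

/-- An ideal generating an algebra of finite rank nilpotent operators is trivial when the ambient
space is irreducible. -/
theorem Irreducible.eq_zero_of_nilpotent {L : Submodule ℂ (X →L[ℂ] X)} (hL : Irreducible L)
    {I : Set (X →L[ℂ] X)} (hI : ∀ C ∈ L, ∀ B ∈ I, C * B - B * C ∈ I)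
    (hnil : ∀ T ∈ NonUnitalAlgebra.adjoin ℂ I, IsNilpotent T ∧ FiniteDimensional ℂ T.range)
    {B : X →L[ℂ] X} (hB : B ∈ I) : B = 0 := by
  classical
  by_contra hB0
  set N := NonUnitalAlgebra.adjoin ℂ I with hN
  have hex : ∃ n, ∃ E ∈ N, E ≠ 0 ∧ Module.finrank ℂ E.range = n :=
    ⟨_, B, NonUnitalAlgebra.subset_adjoin ℂ hB, hB0, rfl⟩
  obtain ⟨E, hE, hE0, hErank⟩ := Nat.find_spec hex
  have hmin : ∀ F ∈ N, F ≠ 0 → Module.finrank ℂ E.range ≤ Module.finrank ℂ F.range :=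
    fun F hF hF0 => hErank ▸ Nat.find_min' hex ⟨F, hF, hF0, rfl⟩
  have hfin := (hnil E hE).2
  have drop : ∀ S : X →L[ℂ] X, E * S * E ∈ N → (∃ n, (E * S) ^ n * E = 0) → E * S * E = 0 := by
    rintro S hS ⟨n, hn⟩
    by_contra hne
    have hle : (E * S * E).range ≤ E.range := by
      rintro _ ⟨x, rfl⟩
      exact ⟨S (E x), rfl⟩
    have heq := Submodule.eq_of_le_of_finrank_le hle (hmin _ hS hne)
    have hpow : ∀ k, ((E * S) ^ k * E).range = E.range := by
      intro k
      induction k with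
      | zero => simp
      | succ k ih =>
        rw [pow_succ]
        refine le_antisymm ?_ ?_
        · rw [← ih]
          rintro _ ⟨x, rfl⟩
          exact ⟨S (E x), rfl⟩
        · intro y hy
          rw [← ih] at hy
          obtain ⟨x, rfl⟩ := hy
          have hx : E x ∈ (E * S * E).range := heq ▸ ⟨x, rfl⟩
          obtain ⟨z, hz⟩ := hx
          exact ⟨z, congrArg ((E * S) ^ k : X →L[ℂ] X) hz⟩
    have := hpow n
    rw [hn] at this
    refine hE0 (ContinuousLinearMap.ext fun x => ?_)
    have hx : E x ∈ (0 : X →L[ℂ] X).range := this ▸ ⟨x, rfl⟩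
    obtain ⟨z, hz⟩ := hx
    exact hz.symm
  have hword : ∀ k, ∀ w : List (X →L[ℂ] X), (∀ C ∈ w, C ∈ L) → w.length < k →
      E * w.prod * E = 0 := by
    intro k
    induction k with
    | zero => intro w _ h; omega
    | succ k ih =>
      intro w hw hlen
      have h1 := mul_prod_mul_eq_mul_foldr (S := L) ih w [] hw (by simp) (by simp; omega)
      simp only [List.prod_nil, mul_one, List.nil_append] at h1
      set F := w.foldr (fun C G => C * G - G * C) E with hF
      have hFN : F ∈ N := by
        clear_value N
        clear h1 hlen ih
        induction w with
        | nil => exact hE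
        | cons C w ihw =>
          rw [hF, List.foldr_cons, hN]
          refine adjoin_commutator_mem (hI C (hw C (by simp))) ?_
          rw [← hN]
          exact ihw (fun D hD => hw D (by simp [hD])) rfl
      refine drop _ (h1 ▸ mul_mem hE hFN) ?_
      obtain ⟨n, hn⟩ := (hnil F hFN).1
      refine ⟨n, ?_⟩
      have : ∀ m, (E * w.prod) ^ m * E = E * F ^ m := by
        intro m
        induction m with
        | zero => simp
        | succ m ihm => rw [pow_succ', mul_assoc, ihm, ← mul_assoc, ← h1, mul_assoc, pow_succ']
      rw [this, hn, mul_zero]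
  obtain ⟨x, hx⟩ : ∃ x, E x ≠ 0 := by
    by_contra! h
    exact hE0 (ContinuousLinearMap.ext h)
  set M0 : Submodule ℂ X := Submodule.span ℂ {y | ∃ w : List (X →L[ℂ] X), (∀ C ∈ w, C ∈ L) ∧
    w.prod (E x) = y} with hM0
  have hinv : ∀ A ∈ L, ∀ y ∈ M0, A y ∈ M0 := by
    intro A hA y hy
    induction hy using Submodule.span_induction with
    | mem y hy =>
      obtain ⟨w, hw, rfl⟩ := hy
      exact Submodule.subset_span ⟨A :: w, by simpa using ⟨hA, hw⟩, by simp⟩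
    | zero => simp
    | add y z _ _ h1 h2 => rw [map_add]; exact add_mem h1 h2
    | smul c y _ h => rw [map_smul]; exact Submodule.smul_mem _ _ h
  have hker : M0.topologicalClosure ≤ E.ker := by
    refine Submodule.topologicalClosure_minimal _ ?_ E.isClosed_ker
    refine Submodule.span_le.2 ?_
    rintro _ ⟨w, hw, rfl⟩
    exact congrArg (fun f : X →L[ℂ] X => f x) (hword _ w hw (Nat.lt_succ_self _))
  have hmem : E x ∈ M0.topologicalClosure :=
    Submodule.le_topologicalClosure _ (Submodule.subset_span ⟨[], by simp, by simp⟩)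
  rcases hL M0.topologicalClosure M0.isClosed_topologicalClosure (fun A hA y hy =>
    map_mem_closure A.continuous hy (hinv A hA)) with h | h
  · rw [h] at hmem
    exact hx hmem
  · exact hx (hker (h ▸ Submodule.mem_top))

end

section Exp

variable {A : Type*} [NormedRing A] [NormedAlgebra ℂ A] [CompleteSpace A]

theorem exp_neg_mul_exp (a : A) : NormedSpace.exp (-a) * NormedSpace.exp a = 1 := by
  let _ := NormedAlgebra.restrictScalars ℚ ℂ A
  rw [← NormedSpace.exp_add_of_commute (Commute.neg_left (Commute.refl a)), neg_add_cancel,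
    NormedSpace.exp_zero]

theorem exp_mul_exp_neg (a : A) : NormedSpace.exp a * NormedSpace.exp (-a) = 1 := by
  simpa using exp_neg_mul_exp (-a)

/-- Multiplication by `a` on the left as a continuous linear map. -/
noncomputable abbrev mulL (a : A) : A →L[ℂ] A := ContinuousLinearMap.mul ℂ A a

/-- Multiplication by `a` on the right as a continuous linear map. -/
noncomputable abbrev mulR (a : A) : A →L[ℂ] A := (ContinuousLinearMap.mul ℂ A).flip a

theorem mulL_pow (a x : A) (n : ℕ) : (mulL a ^ n) x = a ^ n * x := by
  induction n with
  | zero => simp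
  | succ n ih =>
    rw [pow_succ']
    change a * (mulL a ^ n) x = _
    rw [ih, ← mul_assoc, pow_succ']

theorem mulR_pow (a x : A) (n : ℕ) : (mulR a ^ n) x = x * a ^ n := by
  induction n with
  | zero => simp
  | succ n ih =>
    rw [pow_succ']
    change (mulR a ^ n) x * a = _
    rw [ih, mul_assoc, pow_succ]

theorem exp_mulL (a x : A) : NormedSpace.exp (mulL a) x = NormedSpace.exp a * x := by
  have h1 := (NormedSpace.exp_series_hasSum_exp' (𝕂 := ℂ) (mulL a)).mapL
    (ContinuousLinearMap.apply ℂ A x)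
  have h2 := (NormedSpace.exp_series_hasSum_exp' (𝕂 := ℂ) a).mul_right x
  refine h1.unique ?_
  convert! h2 using 2 with n
  change (((n.factorial : ℂ)⁻¹ • mulL a ^ n : A →L[ℂ] A)) x = _
  rw [smul_apply, mulL_pow, smul_mul_assoc]

theorem exp_mulR (a x : A) : NormedSpace.exp (mulR a) x = x * NormedSpace.exp a := by
  have h1 := (NormedSpace.exp_series_hasSum_exp' (𝕂 := ℂ) (mulR a)).mapL
    (ContinuousLinearMap.apply ℂ A x)
  have h2 := (NormedSpace.exp_series_hasSum_exp' (𝕂 := ℂ) a).mul_left x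
  refine h1.unique ?_
  convert! h2 using 2 with n
  change (((n.factorial : ℂ)⁻¹ • mulR a ^ n : A →L[ℂ] A)) x = _
  rw [smul_apply, mulR_pow, mul_smul_comm]

theorem exp_mulL_sub_mulR (a x : A) : NormedSpace.exp (mulL a - mulR a) x =
    NormedSpace.exp a * x * NormedSpace.exp (-a) := by
  let _ := NormedAlgebra.restrictScalars ℚ ℂ (A →L[ℂ] A)
  have hc : Commute (mulL a) (mulR (-a)) := by
    ext y
    change a * (y * -a) = a * y * -a
    rw [mul_assoc]
  have h : mulL a - mulR a = mulL a + mulR (-a) := by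
    ext y
    simp [sub_eq_add_neg]
  rw [h, NormedSpace.exp_add_of_commute hc]
  change NormedSpace.exp (mulL a) (NormedSpace.exp (mulR (-a)) x) = _
  rw [exp_mulR, exp_mulL, mul_assoc]

theorem exp_apply_mem {E : Type*} [NormedAddCommGroup E] [NormedSpace ℂ E] [CompleteSpace E]
    {S : Submodule ℂ E} (hS : IsClosed (S : Set E)) {U : E →L[ℂ] E} (hU : ∀ x ∈ S, U x ∈ S)
    {x : E} (hx : x ∈ S) : NormedSpace.exp U x ∈ S := by
  have h1 := (NormedSpace.exp_series_hasSum_exp' (𝕂 := ℂ) U).mapL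
    (ContinuousLinearMap.apply ℂ E x)
  refine hS.mem_of_tendsto h1 (Eventually.of_forall fun s => ?_)
  refine sum_mem fun n _ => ?_
  change ((n.factorial : ℂ)⁻¹ • U ^ n : E →L[ℂ] E) x ∈ S
  rw [smul_apply]
  refine S.smul_mem _ ?_
  have hpow : ∀ n : ℕ, (U ^ n) x ∈ S := by
    intro n
    induction n with
    | zero => simpa
    | succ n ih => rw [pow_succ']; exact hU _ ih
  exact hpow n

theorem exp_conj_mem {S : Submodule ℂ A} (hS : IsClosed (S : Set A)) {a : A}
    (ha : ∀ x ∈ S, a * x - x * a ∈ S) {x : A} (hx : x ∈ S) :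
    NormedSpace.exp a * x * NormedSpace.exp (-a) ∈ S := by
  rw [← exp_mulL_sub_mulR]
  exact exp_apply_mem hS ha hx

theorem SpectralBound.conj {r : ℝ} {a : A} (h : SpectralBound r a) {u v : A} (hvu : v * u = 1)
    (huv : u * v = 1) : SpectralBound r (u * a * v) := by
  have hpow : ∀ n, (u * a * v) ^ n = u * a ^ n * v := by
    intro n
    induction n with
    | zero => simp [huv]
    | succ n ih =>
      calc (u * a * v) ^ (n + 1) = u * a ^ n * (v * u) * a * v := by
            rw [pow_succ, ih]; simp only [mul_assoc]
        _ = _ := by rw [hvu, mul_one, pow_succ]; simp only [mul_assoc]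
  intro θ hθ
  obtain ⟨C, hC⟩ := h θ hθ
  refine ⟨‖u‖ * C * ‖v‖, fun n => ?_⟩
  rw [hpow]
  calc ‖u * a ^ n * v‖ ≤ ‖u‖ * ‖a ^ n‖ * ‖v‖ := norm_mul₃_le
    _ ≤ ‖u‖ * (C * θ ^ n) * ‖v‖ := by gcongr; exact hC n
    _ = _ := by ring

theorem spectralBound_norm (a : A) : SpectralBound ‖a‖ a := by
  intro θ hθ
  refine ⟨‖(1 : A)‖ + 1, fun n => ?_⟩
  have hθ0 : 0 < θ := (norm_nonneg a).trans_lt hθ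
  rcases Nat.eq_zero_or_pos n with rfl | hn
  · simp
  · calc ‖a ^ n‖ ≤ ‖a‖ ^ n := norm_pow_le' a hn
      _ ≤ 1 * θ ^ n := by rw [one_mul]; gcongr
      _ ≤ _ := by gcongr; linarith [norm_nonneg (1 : A)]

end Exp

section Trace

variable {W : Type*} [NormedAddCommGroup W] [NormedSpace ℂ W] [FiniteDimensional ℂ W]

theorem norm_trace_le {T : W →L[ℂ] W} {r : ℝ} (hr : 0 ≤ r) (h : SpectralBound r T) :
    ‖LinearMap.trace ℂ W (T : W →ₗ[ℂ] W)‖ ≤ Module.finrank ℂ W * r := by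
  have := FiniteDimensional.complete ℂ W
  rw [Module.End.trace_eq_sum_roots_charpoly_of_splits (IsAlgClosed.splits _)]
  have hroot : ∀ μ ∈ (LinearMap.charpoly (T : W →ₗ[ℂ] W)).roots, ‖μ‖ ≤ r := by
    intro μ hμ
    have h1 := Polynomial.isRoot_of_mem_roots hμ
    rw [← Module.End.hasEigenvalue_iff_isRoot_charpoly] at h1
    obtain ⟨v, hv⟩ := h1.exists_hasEigenvector
    exact h.norm_le hr (mem_spectrum_of_apply_eq_smul hv.2 hv.apply_eq_smul)
  have hcard : (LinearMap.charpoly (T : W →ₗ[ℂ] W)).roots.card ≤ Module.finrank ℂ W := by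
    rw [← LinearMap.charpoly_natDegree (T : W →ₗ[ℂ] W)]
    exact Polynomial.card_roots' _
  generalize (LinearMap.charpoly (T : W →ₗ[ℂ] W)).roots = s at hroot hcard
  calc ‖s.sum‖ ≤ (s.map norm).sum := norm_multiset_sum_le s
    _ ≤ (s.map norm).card • r := Multiset.sum_le_card_nsmul _ _ (by simpa using hroot)
    _ ≤ _ := by
      rw [Multiset.card_map, nsmul_eq_mul]
      gcongr

theorem SubmulLie.trace_mul_commutator {L : Submodule ℂ (W →L[ℂ] W)} (hL : SubmulLie L)
    {A C D : W →L[ℂ] W} (hA : A ∈ L) (hC : C ∈ L) (hD : D ∈ L) :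
    LinearMap.trace ℂ W (D * (A * C - C * A) : W →L[ℂ] W) = 0 := by
  have := FiniteDimensional.complete ℂ W
  let tr : (W →L[ℂ] W) →L[ℂ] ℂ := LinearMap.toContinuousLinearMap
    (LinearMap.trace ℂ W ∘ₗ ContinuousLinearMap.coeLM ℂ)
  let f : ℂ → ℂ := fun τ =>
    tr (D * (NormedSpace.exp (τ • A) * C * NormedSpace.exp (τ • -A)))
  have hderiv : ∀ τ, HasDerivAt f (tr (D * ((A * NormedSpace.exp (τ • A)) * C *
      NormedSpace.exp (τ • -A) + NormedSpace.exp (τ • A) * C *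
      (-A * NormedSpace.exp (τ • -A))))) τ := fun τ => by
    refine tr.hasFDerivAt.comp_hasDerivAt τ ((HasDerivAt.mul ?_ ?_).const_mul D)
    · exact (hasDerivAt_exp_smul_const' A τ).mul_const C
    · exact hasDerivAt_exp_smul_const' (-A) τ
  have hbdd : Bornology.IsBounded (Set.range f) := by
    refine isBounded_iff_forall_norm_le.2 ⟨Module.finrank ℂ W * (‖D‖ * ‖C‖), ?_⟩
    rintro _ ⟨τ, rfl⟩
    refine norm_trace_le (by positivity) ?_
    refine hL.submul _ hD _ ?_ _ _ (norm_nonneg _) (norm_nonneg _) (spectralBound_norm _) ?_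
    · rw [smul_neg]
      refine exp_conj_mem L.closed_of_finiteDimensional (fun x hx => ?_) hC
      exact hL.lie _ (L.smul_mem _ hA) _ hx
    · rw [smul_neg]
      exact (spectralBound_norm C).conj (exp_neg_mul_exp _) (exp_mul_exp_neg _)
  have hconst : ∀ τ, f τ = f 0 := fun τ =>
    Differentiable.apply_eq_apply_of_bounded (fun τ => (hderiv τ).differentiableAt) hbdd τ 0
  have h0 := (hderiv 0).unique ((hasDerivAt_const (0 : ℂ) (f 0)).congr_of_eventuallyEq
    (Eventually.of_forall hconst))
  simp only [zero_smul, NormedSpace.exp_zero, mul_one, one_mul, mul_neg, ← sub_eq_add_neg] at h0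
  exact h0

end Trace

section Lie

attribute [local instance] LieRing.ofAssociativeRing

variable {W : Type*} [NormedAddCommGroup W] [NormedSpace ℂ W] [FiniteDimensional ℂ W]

theorem lie_mem_derivedSeries_one {g : Type*} [LieRing g] [LieAlgebra ℂ g] (a b : g) :
    ⁅a, b⁆ ∈ LieAlgebra.derivedSeries ℂ g 1 := by
  rw [LieAlgebra.derivedSeries_def, LieAlgebra.derivedSeriesOfIdeal_succ]
  exact LieSubmodule.lie_mem_lie (by simp) (by simp)

theorem exists_flag_of_trace_eq_zero (g : LieSubalgebra ℂ (Module.End ℂ W))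
    (htr : ∀ A ∈ g, ∀ C ∈ g, ∀ D ∈ g, LinearMap.trace ℂ W (D * (A * C - C * A)) = 0) :
    ∃ F : ℕ → Submodule ℂ W, F 0 = ⊤ ∧ (∃ k, F k = ⊥) ∧ (∀ i, F (i + 1) ≤ F i) ∧
      ∀ a ∈ g, ∀ b ∈ g, ∀ c ∈ g, ∀ d ∈ g, ∀ i, ∀ x ∈ F i,
        ⁅⁅a, b⁆, ⁅c, d⁆⁆ x ∈ F (i + 1) := by
  have h0 : LieModule.traceForm ℂ (LieAlgebra.derivedSeries ℂ g 1) W = 0 := by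
    ext x y
    rw [LieModule.traceForm_apply_apply]
    change LinearMap.trace ℂ W ((x : g) * (y : g) : Module.End ℂ W) = 0
    obtain ⟨y, hy⟩ := y
    change LinearMap.trace ℂ W ((x : g) * y : Module.End ℂ W) = 0
    rw [LieAlgebra.derivedSeries_def, LieAlgebra.derivedSeriesOfIdeal_succ,
      LieAlgebra.derivedSeriesOfIdeal_zero, ← LieSubmodule.mem_toSubmodule,
      LieSubmodule.lieIdeal_oper_eq_linear_span'] at hy
    induction hy using Submodule.span_induction with
    | mem y hy =>
      obtain ⟨a, -, c, -, rfl⟩ := hy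
      exact htr a a.2 c c.2 _ (x : g).2
    | zero => simp
    | add y z _ _ h1 h2 =>
      change LinearMap.trace ℂ W ((x : g) * ((y : Module.End ℂ W) + z)) = 0
      rw [mul_add, map_add, h1, h2, add_zero]
    | smul r y _ h =>
      change LinearMap.trace ℂ W ((x : g) * (r • (y : Module.End ℂ W))) = 0
      rw [mul_smul_comm, map_smul, h, smul_zero]
  have hnil := LieModule.isNilpotent_derivedSeries_of_traceForm_eq_zero h0
  refine ⟨fun i => LieModule.lowerCentralSeries ℂ
    (LieAlgebra.derivedSeries ℂ (LieAlgebra.derivedSeries ℂ g 1) 1) W i, ?_, ?_, ?_, ?_⟩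
  · simp
  · obtain ⟨k, hk⟩ := (LieModule.isNilpotent_iff ℂ _ _).1 hnil
    exact ⟨k, by simp [hk]⟩
  · intro i
    exact LieModule.antitone_lowerCentralSeries ℂ _ W (Nat.le_succ i)
  · intro a ha b hb c hc d hd i x hx
    let u : LieAlgebra.derivedSeries ℂ g 1 :=
      ⟨⁅(⟨a, ha⟩ : g), ⟨b, hb⟩⁆, lie_mem_derivedSeries_one _ _⟩
    let v : LieAlgebra.derivedSeries ℂ g 1 :=
      ⟨⁅(⟨c, hc⟩ : g), ⟨d, hd⟩⁆, lie_mem_derivedSeries_one _ _⟩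
    have huv := lie_mem_derivedSeries_one u v
    change _ ∈ LieModule.lowerCentralSeries ℂ _ W (i + 1)
    rw [LieModule.lowerCentralSeries_succ]
    exact LieSubmodule.lie_mem_lie (LieSubmodule.mem_top (⟨⁅u, v⁆, huv⟩ :
      LieAlgebra.derivedSeries ℂ (LieAlgebra.derivedSeries ℂ g 1) 1)) hx

end Lie

section Ideals

variable {A : Type*} [Ring A] [Algebra ℂ A]

/-- `J` is an ideal of the Lie algebra `L`. -/
structure IsIdeal (L J : Submodule ℂ A) : Prop where
  le : J ≤ L
  lie : ∀ C ∈ L, ∀ B ∈ J, C * B - B * C ∈ J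

/-- The span of the commutators of elements of `J`. -/
def derived (J : Submodule ℂ A) : Submodule ℂ A :=
  Submodule.span ℂ {x | ∃ a ∈ J, ∃ b ∈ J, a * b - b * a = x}

theorem commutator_mem_derived {J : Submodule ℂ A} {a b : A} (ha : a ∈ J) (hb : b ∈ J) :
    a * b - b * a ∈ derived J := Submodule.subset_span ⟨a, ha, b, hb, rfl⟩

theorem IsIdeal.derived_le {L J : Submodule ℂ A} (h : IsIdeal L J) : derived J ≤ J := by
  refine Submodule.span_le.2 ?_
  rintro _ ⟨a, ha, b, hb, rfl⟩
  exact h.lie a (h.le ha) b hb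

theorem IsIdeal.derived {L J : Submodule ℂ A} (h : IsIdeal L J) : IsIdeal L (derived J) := by
  refine ⟨h.derived_le.trans h.le, fun C hC B hB => ?_⟩
  induction hB using Submodule.span_induction with
  | mem x hx =>
    obtain ⟨a, ha, b, hb, rfl⟩ := hx
    have : C * (a * b - b * a) - (a * b - b * a) * C =
        ((C * a - a * C) * b - b * (C * a - a * C)) +
        (a * (C * b - b * C) - (C * b - b * C) * a) := by noncomm_ring
    rw [this]
    exact add_mem (commutator_mem_derived (h.lie C hC a ha) hb)
      (commutator_mem_derived ha (h.lie C hC b hb))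
  | zero => simp
  | add x y _ _ hx hy =>
    have : C * (x + y) - (x + y) * C = (C * x - x * C) + (C * y - y * C) := by noncomm_ring
    rw [this]
    exact add_mem hx hy
  | smul r x _ hx =>
    rw [mul_smul_comm, smul_mul_assoc, ← smul_sub]
    exact Submodule.smul_mem _ r hx

theorem commute_of_derived_eq_bot {J : Submodule ℂ A} (h : derived J = ⊥) {a b : A} (ha : a ∈ J)
    (hb : b ∈ J) : Commute a b := by
  have := commutator_mem_derived ha hb
  rw [h, Submodule.mem_bot, sub_eq_zero] at this
  exact this

theorem isNilpotent_of_mem_adjoin {J : Set A} (hcomm : ∀ a ∈ J, ∀ b ∈ J, Commute a b)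
    (hnil : ∀ a ∈ J, IsNilpotent a) {T : A} (hT : T ∈ NonUnitalAlgebra.adjoin ℂ J) :
    IsNilpotent T := by
  have hc : ∀ a ∈ NonUnitalAlgebra.adjoin ℂ J, ∀ b ∈ NonUnitalAlgebra.adjoin ℂ J,
      Commute a b := fun a ha b hb =>
    NonUnitalAlgebra.commute_of_mem_adjoin_of_forall_mem_commute hb fun c hc =>
      (NonUnitalAlgebra.commute_of_mem_adjoin_of_forall_mem_commute ha fun d hd =>
        hcomm c hc d hd).symm
  induction hT using NonUnitalAlgebra.adjoin_induction with
  | mem x hx => exact hnil x hx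
  | add x y hx hy h1 h2 => exact (hc x hx y hy).isNilpotent_add h1 h2
  | zero => exact IsNilpotent.zero
  | mul x y hx hy h1 h2 => exact (hc x hx y hy).isNilpotent_mul_right h1
  | smul r x _ h => exact h.smul r

theorem commute_pow_mul_eq {B C D : A} (hD : B * C = C * B + D) (hBD : Commute B D) (n : ℕ) :
    B ^ (n + 1) * C = C * B ^ (n + 1) + (n + 1 : ℕ) • (D * B ^ n) := by
  induction n with
  | zero => simpa using hD
  | succ n ih =>
    rw [pow_succ' B (n + 1), mul_assoc, ih, mul_add, ← mul_assoc, hD, mul_smul_comm,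
      ← mul_assoc B D,
      hBD.eq, mul_assoc D B, ← pow_succ', add_mul, mul_assoc C B, ← pow_succ', add_assoc,
      succ_nsmul' (D * B ^ (n + 1)) (n + 1)]

end Ideals

section

variable {X : Type*} [NormedAddCommGroup X] [NormedSpace ℂ X]

theorem Irreducible.pow_eq_zero {L : Submodule ℂ (X →L[ℂ] X)} (hL : Irreducible L)
    {J : Submodule ℂ (X →L[ℂ] X)} (hJ : IsIdeal L J) (hcomm : ∀ a ∈ J, ∀ b ∈ J, Commute a b)
    {B : X →L[ℂ] X} (hB : B ∈ J) (μ : ℂ) {N : ℕ}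
    (hN : ∀ x, ((B - μ • 1) ^ (N + 1)) x = 0 → ((B - μ • 1) ^ N) x = 0)
    {v : X} (hv : v ≠ 0) (hv0 : ((B - μ • 1) ^ N) v = 0) : (B - μ • 1) ^ N = 0 := by
  have hinv : ∀ C ∈ L, ∀ x ∈ ((B - μ • 1) ^ N : X →L[ℂ] X).ker,
      C x ∈ ((B - μ • 1) ^ N : X →L[ℂ] X).ker := by
    intro C hC x hx
    replace hx : ((B - μ • 1) ^ N) x = 0 := hx
    refine hN _ ?_
    have hD := hJ.lie C hC B hB
    have h := commute_pow_mul_eq (B := B - μ • 1) (C := C) (D := -(C * B - B * C))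
      (by simp [sub_mul, mul_sub])
      ((Commute.neg_right (hcomm _ hB _ hD)).sub_left ((Commute.one_left _).smul_left μ)) N
    change ((B - μ • 1) ^ (N + 1) * C) x = 0
    rw [h, pow_succ']
    change C ((B - μ • 1) (((B - μ • 1) ^ N) x)) + ((N + 1 : ℕ) •
      (-(C * B - B * C) * (B - μ • 1) ^ N)) x = 0
    rw [← Nat.cast_smul_eq_nsmul ℂ, smul_apply]
    change _ + _ • (-(C * B - B * C)) (((B - μ • 1) ^ N) x) = 0
    rw [hx]
    simp
  rcases hL _ ((B - μ • 1) ^ N : X →L[ℂ] X).isClosed_ker hinv with h | h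
  · have : v ∈ ((B - μ • 1) ^ N : X →L[ℂ] X).ker := hv0
    rw [h] at this
    exact absurd this hv
  · ext x
    have : x ∈ ((B - μ • 1) ^ N : X →L[ℂ] X).ker := h ▸ Submodule.mem_top
    exact this

theorem finiteDimensional_range_of_mem_adjoin {J : Set (X →L[ℂ] X)}
    (hJ : ∀ a ∈ J, FiniteDimensional ℂ a.range) {T : X →L[ℂ] X}
    (hT : T ∈ NonUnitalAlgebra.adjoin ℂ J) : FiniteDimensional ℂ T.range := by
  induction hT using NonUnitalAlgebra.adjoin_induction with
  | mem x hx => exact hJ x hx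
  | add x y _ _ h1 h2 =>
    refine Submodule.finiteDimensional_of_le (S₂ := x.range ⊔ y.range) ?_
    rintro _ ⟨z, rfl⟩
    exact Submodule.add_mem_sup ⟨z, rfl⟩ ⟨z, rfl⟩
  | zero =>
    refine Submodule.finiteDimensional_of_le (S₂ := ⊥) ?_
    rintro _ ⟨z, rfl⟩
    simp
  | mul x y _ _ h1 h2 =>
    refine Submodule.finiteDimensional_of_le (S₂ := x.range) ?_
    rintro _ ⟨z, rfl⟩
    exact ⟨y z, rfl⟩
  | smul r x _ h =>
    refine Submodule.finiteDimensional_of_le (S₂ := x.range) ?_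
    rintro _ ⟨z, rfl⟩
    exact ⟨r • z, by simp⟩

/-- A commutative ideal of nilpotent operators of finite rank is trivial. -/
theorem Irreducible.eq_bot_of_commute {L : Submodule ℂ (X →L[ℂ] X)} (hL : Irreducible L)
    {J : Submodule ℂ (X →L[ℂ] X)} (hJ : IsIdeal L J) (hcomm : ∀ a ∈ J, ∀ b ∈ J, Commute a b)
    (hnil : ∀ a ∈ J, IsNilpotent a) (hfin : ∀ a ∈ J, FiniteDimensional ℂ a.range) : J = ⊥ := by
  rw [eq_bot_iff]
  intro B hB
  exact hL.eq_zero_of_nilpotent (I := (J : Set (X →L[ℂ] X))) (fun C hC B hB => hJ.lie C hC B hB)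
    (fun T hT => ⟨isNilpotent_of_mem_adjoin hcomm hnil hT,
      finiteDimensional_range_of_mem_adjoin hfin hT⟩) hB

theorem exists_ker_pow_stable {T : X →L[ℂ] X} (hT : FiniteDimensional ℂ T.range) (μ : ℂ)
    (h : μ = 0 ∨ FiniteDimensional ℂ X) :
    ∃ N, 0 < N ∧ ∀ x, ((T - μ • 1) ^ (N + 1)) x = 0 → ((T - μ • 1) ^ N) x = 0 := by
  set S := T - μ • (1 : X →L[ℂ] X) with hS
  have hSfin : FiniteDimensional ℂ S.range := by
    rcases h with rfl | h
    · have : S = T := by simp [hS]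
      rwa [this]
    · infer_instance
  let f : ℕ →o Submodule ℂ S.range :=
    ⟨fun n => (S ^ n : X →L[ℂ] X).ker.comap S.range.subtype,
      monotone_nat_of_le_succ fun n x hx => by
      replace hx : (S ^ n) x = 0 := hx
      change (S ^ (n + 1)) x = 0
      rw [pow_succ']
      change S ((S ^ n) x) = 0
      rw [hx, map_zero]⟩
  obtain ⟨n, hn⟩ := monotone_stabilizes_iff_noetherian.2
    (inferInstance : IsNoetherian ℂ S.range) f
  refine ⟨n + 1, n.succ_pos, fun x hx => ?_⟩
  have hmem : (⟨S x, x, rfl⟩ : S.range) ∈ f (n + 1) := by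
    change (S ^ (n + 1)) (S x) = 0
    rw [pow_succ] at hx
    exact hx
  rw [← hn (n + 1) n.le_succ] at hmem
  rw [pow_succ]
  exact hmem

end

section

variable {X : Type*} [NormedAddCommGroup X] [NormedSpace ℂ X]

/-- The restriction of an operator whose range is contained in `W`. -/
noncomputable def restrictRange (W : Submodule ℂ X) (B : X →L[ℂ] X) (hB : ∀ x, B x ∈ W) :
    W →L[ℂ] W := (B.comp W.subtypeL).codRestrict W fun x => hB x

theorem norm_restrictRange_pow_le (W : Submodule ℂ X) {B : X →L[ℂ] X} (hB : ∀ x, B x ∈ W) (n : ℕ) :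
    ‖restrictRange W B hB ^ n‖ ≤ ‖B ^ n‖ := by
  have h : ∀ (n : ℕ) (x : W), (((restrictRange W B hB) ^ n) x : X) = (B ^ n) x := by
    intro n
    induction n with
    | zero => simp
    | succ n ih =>
      intro x
      rw [pow_succ', pow_succ']
      exact congrArg B (ih x)
  refine ContinuousLinearMap.opNorm_le_bound _ (norm_nonneg _) fun x => ?_
  change ‖(((restrictRange W B hB) ^ n) x : X)‖ ≤ _
  rw [h]
  exact (B ^ n).le_opNorm x

theorem norm_pow_succ_le (W : Submodule ℂ X) {B : X →L[ℂ] X} (hB : ∀ x, B x ∈ W) (n : ℕ) :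
    ‖B ^ (n + 1)‖ ≤ ‖restrictRange W B hB ^ n‖ * ‖B‖ := by
  have h : ∀ (n : ℕ) (x : X), (((restrictRange W B hB) ^ n) ⟨B x, hB x⟩ : X) = (B ^ (n + 1)) x := by
    intro n
    induction n with
    | zero => simp
    | succ n ih =>
      intro x
      rw [pow_succ', pow_succ' B]
      exact congrArg B (ih x)
  refine ContinuousLinearMap.opNorm_le_bound _ (by positivity) fun x => ?_
  rw [← h, mul_assoc]
  exact ((restrictRange W B hB) ^ n).le_opNorm_of_le (B.le_opNorm x)

theorem SpectralBound.restrictRange {W : Submodule ℂ X} {B : X →L[ℂ] X} (hB : ∀ x, B x ∈ W)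
    {r : ℝ} (h : SpectralBound r B) : SpectralBound r (restrictRange W B hB) := fun θ hθ => by
  obtain ⟨C, hC⟩ := h θ hθ
  exact ⟨C, fun n => (norm_restrictRange_pow_le W hB n).trans (hC n)⟩

theorem SpectralBound.of_restrictRange {W : Submodule ℂ X} {B : X →L[ℂ] X} (hB : ∀ x, B x ∈ W)
    {r : ℝ} (hr : 0 ≤ r) (h : SpectralBound r (LieReducible.restrictRange W B hB)) :
    SpectralBound r B := fun θ hθ => by
  obtain ⟨C, hC⟩ := h θ hθ
  have hθ0 : 0 < θ := hr.trans_lt hθ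
  have hC0 : 0 ≤ C := by
    have := (norm_nonneg (LieReducible.restrictRange W B hB ^ 0)).trans (hC 0)
    rwa [pow_zero, mul_one] at this
  refine ⟨‖(1 : X →L[ℂ] X)‖ + C * θ⁻¹ * ‖B‖, fun n => ?_⟩
  cases n with
  | zero => simpa using by positivity
  | succ n =>
    calc ‖B ^ (n + 1)‖ ≤ C * θ ^ n * ‖B‖ :=
          (norm_pow_succ_le W hB n).trans (by gcongr; exact hC n)
      _ = C * θ⁻¹ * ‖B‖ * θ ^ (n + 1) := by rw [pow_succ]; field_simp
      _ ≤ _ := by gcongr; linarith [norm_nonneg (1 : X →L[ℂ] X)]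

/-- The operators on `W` induced by the elements of `L` with range in `W`. -/
noncomputable def restricted (L : Submodule ℂ (X →L[ℂ] X)) (W : Submodule ℂ X) :
    Submodule ℂ (W →L[ℂ] W) where
  carrier := {b | ∃ B ∈ L, ∃ hB : ∀ x, B x ∈ W, restrictRange W B hB = b}
  add_mem' := by
    rintro _ _ ⟨B, hB, hBW, rfl⟩ ⟨C, hC, hCW, rfl⟩
    exact ⟨B + C, add_mem hB hC, fun x => add_mem (hBW x) (hCW x), rfl⟩
  zero_mem' := ⟨0, zero_mem _, fun x => zero_mem W, rfl⟩
  smul_mem' := by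
    rintro c _ ⟨B, hB, hBW, rfl⟩
    exact ⟨c • B, L.smul_mem c hB, fun x => W.smul_mem c (hBW x), rfl⟩

theorem SubmulLie.restricted {L : Submodule ℂ (X →L[ℂ] X)} (hL : SubmulLie L) (W : Submodule ℂ X)
    [FiniteDimensional ℂ W] : SubmulLie (restricted L W) where
  lie := by
    rintro _ ⟨B, hB, hBW, rfl⟩ _ ⟨C, hC, hCW, rfl⟩
    exact ⟨B * C - C * B, hL.lie B hB C hC, fun x => sub_mem (hBW _) (hCW _), rfl⟩
  compact := by
    intro A _
    have := FiniteDimensional.proper ℂ W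
    refine ⟨Metric.closedBall 0 ‖A‖, isCompact_closedBall _ _, ?_⟩
    filter_upwards [Metric.closedBall_mem_nhds (0 : W) one_pos] with x hx
    rw [mem_closedBall_zero_iff] at hx
    simpa using A.le_opNorm_of_le hx
  submul := by
    rintro _ ⟨B, hB, hBW, rfl⟩ _ ⟨C, hC, hCW, rfl⟩ r s hr hs hrB hsC
    have := hL.submul B hB C hC r s hr hs
      (hrB.of_restrictRange hBW hr) (hsC.of_restrictRange hCW hs)
    exact this.restrictRange (W := W) (B := B * C) fun x => hBW _

attribute [local instance] LieRing.ofAssociativeRing in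
theorem SubmulLie.exists_flag {L : Submodule ℂ (X →L[ℂ] X)} (hL : SubmulLie L) (W : Submodule ℂ X)
    (hW : FiniteDimensional ℂ W) :
    ∃ F : ℕ → Submodule ℂ X, F 0 = W ∧ (∃ k, F k = ⊥) ∧ (∀ i, F (i + 1) ≤ F i) ∧
      ∀ a ∈ L, ∀ b ∈ L, ∀ c ∈ L, ∀ d ∈ L, (∀ x, a x ∈ W) → (∀ x, b x ∈ W) → (∀ x, c x ∈ W) →
        (∀ x, d x ∈ W) → ∀ i, ∀ x ∈ F i,
        ((a * b - b * a) * (c * d - d * c) - (c * d - d * c) * (a * b - b * a)) x ∈ F (i + 1) := by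
  have hR := hL.restricted W
  let g : LieSubalgebra ℂ (Module.End ℂ W) :=
    { (LieReducible.restricted L W).map (ContinuousLinearMap.coeLM ℂ) with
      lie_mem' := by
        rintro _ _ ⟨b, hb, rfl⟩ ⟨c, hc, rfl⟩
        exact ⟨_, hR.lie b hb c hc, rfl⟩ }
  obtain ⟨F, h0, ⟨k, hk⟩, hanti, hmap⟩ := exists_flag_of_trace_eq_zero g (by
    rintro _ ⟨a, ha, rfl⟩ _ ⟨c, hc, rfl⟩ _ ⟨d, hd, rfl⟩
    exact hR.trace_mul_commutator ha hc hd)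
  refine ⟨fun i => (F i).map W.subtype, by simp [h0], ⟨k, by simp [hk]⟩,
    fun i => Submodule.map_mono (hanti i), ?_⟩
  intro a ha b hb c hc d hd haW hbW hcW hdW i x hx
  obtain ⟨y, hy, rfl⟩ := hx
  have hg : ∀ e ∈ L, ∀ he : ∀ x, e x ∈ W, (restrictRange W e he : W →ₗ[ℂ] W) ∈ g :=
    fun e he heW => ⟨_, ⟨e, he, heW, rfl⟩, rfl⟩
  exact ⟨_, hmap _ (hg a ha haW) _ (hg b hb hbW) _ (hg c hc hcW) _ (hg d hd hdW) i y hy, rfl⟩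

/-- The elements of `L` of finite rank. -/
def finiteRank (L : Submodule ℂ (X →L[ℂ] X)) : Submodule ℂ (X →L[ℂ] X) where
  carrier := {B | B ∈ L ∧ FiniteDimensional ℂ B.range}
  add_mem' := by
    rintro B C ⟨hB, hB'⟩ ⟨hC, hC'⟩
    refine ⟨add_mem hB hC, Submodule.finiteDimensional_of_le (S₂ := B.range ⊔ C.range) ?_⟩
    rintro _ ⟨z, rfl⟩
    exact Submodule.add_mem_sup ⟨z, rfl⟩ ⟨z, rfl⟩
  zero_mem' := by
    refine ⟨zero_mem _, Submodule.finiteDimensional_of_le (S₂ := ⊥) ?_⟩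
    rintro _ ⟨z, rfl⟩
    simp
  smul_mem' := by
    rintro c B ⟨hB, hB'⟩
    refine ⟨L.smul_mem c hB, Submodule.finiteDimensional_of_le (S₂ := B.range) ?_⟩
    rintro _ ⟨z, rfl⟩
    exact ⟨c • z, by simp⟩

theorem isIdeal_finiteRank {L : Submodule ℂ (X →L[ℂ] X)} (hL : SubmulLie L) :
    IsIdeal L (finiteRank L) where
  le _ h := h.1
  lie := by
    rintro C hC B ⟨hB, hB'⟩
    refine ⟨hL.lie C hC B hB, Submodule.finiteDimensional_of_le
      (S₂ := B.range.map (C : X →ₗ[ℂ] X) ⊔ B.range) ?_⟩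
    rintro _ ⟨z, rfl⟩
    exact sub_mem (Submodule.mem_sup_left ⟨B z, ⟨z, rfl⟩, rfl⟩)
      (Submodule.mem_sup_right ⟨C z, rfl⟩)

theorem isNilpotent_of_mem_adjoin_derived {L : Submodule ℂ (X →L[ℂ] X)} (hL : SubmulLie L)
    {T : X →L[ℂ] X}
    (hT : T ∈ NonUnitalAlgebra.adjoin ℂ (derived (derived (finiteRank L)) : Set (X →L[ℂ] X))) :
    IsNilpotent T := by
  choose F hF0 hFbot hanti hmap using fun (W : Submodule ℂ X) (hW : FiniteDimensional ℂ W) =>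
    hL.exists_flag W hW
  let P : (X →L[ℂ] X) → Prop := fun T => ∃ W0 : Submodule ℂ X, FiniteDimensional ℂ W0 ∧
    ∀ (W : Submodule ℂ X) (hW : FiniteDimensional ℂ W), W0 ≤ W → (∀ x, T x ∈ W) ∧
      ∀ i, ∀ x ∈ F W hW i, T x ∈ F W hW (i + 1)
  have hP0 : P 0 := ⟨⊥, inferInstance, fun W hW _ => ⟨fun x => zero_mem W, fun i x _ => zero_mem _⟩⟩
  have hPadd : ∀ S T, P S → P T → P (S + T) := by
    rintro S T ⟨W1, h1, h1'⟩ ⟨W2, h2, h2'⟩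
    refine ⟨W1 ⊔ W2, inferInstance, fun W hW hle => ?_⟩
    obtain ⟨hS, hS'⟩ := h1' W hW (le_sup_left.trans hle)
    obtain ⟨hT, hT'⟩ := h2' W hW (le_sup_right.trans hle)
    exact ⟨fun x => add_mem (hS x) (hT x), fun i x hx => add_mem (hS' i x hx) (hT' i x hx)⟩
  have hPsmul : ∀ (c : ℂ) T, P T → P (c • T) := by
    rintro c T ⟨W1, h1, h1'⟩
    refine ⟨W1, h1, fun W hW hle => ?_⟩
    obtain ⟨hS, hS'⟩ := h1' W hW hle
    exact ⟨fun x => W.smul_mem c (hS x), fun i x hx => Submodule.smul_mem _ c (hS' i x hx)⟩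
  have hPgen : ∀ x ∈ derived (finiteRank L), ∀ y ∈ derived (finiteRank L), P (x * y - y * x) := by
    intro x hx y hy
    induction hx using Submodule.span_induction with
    | mem x hx =>
      obtain ⟨a, ⟨ha, ha'⟩, b, ⟨hb, hb'⟩, rfl⟩ := hx
      induction hy using Submodule.span_induction with
      | mem y hy =>
        obtain ⟨c, ⟨hc, hc'⟩, d, ⟨hd, hd'⟩, rfl⟩ := hy
        refine ⟨a.range ⊔ b.range ⊔ c.range ⊔ d.range, inferInstance, fun W hW hle => ?_⟩
        have haW : ∀ x, a x ∈ W := fun x => hle (Submodule.mem_sup_left (Submodule.mem_sup_left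
          (Submodule.mem_sup_left ⟨x, rfl⟩)))
        have hbW : ∀ x, b x ∈ W := fun x => hle (Submodule.mem_sup_left (Submodule.mem_sup_left
          (Submodule.mem_sup_right ⟨x, rfl⟩)))
        have hcW : ∀ x, c x ∈ W := fun x => hle (Submodule.mem_sup_left
          (Submodule.mem_sup_right ⟨x, rfl⟩))
        have hdW : ∀ x, d x ∈ W := fun x => hle (Submodule.mem_sup_right ⟨x, rfl⟩)
        exact ⟨fun x => sub_mem (sub_mem (haW _) (hbW _)) (sub_mem (hcW _) (hdW _)),
          hmap W hW a ha b hb c hc d hd haW hbW hcW hdW⟩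
      | zero => simpa using hP0
      | add y z _ _ h1 h2 =>
        rw [mul_add, add_mul, add_sub_add_comm]
        exact hPadd _ _ h1 h2
      | smul r y _ h =>
        rw [mul_smul_comm, smul_mul_assoc, ← smul_sub]
        exact hPsmul _ _ h
    | zero => simpa using hP0
    | add x z _ _ h1 h2 =>
      rw [mul_add, add_mul, add_sub_add_comm]
      exact hPadd _ _ h1 h2
    | smul r x _ h =>
      rw [mul_smul_comm, smul_mul_assoc, ← smul_sub]
      exact hPsmul _ _ h
  have hPT : P T := by
    induction hT using NonUnitalAlgebra.adjoin_induction with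
    | mem x hx =>
      replace hx : x ∈ derived (derived (finiteRank L)) := hx
      induction hx using Submodule.span_induction with
      | mem x hx =>
        obtain ⟨a, ha, b, hb, rfl⟩ := hx
        exact hPgen a ha b hb
      | zero => exact hP0
      | add x z _ _ h1 h2 => exact hPadd _ _ h1 h2
      | smul r x _ h => exact hPsmul _ _ h
    | add x y _ _ h1 h2 => exact hPadd _ _ h1 h2
    | zero => exact hP0
    | mul S T _ _ hS hT =>
      obtain ⟨W1, h1, h1'⟩ := hS
      obtain ⟨W2, h2, h2'⟩ := hT
      refine ⟨W1 ⊔ W2, inferInstance, fun W hW hle => ?_⟩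
      obtain ⟨hS, hS'⟩ := h1' W hW (le_sup_left.trans hle)
      obtain ⟨hT, hT'⟩ := h2' W hW (le_sup_right.trans hle)
      exact ⟨fun x => hS _, fun i x hx => hanti W hW _ (hS' _ _ (hT' i x hx))⟩
    | smul r x _ h => exact hPsmul _ _ h
  obtain ⟨W, hW, h⟩ := hPT
  obtain ⟨hTW, hTF⟩ := h W hW le_rfl
  obtain ⟨k, hk⟩ := hFbot W hW
  have hpow : ∀ i x, (T ^ (i + 1)) x ∈ F W hW i := by
    intro i
    induction i with
    | zero =>
      intro x
      rw [hF0]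
      simpa using hTW x
    | succ i ih =>
      intro x
      rw [pow_succ']
      exact hTF i _ (ih x)
  refine ⟨k + 1, ContinuousLinearMap.ext fun x => ?_⟩
  have := hpow k x
  rw [hk] at this
  exact this

theorem Irreducible.derived_derived_finiteRank {L : Submodule ℂ (X →L[ℂ] X)} (hirr : Irreducible L)
    (hL : SubmulLie L) : derived (derived (finiteRank L)) = ⊥ := by
  have hI := isIdeal_finiteRank hL
  rw [eq_bot_iff]
  intro B hB
  refine hirr.eq_zero_of_nilpotent (I := (derived (derived (finiteRank L)) : Set (X →L[ℂ] X)))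
    hI.derived.derived.lie (fun T hT => ⟨isNilpotent_of_mem_adjoin_derived hL hT,
      finiteDimensional_range_of_mem_adjoin (fun a ha => ?_) hT⟩) hB
  exact (hI.derived_le (hI.derived.derived_le ha)).2

end

section

variable {X : Type*} [NormedAddCommGroup X] [NormedSpace ℂ X]

theorem Irreducible.isNilpotent_of_infiniteDimensional {L J : Submodule ℂ (X →L[ℂ] X)}
    (hirr : Irreducible L) (hX : ¬ FiniteDimensional ℂ X) (hJ : IsIdeal L J)
    (hcomm : ∀ a ∈ J, ∀ b ∈ J, Commute a b) {B : X →L[ℂ] X} (hB : B ∈ J)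
    (hfin : FiniteDimensional ℂ B.range) : IsNilpotent B := by
  obtain ⟨N, hN0, hN⟩ := exists_ker_pow_stable hfin 0 (Or.inl rfl)
  have hker : B.ker ≠ ⊥ := fun h => hX <| by
    have : Function.Injective ((B : X →ₗ[ℂ] X).rangeRestrict) :=
      LinearMap.ker_eq_bot.1 (by rw [LinearMap.ker_rangeRestrict]; exact h)
    exact FiniteDimensional.of_injective _ this
  obtain ⟨v, hv, hv0⟩ := Submodule.exists_mem_ne_zero_of_ne_bot hker
  replace hv : B v = 0 := hv
  refine ⟨N, ?_⟩
  have := hirr.pow_eq_zero hJ hcomm hB 0 hN hv0 (by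
    obtain ⟨k, rfl⟩ := Nat.exists_eq_succ_of_ne_zero hN0.ne'
    simp only [zero_smul, sub_zero, Nat.succ_eq_add_one, pow_succ]
    change (B ^ k) (B v) = 0
    rw [hv, map_zero])
  simpa using this

theorem Irreducible.finiteRank_eq_bot {L : Submodule ℂ (X →L[ℂ] X)} (hirr : Irreducible L)
    (hX : ¬ FiniteDimensional ℂ X) (hL : SubmulLie L) : finiteRank L = ⊥ := by
  have hF := isIdeal_finiteRank hL
  have key : ∀ J, IsIdeal L J → J ≤ finiteRank L → derived J = ⊥ → J = ⊥ := fun J hJ hle h =>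
    hirr.eq_bot_of_commute hJ (fun a ha b hb => commute_of_derived_eq_bot h ha hb)
      (fun a ha => hirr.isNilpotent_of_infiniteDimensional hX hJ
        (fun a ha b hb => commute_of_derived_eq_bot h ha hb) ha (hle ha).2) fun a ha => (hle ha).2
  exact key _ hF le_rfl (key _ hF.derived hF.derived_le (hirr.derived_derived_finiteRank hL))

theorem Irreducible.rank_le_one [FiniteDimensional ℂ X] {L : Submodule ℂ (X →L[ℂ] X)}
    (hirr : Irreducible L) (hL : SubmulLie L) : Module.finrank ℂ X ≤ 1 := by
  rcases subsingleton_or_nontrivial X with hX | hX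
  · simp [Module.finrank_zero_of_subsingleton]
  have hfin : ∀ a : X →L[ℂ] X, FiniteDimensional ℂ a.range := fun a => inferInstance
  have hF := isIdeal_finiteRank hL
  have hJ := hF.derived
  have hJc : ∀ a ∈ derived (finiteRank L), ∀ b ∈ derived (finiteRank L), Commute a b :=
    fun a ha b hb => commute_of_derived_eq_bot (hirr.derived_derived_finiteRank hL) ha hb
  have heig : ∀ B : X →L[ℂ] X, ∃ (μ : ℂ) (v : X), v ≠ 0 ∧ (B - μ • 1) v = 0 := by
    intro B
    obtain ⟨μ, hμ⟩ := Module.End.exists_eigenvalue (B : X →ₗ[ℂ] X)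
    obtain ⟨v, hv⟩ := hμ.exists_hasEigenvector
    refine ⟨μ, v, hv.2, ?_⟩
    have := hv.apply_eq_smul
    rw [sub_smul_one_apply, sub_eq_zero]
    exact this
  have hpow : ∀ J, IsIdeal L J → (∀ a ∈ J, ∀ b ∈ J, Commute a b) → ∀ B ∈ J, ∃ (μ : ℂ) (N : ℕ),
      (B - μ • 1) ^ N = 0 := by
    intro J hJ hJc B hB
    obtain ⟨μ, v, hv, hv0⟩ := heig B
    obtain ⟨N, hN0, hN⟩ := exists_ker_pow_stable (hfin B) μ (Or.inr inferInstance)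
    refine ⟨μ, N, hirr.pow_eq_zero hJ hJc hB μ hN hv ?_⟩
    obtain ⟨k, rfl⟩ := Nat.exists_eq_succ_of_ne_zero hN0.ne'
    rw [Nat.succ_eq_add_one, pow_succ]
    change ((B - μ • 1) ^ k) ((B - μ • 1) v) = 0
    rw [hv0, map_zero]
  have htr : ∀ B ∈ derived (finiteRank L), LinearMap.trace ℂ X B = 0 := by
    intro B hB
    induction hB using Submodule.span_induction with
    | mem x hx =>
      obtain ⟨a, _, b, _, rfl⟩ := hx
      change LinearMap.trace ℂ X ((a : X →ₗ[ℂ] X) * b - (b : X →ₗ[ℂ] X) * a) = 0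
      rw [map_sub, LinearMap.trace_mul_comm, sub_self]
    | zero => simp
    | add x y _ _ hx hy =>
      change LinearMap.trace ℂ X ((x : X →ₗ[ℂ] X) + y) = 0
      rw [map_add, hx, hy, add_zero]
    | smul r x _ hx =>
      change LinearMap.trace ℂ X (r • (x : X →ₗ[ℂ] X)) = 0
      rw [map_smul, hx, smul_zero]
  have hnil : ∀ B ∈ derived (finiteRank L), IsNilpotent B := by
    intro B hB
    obtain ⟨μ, N, h⟩ := hpow _ hJ hJc B hB
    have h1 : IsNilpotent ((B : X →ₗ[ℂ] X) - μ • LinearMap.id : Module.End ℂ X) := by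
      refine ⟨N, LinearMap.ext fun x => ?_⟩
      have h2 : ∀ (n : ℕ) (x : X), ((((B : X →ₗ[ℂ] X) - μ • LinearMap.id : Module.End ℂ X)) ^ n) x =
          ((B - μ • (1 : X →L[ℂ] X)) ^ n) x := by
        intro n
        induction n with
        | zero => intro x; rfl
        | succ n ih =>
          intro x
          rw [pow_succ, pow_succ]
          exact ih _
      rw [h2, h]
      rfl
    have h3 := (LinearMap.isNilpotent_trace_of_isNilpotent h1).eq_zero
    rw [map_sub, map_smul, htr B hB, LinearMap.trace_id, zero_sub, neg_eq_zero, smul_eq_mul,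
      mul_eq_zero] at h3
    have hμ : μ = 0 := h3.resolve_right (by exact_mod_cast Module.finrank_pos.ne')
    exact ⟨N, by simpa [hμ] using h⟩
  have hJ0 : derived (finiteRank L) = ⊥ := hirr.eq_bot_of_commute hJ hJc hnil fun a _ => hfin a
  have hcomm : ∀ a ∈ L, ∀ b ∈ L, Commute a b := fun a ha b hb =>
    commute_of_derived_eq_bot hJ0 ⟨ha, hfin a⟩ ⟨hb, hfin b⟩
  have hscalar : ∀ A ∈ L, ∃ μ : ℂ, A - μ • 1 = 0 := by
    intro A hA
    obtain ⟨μ, v, hv, hv0⟩ := heig A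
    refine ⟨μ, ?_⟩
    rcases hirr (A - μ • 1 : X →L[ℂ] X).ker (A - μ • 1 : X →L[ℂ] X).isClosed_ker (by
      intro C hC x hx
      replace hx : (A - μ • 1) x = 0 := hx
      change ((A - μ • 1) * C) x = 0
      rw [((hcomm A hA C hC).sub_left ((Commute.one_left _).smul_left μ)).eq]
      change C ((A - μ • 1) x) = 0
      rw [hx, map_zero]) with h | h
    · have : v ∈ (A - μ • 1 : X →L[ℂ] X).ker := hv0
      rw [h] at this
      exact absurd this hv
    · ext x
      have : x ∈ (A - μ • 1 : X →L[ℂ] X).ker := h ▸ Submodule.mem_top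
      exact this
  obtain ⟨v, hv⟩ := exists_ne (0 : X)
  rcases hirr (Submodule.span ℂ {v}) (Submodule.closed_of_finiteDimensional _) (by
    intro A hA x hx
    obtain ⟨μ, hμ⟩ := hscalar A hA
    rw [sub_eq_zero.1 hμ]
    exact Submodule.smul_mem _ μ hx) with h | h
  · exact absurd (Submodule.span_singleton_eq_bot.1 h) hv
  · rw [← finrank_top ℂ X, ← h]
    exact (finrank_span_singleton hv).le

end

section

variable {X : Type*} [NormedAddCommGroup X] [NormedSpace ℂ X]

theorem totallyBounded_image_closedBall {A : X →L[ℂ] X} (hA : IsCompactOperator A) (r : ℝ) :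
    TotallyBounded (A '' Metric.closedBall (0 : X) r) := by
  obtain ⟨K, hK, hAK⟩ := IsCompactOperator.image_closedBall_subset_compact (𝕜₁ := ℂ) (𝕜₂ := ℂ)
    (f := (A : X →ₗ[ℂ] X)) hA r
  exact hK.totallyBounded.subset hAK

/-- Two-sided multiplication by compact operators is a compact map. -/
theorem totallyBounded_mul_mul {A B : X →L[ℂ] X} (hA : IsCompactOperator A)
    (hB : IsCompactOperator B) (r : ℝ) :
    TotallyBounded ((fun C => A * C * B) '' Metric.closedBall (0 : X →L[ℂ] X) r) := by
  refine Metric.totallyBounded_of_finite_discretization fun ε hε => ?_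
  set δ : ℝ := ε / 4 / (2 * |r| * ‖A‖ + 1) with hδ
  have hδ0 : 0 < δ := by positivity
  obtain ⟨t, htB, htf, ht⟩ := Metric.finite_approx_of_totallyBounded
    (totallyBounded_image_closedBall hB 1) δ hδ0
  obtain ⟨s, -, hsf, hs⟩ := Metric.finite_approx_of_totallyBounded
    (totallyBounded_image_closedBall hA (|r| * ‖B‖)) (ε / 8) (by positivity)
  have hval : ∀ C : X →L[ℂ] X, ‖C‖ ≤ r → ∀ y ∈ t, ∃ z ∈ s, dist (A (C y)) z < ε / 8 := by
    intro C hC y hy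
    obtain ⟨x, hx, rfl⟩ := htB hy
    rw [mem_closedBall_zero_iff] at hx
    have : A (C (B x)) ∈ ⋃ z ∈ s, Metric.ball z (ε / 8) := hs ⟨C (B x), by
      rw [mem_closedBall_zero_iff]
      refine C.le_of_opNorm_le_of_le (hC.trans (le_abs_self r)) ?_
      simpa using B.le_opNorm_of_le hx, rfl⟩
    simpa using this
  choose! f hfs hf using hval
  choose c hc hcS using fun D : ((fun C => A * C * B) '' Metric.closedBall (0 : X →L[ℂ] X) r) => D.2
  have hc' : ∀ D, ‖c D‖ ≤ r := fun D => mem_closedBall_zero_iff.1 (hc D)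
  have := htf.to_subtype
  have := hsf.to_subtype
  refine ⟨t → s, Fintype.ofFinite _, fun D y => ⟨f (c D) y, hfs _ (hc' D) _ y.2⟩, ?_⟩
  intro D D' hDD
  have hclose : ∀ y ∈ t, ‖A ((c D - c D') y)‖ ≤ ε / 4 := by
    intro y hy
    have h1 := hf _ (hc' D) y hy
    have h2 := hf _ (hc' D') y hy
    have h3 : f (c D) y = f (c D') y := congrArg Subtype.val (congrFun hDD ⟨y, hy⟩)
    rw [← h3] at h2
    have h4 := dist_triangle_right (A (c D y)) (A (c D' y)) (f (c D) y)
    rw [dist_eq_norm, ← map_sub] at h4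
    change ‖A (c D y - c D' y)‖ ≤ _
    linarith
  rw [← hcS D, ← hcS D', dist_eq_norm]
  refine lt_of_le_of_lt (b := ε / 2) ?_ (by linarith)
  have hEq : A * c D * B - A * c D' * B = A * (c D - c D') * B := by noncomm_ring
  change ‖A * c D * B - A * c D' * B‖ ≤ _
  rw [hEq]
  refine ContinuousLinearMap.opNorm_le_of_unit_norm (by positivity) fun x hx => ?_
  have hmem : B x ∈ ⋃ y ∈ t, Metric.ball y δ := ht ⟨x, mem_closedBall_zero_iff.2 hx.le, rfl⟩
  simp only [Set.mem_iUnion, Metric.mem_ball, dist_eq_norm] at hmem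
  obtain ⟨y, hy, hyx⟩ := hmem
  have hD : ‖c D - c D'‖ ≤ 2 * |r| := by
    have h1 := (hc' D).trans (le_abs_self r)
    have h2 := (hc' D').trans (le_abs_self r)
    linarith [norm_sub_le (c D) (c D')]
  have h1 : ‖A ((c D - c D') (B x - y))‖ ≤ ‖A‖ * (2 * |r| * δ) :=
    A.le_opNorm_of_le (ContinuousLinearMap.le_of_opNorm_le_of_le _ hD hyx.le)
  have h2 : ‖A‖ * (2 * |r| * δ) ≤ ε / 4 := by
    have : (2 * |r| * ‖A‖ + 1) * δ = ε / 4 := by rw [hδ]; field_simp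
    nlinarith
  have h3 : A ((c D - c D') (B x)) = A ((c D - c D') (B x - y)) + A ((c D - c D') y) := by
    rw [← map_add, ← map_add, sub_add_cancel]
  change ‖A ((c D - c D') (B x))‖ ≤ _
  rw [h3]
  linarith [norm_add_le (A ((c D - c D') (B x - y))) (A ((c D - c D') y)), hclose y hy]

theorem exists_isCompact_mul_mul [CompleteSpace X] {A B : X →L[ℂ] X} (hA : IsCompactOperator A)
    (hB : IsCompactOperator B) (r : ℝ) :
    ∃ K : Set (X →L[ℂ] X), IsCompact K ∧ ∀ C, ‖C‖ ≤ r → A * C * B ∈ K :=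
  ⟨_, (totallyBounded_mul_mul hA hB r).closure.isCompact_of_isClosed isClosed_closure,
    fun C hC => subset_closure ⟨C, mem_closedBall_zero_iff.2 hC, rfl⟩⟩

end

section

variable {A : Type*} [NormedRing A] [NormedAlgebra ℂ A] [CompleteSpace A]

/-- The spectrum of a difference of commuting elements. -/
theorem spectrum_sub_subset {a b : A} (h : Commute a b) :
    spectrum ℂ (a - b) ⊆ Set.image2 (· - ·) (spectrum ℂ a) (spectrum ℂ b) := by
  intro z hz
  let C := Subalgebra.centralizer ℂ ({a, b} : Set A)
  let S := Subalgebra.centralizer ℂ (C : Set A)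
  have haS : a ∈ S := Subalgebra.mem_centralizer_iff ℂ |>.2 fun g hg =>
    ((Subalgebra.mem_centralizer_iff ℂ).1 hg a (by simp)).symm
  have hbS : b ∈ S := Subalgebra.mem_centralizer_iff ℂ |>.2 fun g hg =>
    ((Subalgebra.mem_centralizer_iff ℂ).1 hg b (by simp)).symm
  have hSC : S ≤ C := by
    refine Subalgebra.centralizer_le ℂ _ _ ?_
    rintro x (rfl | rfl)
    · refine (Subalgebra.mem_centralizer_iff ℂ).2 ?_
      rintro g (rfl | rfl)
      · rfl
      · exact h.eq.symm
    · refine (Subalgebra.mem_centralizer_iff ℂ).2 ?_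
      rintro g (rfl | rfl)
      · exact h.eq
      · rfl
  have hclosed : IsClosed (S : Set A) := by
    have : (S : Set A) = ⋂ g ∈ C, {x | g * x = x * g} := by
      ext x
      simp only [Set.mem_iInter]
      exact Subalgebra.mem_centralizer_iff ℂ
    rw [this]
    exact isClosed_biInter fun g _ => isClosed_eq (by fun_prop) (by fun_prop)
  let _ : NormedCommRing S :=
    { (inferInstance : NormedRing S) with
      mul_comm := fun x y => Subtype.ext
        ((Subalgebra.mem_centralizer_iff ℂ).1 y.2 x (hSC x.2)) }
  have : CompleteSpace S := hclosed.completeSpace_coe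
  have hspec : ∀ x : S, spectrum ℂ x ⊆ spectrum ℂ (x : A) := by
    intro x w hw hu
    obtain ⟨u, hu⟩ := hu
    refine hw ⟨⟨algebraMap ℂ S w - x, ⟨↑u⁻¹, ?_⟩, ?_, ?_⟩, rfl⟩
    · refine (Subalgebra.mem_centralizer_iff ℂ).2 fun g hg => ?_
      have : Commute g (u : A) := by
        rw [hu]
        exact Commute.sub_right (Algebra.commutes w g).symm
          ((Subalgebra.mem_centralizer_iff ℂ).1 x.2 g hg)
      exact this.units_inv_right
    · refine Subtype.ext ?_
      change (algebraMap ℂ A w - x) * ↑u⁻¹ = 1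
      rw [← hu, u.mul_inv]
    · refine Subtype.ext ?_
      change ↑u⁻¹ * (algebraMap ℂ A w - x) = 1
      rw [← hu, u.inv_mul]
  have hz' : z ∈ spectrum ℂ (⟨a, haS⟩ - ⟨b, hbS⟩ : S) := spectrum.subset_subalgebra _ hz
  obtain ⟨f, hf⟩ := WeakDual.CharacterSpace.mem_spectrum_iff_exists.1 hz'
  refine ⟨_, hspec ⟨a, haS⟩ (AlgHom.apply_mem_spectrum f _), _,
    hspec ⟨b, hbS⟩ (AlgHom.apply_mem_spectrum f _), ?_⟩
  rw [← hf]
  exact (map_sub f _ _).symm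

theorem mulL_sub_smul (a : A) (z : ℂ) : z • 1 - mulL a = mulL (z • 1 - a) := by
  ext x
  change z • x - a * x = (z • 1 - a) * x
  rw [sub_mul, smul_mul_assoc, one_mul]

theorem mulR_sub_smul (a : A) (z : ℂ) : z • 1 - mulR a = mulR (z • 1 - a) := by
  ext x
  change z • x - x * a = x * (z • 1 - a)
  rw [mul_sub, mul_smul_comm, mul_one]

theorem spectrum_mulL_subset (a : A) : spectrum ℂ (mulL a) ⊆ spectrum ℂ a := by
  intro z hz hu
  refine hz ?_
  rw [spectrum.mem_resolventSet_iff, Algebra.algebraMap_eq_smul_one] at hu ⊢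
  obtain ⟨u, hu⟩ := hu
  rw [mulL_sub_smul, ← hu]
  refine ⟨⟨mulL u, mulL ↑u⁻¹, ?_, ?_⟩, rfl⟩ <;> ext x <;> change _ * (_ * x) = x <;> simp

theorem spectrum_mulR_subset (a : A) : spectrum ℂ (mulR a) ⊆ spectrum ℂ a := by
  intro z hz hu
  refine hz ?_
  rw [spectrum.mem_resolventSet_iff, Algebra.algebraMap_eq_smul_one] at hu ⊢
  obtain ⟨u, hu⟩ := hu
  rw [mulR_sub_smul, ← hu]
  refine ⟨⟨mulR u, mulR ↑u⁻¹, ?_, ?_⟩, rfl⟩ <;> ext x <;> change x * _ * _ = x <;> simp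

theorem commute_mulL_mulR (a b : A) : Commute (mulL a) (mulR b) := by
  ext x
  exact (mul_assoc _ _ _).symm

theorem countable_spectrum_ad {a : A} (h : (spectrum ℂ a).Countable) :
    (spectrum ℂ (mulL a - mulR a)).Countable :=
  (h.image2 h _).mono ((spectrum_sub_subset (commute_mulL_mulR a a)).trans
    (Set.image2_subset (spectrum_mulL_subset a) (spectrum_mulR_subset a)))

end

section

variable {E : Type*} [NormedAddCommGroup E] [NormedSpace ℂ E] [CompleteSpace E]

/-- A closed subspace invariant under an operator with countable spectrum is invariant under the
resolvent. -/
theorem resolvent_apply_mem {U : E →L[ℂ] E} (hU : (spectrum ℂ U).Countable) {S : Submodule ℂ E}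
    (hS : IsClosed (S : Set E)) (hUS : ∀ x ∈ S, U x ∈ S) {z : ℂ} (hz : z ∉ spectrum ℂ U) {x : E}
    (hx : x ∈ S) : resolvent U z x ∈ S := by
  let T : Subalgebra ℂ (E →L[ℂ] E) :=
    { carrier := {V | ∀ x ∈ S, V x ∈ S}
      mul_mem' := fun hV hW x hx => hV _ (hW _ hx)
      one_mem' := fun x hx => hx
      add_mem' := fun hV hW x hx => S.add_mem (hV _ hx) (hW _ hx)
      zero_mem' := fun x _ => S.zero_mem
      algebraMap_mem' := fun r x hx => S.smul_mem r hx }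
  have hT : IsClosed (T : Set (E →L[ℂ] E)) := by
    have : (T : Set (E →L[ℂ] E)) = ⋂ x ∈ S, {V | V x ∈ (S : Set E)} := by
      ext V
      simp only [Set.mem_iInter]
      rfl
    rw [this]
    exact isClosed_biInter fun x _ => hS.preimage (by fun_prop)
  have hpre : IsPreconnected (spectrum ℂ ((⟨U, hUS⟩ : T) : E →L[ℂ] E))ᶜ :=
    (hU.isConnected_compl_of_one_lt_rank (by simp)).isPreconnected
  have hspec := Subalgebra.spectrum_eq_of_isPreconnected_compl T ⟨U, hUS⟩ hpre
  have hz' : z ∉ spectrum ℂ (⟨U, hUS⟩ : T) := by rwa [hspec]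
  obtain ⟨u, hu⟩ := not_not.1 hz'
  have hres : resolvent U z = ((↑u⁻¹ : T) : E →L[ℂ] E) := by
    have h1 : (algebraMap ℂ (E →L[ℂ] E) z - U) * ((↑u⁻¹ : T) : E →L[ℂ] E) = 1 := by
      have := congrArg (Subtype.val : T → E →L[ℂ] E) u.mul_inv
      rw [hu] at this
      exact this
    have h2 : ((↑u⁻¹ : T) : E →L[ℂ] E) * (algebraMap ℂ (E →L[ℂ] E) z - U) = 1 := by
      have := congrArg (Subtype.val : T → E →L[ℂ] E) u.inv_mul
      rw [hu] at this
      exact this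
    exact Ring.inverse_unit ⟨_, _, h1, h2⟩
  rw [hres]
  exact (↑u⁻¹ : T).2 x hx

end

section

variable {E : Type*} [NormedAddCommGroup E] [NormedSpace ℂ E] [CompleteSpace E]

theorem clm_circleIntegral {F : Type*} [NormedAddCommGroup F] [NormedSpace ℂ F] [CompleteSpace F]
    (T : E →L[ℂ] F) {f : ℂ → E} {s : ℝ} (hf : CircleIntegrable f 0 s) :
    T (∮ z in C(0, s), f z) = ∮ z in C(0, s), T (f z) := by
  simp only [circleIntegral]
  rw [← ContinuousLinearMap.intervalIntegral_comp_comm T hf.out]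
  simp only [map_smul]

theorem circleIntegral_mem {S : Submodule ℂ E} (hS : IsClosed (S : Set E)) {f : ℂ → E} {s : ℝ}
    (hs : 0 ≤ s) (hf : CircleIntegrable f 0 s) (h : ∀ z ∈ Metric.sphere (0 : ℂ) s, f z ∈ S) :
    (∮ z in C(0, s), f z) ∈ S := by
  have : IsClosed (S : Set E) := hS
  rw [← Submodule.Quotient.mk_eq_zero]
  change S.mkQL _ = 0
  rw [clm_circleIntegral S.mkQL hf, circleIntegral.integral_congr (g := fun _ => 0) hs]
  · simp [circleIntegral]
  · intro z hz
    exact (Submodule.Quotient.mk_eq_zero S).2 (h z hz)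

/-- The part of a vector lying in the spectral subspace of a disc whose boundary circle misses the
spectrum. -/
theorem exists_spectral_part {U : E →L[ℂ] E} (hU : (spectrum ℂ U).Countable) {S : Submodule ℂ E}
    (hS : IsClosed (S : Set E)) (hUS : ∀ x ∈ S, U x ∈ S) {x : E} (hx : x ∈ S) {s : ℝ} (hs : 0 < s)
    (hsU : ∀ z ∈ spectrum ℂ U, ‖z‖ ≠ s) :
    ∃ D ∈ S, ∃ c, 0 ≤ c ∧ (∀ n, ‖(U ^ n) D‖ ≤ c * s ^ n) ∧
      ∀ k : ℕ, ∃ J, ‖J‖ ≤ c * (s ^ (k + 1))⁻¹ ∧ x - D = (U ^ (k + 1)) J := by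
  have hsph : ∀ z ∈ Metric.sphere (0 : ℂ) s, z ∈ resolventSet ℂ U := fun z hz =>
    not_not.1 fun h => hsU z h (mem_sphere_zero_iff_norm.1 hz)
  have hcont : ContinuousOn (fun z => resolvent U z x) (Metric.sphere (0 : ℂ) s) := fun z hz =>
    ((spectrum.hasDerivAt_resolvent_const_left (hsph z hz)).continuousAt.clm_apply
      continuousAt_const).continuousWithinAt
  have hz0 : ∀ z ∈ Metric.sphere (0 : ℂ) s, z ≠ 0 := by
    rintro z hz rfl
    simp only [mem_sphere_zero_iff_norm, norm_zero] at hz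
    exact hs.ne hz
  have hcn : ∀ n : ℤ, ContinuousOn (fun z => z ^ n • resolvent U z x) (Metric.sphere (0 : ℂ) s) :=
    fun n => (continuousOn_id.zpow₀ n fun z hz => Or.inl (hz0 z hz)).smul hcont
  have hint : ∀ n : ℤ, CircleIntegrable (fun z => z ^ n • resolvent U z x) 0 s :=
    fun n => (hcn n).circleIntegrable hs.le
  have hres : ∀ z ∈ Metric.sphere (0 : ℂ) s,
      U (resolvent U z x) = z • resolvent U z x - x := by
    intro z hz
    have h1 : (algebraMap ℂ (E →L[ℂ] E) z - U) * resolvent U z = 1 :=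
      Ring.mul_inverse_cancel _ (hsph z hz)
    have h2 : z • resolvent U z x - U (resolvent U z x) = x := DFunLike.congr_fun h1 x
    exact eq_sub_of_add_eq' (sub_eq_iff_eq_add.1 h2).symm
  let I : ℤ → E := fun n => ∮ z in C(0, s), z ^ n • resolvent U z x
  have hUI : ∀ n : ℤ, U (I n) = I (n + 1) - (∮ z in C(0, s), z ^ n) • x := by
    intro n
    simp only [I]
    rw [clm_circleIntegral U (hint n), ← circleIntegral.integral_smul_const,
      ← circleIntegral.integral_sub (hint (n + 1)) _]
    · refine circleIntegral.integral_congr hs.le fun z hz => ?_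
      simp only [map_smul]
      rw [hres z hz, smul_sub, smul_smul, zpow_add_one₀ (hz0 z hz)]
    · refine ContinuousOn.circleIntegrable hs.le ?_
      exact (continuousOn_id.zpow₀ n fun z hz => Or.inl (hz0 z hz)).smul continuousOn_const
  have hI0 : ∀ n : ℤ, n ≠ -1 → U (I n) = I (n + 1) := by
    intro n hn
    have := circleIntegral.integral_sub_zpow_of_ne hn 0 0 s
    simp only [sub_zero] at this
    rw [hUI, this, zero_smul, sub_zero]
  have hI1 : U (I (-1)) = I 0 - (2 * Real.pi * Complex.I : ℂ) • x := by
    have := circleIntegral.integral_sub_center_inv 0 hs.ne'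
    simp only [sub_zero] at this
    rw [hUI]
    simp [this]
  obtain ⟨M, hM⟩ := (isCompact_sphere (0 : ℂ) s).exists_bound_of_continuousOn hcont
  have hM0 : 0 ≤ M := (norm_nonneg _).trans (hM s (by simp [abs_of_pos hs]))
  have hIn : ∀ n : ℤ, ‖(2 * Real.pi * Complex.I : ℂ)⁻¹ • I n‖ ≤ s * M * s ^ n := by
    intro n
    refine (circleIntegral.norm_two_pi_i_inv_smul_integral_le_of_norm_le_const hs.le
      (C := s ^ n * M) fun z hz => ?_).trans (by ring_nf; rfl)
    rw [norm_smul, norm_zpow, mem_sphere_zero_iff_norm.1 hz]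
    gcongr
    exact hM z hz
  have hπ : (2 * Real.pi * Complex.I : ℂ) ≠ 0 := Complex.two_pi_I_ne_zero
  refine ⟨(2 * Real.pi * Complex.I : ℂ)⁻¹ • I 0, S.smul_mem _ (circleIntegral_mem hS hs.le (hint 0)
    fun z hz => S.smul_mem _ (resolvent_apply_mem hU hS hUS (not_not.2 (hsph z hz)) hx)),
    s * M, by positivity, fun n => ?_, fun k => ?_⟩
  · have : (U ^ n) (I 0) = I n := by
      induction n with
      | zero => rfl
      | succ n ih =>
        rw [pow_succ']
        change U ((U ^ n) (I 0)) = _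
        rw [ih, hI0 n (by omega)]
        rfl
    rw [map_smul, this]
    exact_mod_cast hIn n
  · have : ∀ k : ℕ, (U ^ (k + 1)) (I (-1 - k)) = I 0 - (2 * Real.pi * Complex.I : ℂ) • x := by
      intro k
      induction k with
      | zero => simpa using hI1
      | succ k ih =>
        rw [pow_succ]
        change (U ^ (k + 1)) (U _) = _
        rw [hI0 _ (by omega), ← ih]
        congr 2
        push_cast
        ring
    refine ⟨-((2 * Real.pi * Complex.I : ℂ)⁻¹ • I (-1 - k)), ?_, ?_⟩
    · rw [norm_neg]
      refine (hIn _).trans_eq ?_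
      rw [← zpow_natCast, ← zpow_neg]
      congr 2
      push_cast
      ring
    · rw [map_neg, map_smul, this, smul_sub, smul_smul, inv_mul_cancel₀ hπ, one_smul, neg_sub]

end

section

open Polynomial

variable {X : Type*} [NormedAddCommGroup X] [NormedSpace ℂ X] [CompleteSpace X]

theorem finiteDimensional_ker_aeval {A : X →L[ℂ] X} (hA : IsCompactOperator A) {q : ℂ[X]}
    (hq : q.eval 0 ≠ 0) : FiniteDimensional ℂ (aeval A q : X →L[ℂ] X).ker := by
  have h : aeval A q = A * aeval A q.divX - (-q.eval 0) • (1 : X →L[ℂ] X) := by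
    conv_lhs => rw [← divX_mul_X_add q]
    rw [map_add, map_mul, aeval_X, aeval_C, Algebra.algebraMap_eq_smul_one, neg_smul,
      sub_neg_eq_add, coeff_zero_eq_eval_zero]
    congr 1
    have := congrArg (aeval A) (mul_comm q.divX Polynomial.X)
    simpa using this
  rw [h]
  exact finiteDimensional_ker_sub (hA.comp_clm _) (neg_ne_zero.2 hq)

theorem commute_aeval_pow (A : X →L[ℂ] X) (q : ℂ[X]) (n : ℕ) :
    A ^ n * aeval A q = aeval A q * A ^ n := by
  have := congrArg (aeval A) (mul_comm (Polynomial.X ^ n) q)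
  simpa using this

theorem coe_restrict_pow {A : X →L[ℂ] X} {R : Submodule ℂ X} (hR : ∀ x ∈ R, A x ∈ R) (n : ℕ)
    (x : R) : (((A.restrict hR) ^ n) x : X) = (A ^ n) x := by
  induction n with
  | zero => rfl
  | succ n ih =>
    rw [pow_succ', pow_succ']
    exact congrArg A ih

theorem isUnit_aeval_of_spectrum {Y : Type*} [NormedAddCommGroup Y] [NormedSpace ℂ Y]
    [CompleteSpace Y] {B : Y →L[ℂ] Y} {q : ℂ[X]} (h : ∀ z ∈ spectrum ℂ B, q.eval z ≠ 0) :
    IsUnit (aeval B q) := by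
  obtain hsub | hnt := subsingleton_or_nontrivial Y
  · exact isUnit_of_subsingleton _
  by_contra hn
  have h0 : (0 : ℂ) ∈ spectrum ℂ (aeval B q) := (spectrum.zero_mem_iff ℂ).2 hn
  rw [spectrum.map_polynomial_aeval_of_nonempty B q (spectrum.nonempty B)] at h0
  obtain ⟨z, hz, hz0⟩ := h0
  exact h z hz hz0

theorem exists_norm_pow_le_of_spectrum {Y : Type*} [NormedAddCommGroup Y] [NormedSpace ℂ Y]
    [CompleteSpace Y] {B : Y →L[ℂ] Y} {θ : ℝ} (hθ : 0 < θ)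
    (h : ∀ z ∈ spectrum ℂ B, ‖z‖ < θ / 2) : ∃ c, 0 ≤ c ∧ ∀ n, ‖B ^ n‖ ≤ c * θ ^ n := by
  have hB : SpectralBound (θ / 2) B :=
    spectralBound_of_spectrum (half_pos hθ).le fun μ hμ => (h μ hμ).le
  obtain ⟨c, hc⟩ := hB θ (half_lt_self hθ)
  refine ⟨c, ?_, hc⟩
  have := (norm_nonneg (B ^ 0)).trans (hc 0)
  rwa [pow_zero θ, mul_one] at this

theorem coe_aeval_restrict {A : X →L[ℂ] X} {R : Submodule ℂ X} (hR : ∀ x ∈ R, A x ∈ R)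
    (p : ℂ[X]) (x : R) : ((aeval (A.restrict hR) p x : R) : X) = aeval A p x := by
  induction p using Polynomial.induction_on' with
  | add p r hp hr => simp [hp, hr]
  | monomial n a =>
    simp only [aeval_monomial, Algebra.algebraMap_eq_smul_one, smul_mul_assoc, one_mul,
      smul_apply]
    exact congrArg (a • ·) (coe_restrict_pow hR n x)

theorem norm_le_inv_pow_mul {A : X →L[ℂ] X} {R : Submodule ℂ X}
    {μ : ℂ} {u v : R →L[ℂ] R} (hu : ∀ w, v (u w) = w)
    (hu' : ∀ w : R, ((u w : R) : X) = -((A - μ • 1) (w : X))) (n : ℕ) :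
    ∀ w : R, ‖w‖ ≤ ‖v‖ ^ n * ‖((A - μ • 1) ^ n) (w : X)‖ := by
  induction n with
  | zero =>
    intro w
    rw [pow_zero, pow_zero, one_mul]
    exact le_rfl
  | succ n ih =>
    intro w
    have h3 := ih (u w)
    rw [hu', map_neg, norm_neg] at h3
    rw [pow_succ' ‖v‖, pow_succ (A - μ • 1), mul_assoc]
    calc ‖w‖ = ‖v (u w)‖ := by rw [hu]
      _ ≤ ‖v‖ * ‖u w‖ := v.le_opNorm _
      _ ≤ _ := mul_le_mul_of_nonneg_left h3 (norm_nonneg v)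

/-- A polynomial in a compact operator, with finite-dimensional kernel, which cuts down to a small
part of the spectrum. -/
theorem exists_small_polynomial {A : X →L[ℂ] X} (hA : IsCompactOperator A) {θ : ℝ} (hθ : 0 < θ) :
    ∃ Q : X →L[ℂ] X, FiniteDimensional ℂ Q.ker ∧ (∀ n, A ^ n * Q = Q * A ^ n) ∧
      (∀ E : X →L[ℂ] X, Q * E * Q = 0 → FiniteDimensional ℂ E.range) ∧
      (∃ c, 0 ≤ c ∧ ∀ n, ‖A ^ n * Q‖ ≤ c * θ ^ n) ∧
      ∀ μ : ℂ, θ ≤ ‖μ‖ → ∃ c, 0 ≤ c ∧ ∀ (n : ℕ) (y : X),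
        ‖Q y‖ ≤ c ^ n * ‖((A - μ • 1) ^ n) (Q y)‖ := by
  obtain ⟨q, R, hR, hq, hcl, hran, hspec⟩ := exists_small_restriction hA (half_pos hθ)
  have hq0 : q.eval 0 ≠ 0 := fun h => by
    have := hq 0 h
    simp only [norm_zero] at this
    linarith
  have : CompleteSpace R := hcl.completeSpace_coe
  have hker := finiteDimensional_ker_aeval hA hq0
  have hcoe := coe_aeval_restrict hR q
  have hunit : IsUnit (aeval (A.restrict hR) q) :=
    isUnit_aeval_of_spectrum fun z hz h => absurd (hspec z hz) (not_lt.2 (hq z h))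
  have hcomm := commute_aeval_pow A q
  generalize (aeval A q : X →L[ℂ] X) = Q at *
  have hmem : ∀ y, Q y ∈ R := fun y => hran ▸ ⟨y, rfl⟩
  refine ⟨Q, hker, hcomm, fun E hE => ?_, ?_, fun μ hμ => ?_⟩
  · obtain ⟨u, hu⟩ := hunit
    have hsplit : ∀ x, ∃ y ∈ R, x - y ∈ Q.ker := by
      intro x
      refine ⟨_, ((↑u⁻¹ : R →L[ℂ] R) ⟨Q x, hmem x⟩).2, ?_⟩
      change Q _ = 0
      rw [map_sub, ← hcoe, ← hu, sub_eq_zero]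
      have := DFunLike.congr_fun u.mul_inv ⟨Q x, hmem x⟩
      exact (congrArg Subtype.val this).symm
    refine Submodule.finiteDimensional_of_le (S₂ := Q.ker ⊔ Q.ker.map (E : X →ₗ[ℂ] X)) ?_
    rintro _ ⟨x, rfl⟩
    obtain ⟨y, hy, hxy⟩ := hsplit x
    rw [← add_sub_cancel y x, map_add]
    refine Submodule.add_mem_sup ?_ ⟨_, hxy, rfl⟩
    rw [hran] at hy
    obtain ⟨w, rfl⟩ := hy
    exact DFunLike.congr_fun hE w
  · obtain ⟨c, hc0, hc⟩ := exists_norm_pow_le_of_spectrum hθ hspec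
    refine ⟨c * ‖Q‖, by positivity, fun n => ?_⟩
    refine ContinuousLinearMap.opNorm_le_bound _ (by positivity) fun x => ?_
    change ‖(A ^ n) (Q x)‖ ≤ _
    rw [← coe_restrict_pow hR n ⟨Q x, hmem x⟩]
    calc ‖((A.restrict hR) ^ n) ⟨Q x, hmem x⟩‖ ≤ (c * θ ^ n) * (‖Q‖ * ‖x‖) :=
          ContinuousLinearMap.le_of_opNorm_le_of_le _ (hc n) (Q.le_opNorm x)
      _ = _ := by ring
  · have hμ' : μ ∉ spectrum ℂ (A.restrict hR) := fun h => by linarith [hspec μ h]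
    obtain ⟨u, hu⟩ := not_not.1 hμ'
    refine ⟨‖(↑u⁻¹ : R →L[ℂ] R)‖, norm_nonneg (↑u⁻¹ : R →L[ℂ] R), fun n y => ?_⟩
    refine norm_le_inv_pow_mul (u := u) (DFunLike.congr_fun u.inv_mul) (fun w => ?_) n
      ⟨Q y, hmem y⟩
    rw [hu, sub_smul_one_apply]
    change μ • (w : X) - A w = _
    rw [neg_sub]

theorem norm_mul_ad_pow_mul_le {A Q : X →L[ℂ] X} {c θ : ℝ} (hc : 0 ≤ c) (hθ : 0 ≤ θ)
    (h1 : ∀ n, ‖Q * A ^ n‖ ≤ c * θ ^ n) (h2 : ∀ n, ‖A ^ n * Q‖ ≤ c * θ ^ n)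
    (J : X →L[ℂ] X) (k : ℕ) :
    ∀ i j, ‖Q * A ^ i * ((mulL A - mulR A) ^ k) J * (A ^ j * Q)‖ ≤
      c ^ 2 * ‖J‖ * θ ^ (i + j) * (2 * θ) ^ k := by
  induction k with
  | zero =>
    intro i j
    rw [pow_zero (mulL A - mulR A), pow_zero (2 * θ)]
    change ‖Q * A ^ i * J * (A ^ j * Q)‖ ≤ _
    have h3 : ‖Q * A ^ i * J‖ ≤ c * θ ^ i * ‖J‖ :=
      (norm_mul_le _ _).trans (mul_le_mul_of_nonneg_right (h1 i) (norm_nonneg J))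
    refine (norm_mul_le _ _).trans ((mul_le_mul h3 (h2 j) (norm_nonneg _) (by positivity)).trans
      (le_of_eq ?_))
    ring
  | succ k ih =>
    intro i j
    rw [pow_succ']
    change ‖Q * A ^ i * (A * ((mulL A - mulR A) ^ k) J - ((mulL A - mulR A) ^ k) J * A) *
      (A ^ j * Q)‖ ≤ _
    set Y := ((mulL A - mulR A) ^ k) J
    have : Q * A ^ i * (A * Y - Y * A) * (A ^ j * Q) =
        Q * A ^ (i + 1) * Y * (A ^ j * Q) - Q * A ^ i * Y * (A ^ (j + 1) * Q) := by
      rw [pow_succ A i, pow_succ' A j]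
      noncomm_ring
    rw [this]
    calc _ ≤ c ^ 2 * ‖J‖ * θ ^ (i + 1 + j) * (2 * θ) ^ k +
          c ^ 2 * ‖J‖ * θ ^ (i + (j + 1)) * (2 * θ) ^ k :=
        (norm_sub_le _ _).trans (add_le_add (ih _ _) (ih _ _))
      _ = _ := by ring

theorem countable_spectrum_of_isCompactOperator {A : X →L[ℂ] X} (hA : IsCompactOperator A) :
    (spectrum ℂ A).Countable := by
  have : spectrum ℂ A ⊆ {0} ∪ ⋃ n : ℕ, {μ ∈ spectrum ℂ A | 1 / ((n : ℝ) + 1) ≤ ‖μ‖} := by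
    intro μ hμ
    by_cases h : μ = 0
    · exact Or.inl h
    · obtain ⟨n, hn⟩ := exists_nat_one_div_lt (norm_pos_iff.2 h)
      exact Or.inr (Set.mem_iUnion.2 ⟨n, hμ, hn.le⟩)
  exact ((Set.countable_singleton 0).union (Set.countable_iUnion fun n =>
    (finite_spectrum_of_le_norm hA (by positivity)).countable)).mono this

/-- If a closed Lie algebra of compact operators has no nonzero element of finite rank, then its
inner derivations are locally quasinilpotent. -/
theorem exists_ad_pow_le {S : Submodule ℂ (X →L[ℂ] X)} (hS : IsClosed (S : Set (X →L[ℂ] X)))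
    (hL : SubmulLie S) (hF : finiteRank S = ⊥) {A C : X →L[ℂ] X} (hA : A ∈ S) (hC : C ∈ S) {r : ℝ}
    (hr : 0 < r) : ∃ c, 0 ≤ c ∧ ∀ n, ‖((mulL A - mulR A) ^ n) C‖ ≤ c * r ^ n := by
  have hAc := hL.compact A hA
  have hcount := countable_spectrum_ad (countable_spectrum_of_isCompactOperator hAc)
  obtain ⟨s, hs, hs0, hsr⟩ := ((hcount.image (‖·‖)).dense_compl ℝ).exists_between hr
  obtain ⟨D, hD, c, hc, hDn, hJ⟩ := exists_spectral_part hcount hS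
    (fun x hx => hL.lie A hA x hx) hC hs0 (fun z hz h => hs ⟨z, hz, h⟩)
  obtain ⟨Q, -, hcomm, hq, ⟨b, hb, hbn⟩, -⟩ := exists_small_polynomial hAc (θ := s / 3)
    (by positivity)
  have hzero : Q * (C - D) * Q = 0 := by
    have hlim : Tendsto (fun k : ℕ => b ^ 2 * c * (2 / 3 : ℝ) ^ (k + 1)) atTop (𝓝 0) := by
      have := ((tendsto_pow_atTop_nhds_zero_of_lt_one (r := (2 / 3 : ℝ)) (by norm_num)
        (by norm_num)).comp (tendsto_add_atTop_nat 1)).const_mul (b ^ 2 * c)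
      simpa using this
    rw [← norm_le_zero_iff]
    refine ge_of_tendsto' hlim fun k => ?_
    obtain ⟨J, hJn, hJ⟩ := hJ k
    have := norm_mul_ad_pow_mul_le (Q := Q) hb (by positivity : 0 ≤ s / 3)
      (fun n => by rw [← hcomm]; exact hbn n) hbn J (k + 1) 0 0
    rw [← hJ] at this
    simp only [pow_zero, mul_one, one_mul, add_zero] at this
    calc _ ≤ _ := this
      _ ≤ b ^ 2 * (c * (s ^ (k + 1))⁻¹) * (2 * (s / 3)) ^ (k + 1) := by gcongr
      _ = _ := by
        rw [show 2 * (s / 3) = (2 / 3) * s by ring, mul_pow]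
        field_simp
  have hCD : C - D ∈ finiteRank S := ⟨sub_mem hC hD, hq _ hzero⟩
  rw [hF, Submodule.mem_bot, sub_eq_zero] at hCD
  refine ⟨c, hc, fun n => ?_⟩
  rw [hCD]
  exact (hDn n).trans (by gcongr)

theorem norm_pow_ad_pow_apply_le {A C : X →L[ℂ] X} (μ : ℂ) {y : X} {c d θ : ℝ}
    (h1 : ∀ n, ‖((mulL A - mulR A) ^ n) C‖ ≤ c * θ ^ n)
    (h2 : ∀ n, ‖((A - μ • 1) ^ n) y‖ ≤ d * θ ^ n) (n : ℕ) :
    ∀ k j, ‖((A - μ • 1) ^ n) ((((mulL A - mulR A) ^ k) C) (((A - μ • 1) ^ j) y))‖ ≤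
      c * d * θ ^ (k + j) * (2 * θ) ^ n := by
  induction n with
  | zero =>
    intro k j
    calc _ ≤ (c * θ ^ k) * (d * θ ^ j) :=
          ContinuousLinearMap.le_of_opNorm_le_of_le _ (h1 k) (h2 j)
      _ = _ := by ring
  | succ n ih =>
    intro k j
    have : (A - μ • 1) ((((mulL A - mulR A) ^ k) C) (((A - μ • 1) ^ j) y)) =
        (((mulL A - mulR A) ^ (k + 1)) C) (((A - μ • 1) ^ j) y) +
        (((mulL A - mulR A) ^ k) C) (((A - μ • 1) ^ (j + 1)) y) := by
      rw [pow_succ' _ k, pow_succ' _ j]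
      have h (Y : X →L[ℂ] X) (w : X) : (A - μ • 1) (Y w) =
          (A * Y - Y * A) w + Y ((A - μ • 1) w) := by
        rw [sub_smul_one_apply, sub_smul_one_apply, map_sub, map_smul, sub_apply]
        change A (Y w) - μ • Y w = A (Y w) - Y (A w) + (Y (A w) - μ • Y w)
        abel
      exact h _ _
    rw [pow_succ]
    change ‖((A - μ • 1) ^ n) ((A - μ • 1) _)‖ ≤ _
    rw [this, map_add]
    calc _ ≤ c * d * θ ^ (k + 1 + j) * (2 * θ) ^ n + c * d * θ ^ (k + (j + 1)) * (2 * θ) ^ n :=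
        (norm_add_le _ _).trans (add_le_add (ih _ _) (ih _ _))
      _ = _ := by ring

theorem Irreducible.spectralBound_zero {S : Submodule ℂ (X →L[ℂ] X)} (hirr : Irreducible S)
    (hX : ¬ FiniteDimensional ℂ X) (hS : IsClosed (S : Set (X →L[ℂ] X))) (hL : SubmulLie S)
    {A : X →L[ℂ] X} (hA : A ∈ S) : SpectralBound 0 A := by
  have hF := hirr.finiteRank_eq_bot hX hL
  refine spectralBound_of_spectrum le_rfl fun μ hμ => ?_
  by_contra hμ0
  have hμ0 : μ ≠ 0 := fun h => hμ0 (by simp [h])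
  obtain ⟨v, hv0, hv⟩ := exists_eigenvector (hL.compact A hA) hμ0 hμ
  let W : Submodule ℂ X :=
    { carrier := {y | ∀ θ > 0, ∃ d, 0 ≤ d ∧ ∀ n, ‖((A - μ • 1) ^ n) y‖ ≤ d * θ ^ n}
      add_mem' := fun {x y} hx hy θ hθ => by
        obtain ⟨d, hd, h⟩ := hx θ hθ
        obtain ⟨d', hd', h'⟩ := hy θ hθ
        refine ⟨d + d', add_nonneg hd hd', fun n => ?_⟩
        rw [map_add, add_mul]
        exact (norm_add_le _ _).trans (add_le_add (h n) (h' n))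
      zero_mem' := fun θ hθ => ⟨0, le_rfl, fun n => by rw [map_zero]; simp⟩
      smul_mem' := fun a x hx θ hθ => by
        obtain ⟨d, hd, h⟩ := hx θ hθ
        refine ⟨‖a‖ * d, by positivity, fun n => ?_⟩
        rw [map_smul, norm_smul, mul_assoc]
        exact mul_le_mul_of_nonneg_left (h n) (norm_nonneg a) }
  have hvW : v ∈ W := by
    intro θ hθ
    refine ⟨‖v‖, norm_nonneg _, fun n => ?_⟩
    cases n with
    | zero => simp
    | succ n =>
      have : (A - μ • 1) v = 0 := by rw [sub_smul_one_apply, hv, sub_self]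
      rw [pow_succ]
      change ‖((A - μ • 1) ^ n) ((A - μ • 1) v)‖ ≤ _
      rw [this, map_zero, norm_zero]
      positivity
  obtain ⟨Q, hqker, hAQ, -, -, hq⟩ := exists_small_polynomial (hL.compact A hA) (norm_pos_iff.2 hμ0)
  obtain ⟨c, hc, hcn⟩ := hq μ le_rfl
  have hWq : W ≤ Q.ker := by
    intro y hy
    obtain ⟨d, hd, h⟩ := hy (1 / (2 * (c + 1))) (by positivity)
    have hlim : Tendsto (fun n : ℕ => ‖Q‖ * d * (1 / 2 : ℝ) ^ n) atTop
        (𝓝 0) := by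
      simpa using (tendsto_pow_atTop_nhds_zero_of_lt_one (r := (1 / 2 : ℝ)) (by norm_num)
        (by norm_num)).const_mul (‖Q‖ * d)
    change Q y = 0
    rw [← norm_le_zero_iff]
    refine ge_of_tendsto' hlim fun n => ?_
    have hcomm : ((A - μ • 1) ^ n) (Q y) = Q (((A - μ • 1) ^ n) y) := by
      have h : Commute (A - μ • 1) Q := by
        refine Commute.sub_left ?_ ((Commute.one_left _).smul_left _)
        have := hAQ 1
        rwa [pow_one] at this
      exact DFunLike.congr_fun (h.pow_left n) y
    calc ‖Q y‖ ≤ c ^ n * ‖((A - μ • 1) ^ n) (Q y)‖ := hcn n y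
      _ ≤ c ^ n * (‖Q‖ * (d * (1 / (2 * (c + 1))) ^ n)) := by
        rw [hcomm]
        gcongr
        exact Q.le_opNorm_of_le (h n)
      _ = ‖Q‖ * d * (c / (2 * (c + 1))) ^ n := by
        rw [div_pow, div_pow, one_pow]
        ring
      _ ≤ _ := by
        have : c / (2 * (c + 1)) ≤ 1 / 2 := by
          rw [div_le_div_iff₀ (by positivity) (by positivity)]
          linarith
        exact mul_le_mul_of_nonneg_left (pow_le_pow_left₀ (by positivity) this n) (by positivity)
  have hWfin : FiniteDimensional ℂ W := Submodule.finiteDimensional_of_le hWq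
  rcases hirr W (Submodule.closed_of_finiteDimensional _) (by
    intro C hC y hy θ hθ
    obtain ⟨c, hc, h1⟩ := exists_ad_pow_le hS hL hF hA hC (half_pos hθ)
    obtain ⟨d, hd, h2⟩ := hy _ (half_pos hθ)
    refine ⟨c * d, by positivity, fun n => ?_⟩
    have := norm_pow_ad_pow_apply_le μ h1 h2 n 0 0
    simpa [mul_div_cancel₀] using this) with h | h
  · rw [h] at hvW
    exact hv0 hvW
  · rw [h] at hWfin
    exact hX (LinearEquiv.finiteDimensional (Submodule.topEquiv (R := ℂ) (M := X)))

end

section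

open NormedSpace

variable {A : Type*} [NormedRing A] [NormedAlgebra ℂ A] [CompleteSpace A] [NormOneClass A]

theorem norm_exp_le (a : A) : ‖exp a‖ ≤ Real.exp ‖a‖ := by
  rw [← (exp_series_hasSum_exp' (𝕂 := ℂ) a).tsum_eq]
  have h := exp_series_hasSum_exp' (𝕂 := ℝ) ‖a‖
  rw [← Real.exp_eq_exp_ℝ] at h
  refine tsum_of_norm_bounded h fun n => ?_
  rw [norm_smul, smul_eq_mul, norm_inv, Complex.norm_natCast]
  gcongr
  exact norm_pow_le a n

theorem hasDerivAt_exp_neg_smul_mul_exp_smul (c y : A) (t : ℝ) :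
    HasDerivAt (fun t : ℝ => exp (t • (-c)) * exp (t • (c + y)))
      (exp (t • (-c)) * y * exp (t • (c + y))) t := by
  convert! (hasDerivAt_exp_smul_const (𝕂 := ℝ) (-c) t).mul
    (hasDerivAt_exp_smul_const' (𝕂 := ℝ) (c + y) t) using 1
  noncomm_ring

theorem norm_smul_le_of_mem {t : ℝ} (ht : t ∈ Set.Icc (0 : ℝ) 1) {a : A} {r : ℝ} (ha : ‖a‖ ≤ r) :
    ‖t • a‖ ≤ r := by
  rw [norm_smul, Real.norm_of_nonneg ht.1]
  exact (mul_le_of_le_one_left (norm_nonneg a) ht.2).trans ha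

theorem norm_exp_le_of_le {a : A} {r : ℝ} (h : ‖a‖ ≤ r) : ‖exp a‖ ≤ Real.exp r :=
  (norm_exp_le a).trans (Real.exp_le_exp.2 h)

theorem norm_exp_neg_mul_exp_add_sub_one_le {c y : A} (hc : ‖c‖ ≤ 1) (hy : ‖y‖ ≤ 1) :
    ‖exp (-c) * exp (c + y) - 1‖ ≤ Real.exp 3 * ‖y‖ := by
  have := norm_image_sub_le_of_norm_deriv_le_segment_01' (C := Real.exp 3 * ‖y‖)
    (fun t _ => (hasDerivAt_exp_neg_smul_mul_exp_smul c y t).hasDerivWithinAt) (fun t ht => by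
      have ht' := Set.Ico_subset_Icc_self ht
      have h1 : ‖exp (t • (-c))‖ ≤ Real.exp 1 :=
        norm_exp_le_of_le (norm_smul_le_of_mem ht' (by rwa [norm_neg]))
      have h2 : ‖exp (t • (c + y))‖ ≤ Real.exp 2 :=
        norm_exp_le_of_le (norm_smul_le_of_mem ht' ((norm_add_le _ _).trans (by linarith)))
      calc _ ≤ ‖exp (t • (-c))‖ * ‖y‖ * ‖exp (t • (c + y))‖ :=
            (norm_mul_le _ _).trans (mul_le_mul_of_nonneg_right (norm_mul_le _ _) (norm_nonneg _))
        _ ≤ Real.exp 1 * ‖y‖ * Real.exp 2 := by gcongr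
        _ = Real.exp 3 * ‖y‖ := by
          rw [mul_right_comm, ← Real.exp_add]
          norm_num)
  simpa using this

theorem norm_exp_add_sub_exp_le {c y : A} (hc : ‖c‖ ≤ 1) (hy : ‖y‖ ≤ 1) :
    ‖exp (c + y) - exp c‖ ≤ Real.exp 4 * ‖y‖ := by
  have h : exp (c + y) - exp c = exp c * (exp (-c) * exp (c + y) - 1) := by
    rw [mul_sub, ← mul_assoc, exp_mul_exp_neg, one_mul, mul_one]
  rw [h]
  calc _ ≤ ‖exp c‖ * ‖exp (-c) * exp (c + y) - 1‖ := norm_mul_le _ _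
    _ ≤ Real.exp 1 * (Real.exp 3 * ‖y‖) := by
      gcongr
      · exact norm_exp_le_of_le hc
      · exact norm_exp_neg_mul_exp_add_sub_one_le hc hy
    _ = _ := by
      rw [← mul_assoc, ← Real.exp_add]
      norm_num

theorem map_exp_apply {Y E : Type*} [NormedAddCommGroup Y] [NormedSpace ℂ Y] [CompleteSpace Y]
    [NormedAddCommGroup E] [NormedSpace ℂ E] [CompleteSpace E] {j : Y →L[ℂ] E} {V : Y →L[ℂ] Y}
    {U : E →L[ℂ] E} (h : ∀ x, j (V x) = U (j x)) (x : Y) : j (exp V x) = exp U (j x) := by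
  have h1 := (exp_series_hasSum_exp' (𝕂 := ℂ) U).mapL (ContinuousLinearMap.apply ℂ E (j x))
  have h2 := ((exp_series_hasSum_exp' (𝕂 := ℂ) V).mapL (ContinuousLinearMap.apply ℂ Y x)).mapL j
  refine h2.unique ?_
  convert! h1 using 2 with n
  have hpow : j ((V ^ n) x) = (U ^ n) (j x) := by
    induction n with
    | zero => rfl
    | succ n ih =>
      rw [pow_succ', pow_succ']
      exact (h _).trans (congrArg U ih)
  change j ((n.factorial : ℂ)⁻¹ • (V ^ n) x) = (n.factorial : ℂ)⁻¹ • (U ^ n) (j x)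
  rw [map_smul, hpow]

/-- If the derivative of `F` is `t ↦ exp (t • V)` and `F 0 = 0`, then `F 1 - 1` is small when `V`
is small. -/
theorem exists_integral_exp {E : Type*} [NormedAddCommGroup E] [NormedSpace ℂ E]
    [CompleteSpace E] : ∃ η > 0, ∀ V : E →L[ℂ] E, ‖V‖ ≤ η → ∃ F : ℝ → E →L[ℂ] E,
      F 0 = 0 ∧ (∀ t, HasDerivAt F (exp (t • V)) t) ∧ ‖F 1 - 1‖ ≤ 1 / 2 := by
  have hcont : Continuous (exp : (E →L[ℂ] E) → E →L[ℂ] E) := by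
    let _ := NormedAlgebra.restrictScalars ℚ ℂ (E →L[ℂ] E)
    exact exp_continuous
  have h0 : Tendsto (exp : (E →L[ℂ] E) → E →L[ℂ] E) (𝓝 0) (𝓝 1) := by
    have := hcont.tendsto 0
    rwa [exp_zero] at this
  obtain ⟨η, hη, hball⟩ := Metric.mem_nhds_iff.1 (h0 (Metric.closedBall_mem_nhds _ one_half_pos))
  refine ⟨η / 2, half_pos hη, fun V hV => ?_⟩
  have hc : Continuous fun t : ℝ => exp (t • V) := hcont.comp (by fun_prop)
  have hderiv : ∀ t, HasDerivAt (fun t : ℝ => ∫ u in (0 : ℝ)..t, exp (u • V)) (exp (t • V)) t :=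
    fun t => (hc.integral_hasStrictDerivAt 0 t).hasDerivAt
  refine ⟨_, by simp, hderiv, ?_⟩
  have := norm_image_sub_le_of_norm_deriv_le_segment_01' (C := 1 / 2)
    (fun t _ => ((hderiv t).sub ((hasDerivAt_id t).smul_const (1 : E →L[ℂ] E))).hasDerivWithinAt)
    (fun t ht => by
      have : t • V ∈ Metric.ball 0 η := by
        rw [mem_ball_zero_iff, norm_smul, Real.norm_of_nonneg ht.1]
        nlinarith [ht.1, ht.2, norm_nonneg V]
      have := hball this
      rw [Set.mem_preimage, mem_closedBall_iff_norm] at this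
      simpa using this)
  simpa using this

theorem norm_exp_sub_one_sub_le {b : A} (hb : ‖b‖ ≤ 1) :
    ‖exp b - 1 - b‖ ≤ Real.exp 4 * ‖b‖ ^ 2 := by
  have := norm_image_sub_le_of_norm_deriv_le_segment_01' (C := Real.exp 4 * ‖b‖ ^ 2)
    (fun t _ => ((hasDerivAt_exp_smul_const (𝕂 := ℝ) b t).sub
      ((hasDerivAt_id t).smul_const b)).hasDerivWithinAt) (fun t ht => by
      have ht' := Set.Ico_subset_Icc_self ht
      have h1 := norm_exp_add_sub_exp_le (c := 0) (y := t • b) (by simp)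
        (norm_smul_le_of_mem ht' hb)
      rw [zero_add, exp_zero] at h1
      have h2 := h1.trans (mul_le_mul_of_nonneg_left (norm_smul_le_of_mem ht' le_rfl)
        (Real.exp_pos 4).le)
      rw [one_smul, ← sub_one_mul]
      calc _ ≤ ‖exp (t • b) - 1‖ * ‖b‖ := norm_mul_le _ _
        _ ≤ (Real.exp 4 * ‖b‖) * ‖b‖ := by gcongr
        _ = _ := by ring)
  have h2 : exp b - 1 - b =
      exp ((1 : ℝ) • b) - id (1 : ℝ) • b - (exp ((0 : ℝ) • b) - id (0 : ℝ) • b) := by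
    simp only [id, one_smul, zero_smul, exp_zero]
    abel
  rw [h2]
  exact this

theorem norm_exp_neg_mul_exp_add_sub_le {c y : A} (hc : ‖c‖ ≤ 1) (hy : ‖y‖ ≤ 1) {f : ℝ → A}
    (hf : ∀ t, HasDerivAt f (exp (t • (-c)) * y * exp (t • c)) t) :
    ‖exp (-c) * exp (c + y) - 1 - (f 1 - f 0)‖ ≤ Real.exp 5 * ‖y‖ ^ 2 := by
  have := norm_image_sub_le_of_norm_deriv_le_segment_01' (C := Real.exp 5 * ‖y‖ ^ 2)
    (fun t _ => ((hasDerivAt_exp_neg_smul_mul_exp_smul c y t).sub (hf t)).hasDerivWithinAt)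
    (fun t ht => by
      have ht' := Set.Ico_subset_Icc_self ht
      have h1 : ‖exp (t • (-c))‖ ≤ Real.exp 1 :=
        norm_exp_le_of_le (norm_smul_le_of_mem ht' (by rwa [norm_neg]))
      have h2 := norm_exp_add_sub_exp_le (norm_smul_le_of_mem ht' hc) (norm_smul_le_of_mem ht' hy)
      rw [← smul_add] at h2
      have h3 := h2.trans (mul_le_mul_of_nonneg_left (norm_smul_le_of_mem ht' le_rfl)
        (Real.exp_pos 4).le)
      rw [← mul_sub]
      calc _ ≤ ‖exp (t • (-c))‖ * ‖y‖ * ‖exp (t • (c + y)) - exp (t • c)‖ :=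
            (norm_mul_le _ _).trans (mul_le_mul_of_nonneg_right (norm_mul_le _ _) (norm_nonneg _))
        _ ≤ Real.exp 1 * ‖y‖ * (Real.exp 4 * ‖y‖) := by gcongr
        _ = Real.exp 1 * Real.exp 4 * ‖y‖ ^ 2 := by ring
        _ = _ := by
          rw [← Real.exp_add]
          norm_num)
  have h2 : exp (-c) * exp (c + y) - 1 - (f 1 - f 0) =
      exp ((1 : ℝ) • (-c)) * exp ((1 : ℝ) • (c + y)) - f 1 -
        (exp ((0 : ℝ) • (-c)) * exp ((0 : ℝ) • (c + y)) - f 0) := by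
    simp only [one_smul, zero_smul, exp_zero, mul_one]
    abel
  rw [h2]
  exact this

theorem hasDerivAt_map_apply {Y : Type*} [NormedAddCommGroup Y] [NormedSpace ℂ Y] [CompleteSpace Y]
    {j : Y →L[ℂ] A} {V : Y →L[ℂ] Y} {c : A} (hj : ∀ x, j (V x) = -c * j x - j x * -c)
    {F : ℝ → Y →L[ℂ] Y} (y : Y) {t : ℝ} (hF : HasDerivAt F (exp (t • V)) t) :
    HasDerivAt (fun t => j (F t y)) (exp (t • (-c)) * j y * exp (t • c)) t := by
  have h1 : exp (t • (-c)) * j y * exp (t • c) = j (exp (t • V) y) := by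
    rw [map_exp_apply (U := mulL (t • (-c)) - mulR (t • (-c))) (fun x => ?_), exp_mulL_sub_mulR,
      smul_neg, neg_neg]
    change j (t • V x) = t • (-c) * j x - j x * t • (-c)
    rw [smul_mul_assoc, mul_smul_comm, ← smul_sub, ← hj]
    exact map_smul (j.restrictScalars ℝ) t _
  rw [h1]
  let Λ : (Y →L[ℂ] Y) →L[ℝ] A :=
    (j.comp (ContinuousLinearMap.apply ℂ Y y)).restrictScalars ℝ
  exact (Λ.hasFDerivAt (x := F t)).comp_hasDerivAt t hF

theorem exists_exp_add_eq {S : Submodule ℂ A} (hS : IsClosed (S : Set A))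
    (hlie : ∀ a ∈ S, ∀ b ∈ S, a * b - b * a ∈ S) : ∃ δ > 0, δ ≤ 1 ∧ ∃ K, 0 ≤ K ∧
      ∀ c ∈ S, ‖c‖ ≤ δ → ∀ b ∈ S, ‖b‖ ≤ 1 / 2 →
        ∃ y ∈ S, ‖y‖ ≤ 2 * ‖b‖ ∧ ‖exp (c + y) - exp c * exp b‖ ≤ K * ‖b‖ ^ 2 := by
  have : CompleteSpace S := hS.completeSpace_coe
  obtain ⟨η, hη, hF⟩ := exists_integral_exp (E := S)
  refine ⟨min 1 (η / 2), by positivity, min_le_left _ _, Real.exp 1 * (4 * Real.exp 5 + Real.exp 4),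
    by positivity, ?_⟩
  intro c hc hcn b hb hbn
  have hcS : ∀ x ∈ S, (mulL (-c) - mulR (-c)) x ∈ S := fun x hx => hlie _ (S.neg_mem hc) x hx
  obtain ⟨F, hF0, hF', hF1⟩ := hF ((mulL (-c) - mulR (-c)).restrict hcS) (by
    refine ContinuousLinearMap.opNorm_le_bound _ hη.le fun x => ?_
    change ‖(-c) * (x : A) - (x : A) * (-c)‖ ≤ η * ‖(x : A)‖
    have h1 := norm_mul_le (-c) (x : A)
    have h2 := norm_mul_le (x : A) (-c)
    rw [norm_neg] at h1 h2
    have h3 : ‖c‖ ≤ η / 2 := hcn.trans (min_le_right _ _)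
    have := norm_sub_le ((-c) * (x : A)) ((x : A) * (-c))
    nlinarith [norm_nonneg (x : A)])
  obtain ⟨y, hyb, hyn⟩ : ∃ y : S, F 1 y = ⟨b, hb⟩ ∧ ‖y‖ ≤ 2 * ‖b‖ := by
    obtain ⟨u, hu⟩ := isUnit_one_sub_of_norm_lt_one (x := 1 - F 1) (by
      rw [norm_sub_rev]
      linarith)
    rw [sub_sub_cancel] at hu
    have h : F 1 ((↑u⁻¹ : S →L[ℂ] S) ⟨b, hb⟩) = ⟨b, hb⟩ := by
      rw [← hu]
      exact DFunLike.congr_fun u.mul_inv _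
    refine ⟨_, h, ?_⟩
    generalize (↑u⁻¹ : S →L[ℂ] S) ⟨b, hb⟩ = y at h
    have h1 : ‖(F 1 - 1) y‖ ≤ 1 / 2 * ‖y‖ := ContinuousLinearMap.le_of_opNorm_le _ hF1 y
    have h2 : (F 1 - 1) y = ⟨b, hb⟩ - y := by
      rw [← h]
      rfl
    rw [h2] at h1
    have h3 := norm_sub_norm_le y ⟨b, hb⟩
    rw [norm_sub_rev] at h3
    change _ - ‖b‖ ≤ _ at h3
    linarith
  have hc1 : ‖c‖ ≤ 1 := hcn.trans (min_le_left _ _)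
  have hy1 : ‖(y : A)‖ ≤ 1 := by
    have : ‖(y : A)‖ = ‖y‖ := rfl
    linarith
  refine ⟨y, y.2, hyn, ?_⟩
  have hmain := norm_exp_neg_mul_exp_add_sub_le hc1 hy1 (f := fun t => (F t y : A)) (fun t =>
    hasDerivAt_map_apply (j := S.subtypeL) (fun _ => rfl) y (hF' t))
  have hb2 := norm_exp_sub_one_sub_le (b := b) (by linarith)
  rw [hF0] at hmain
  have hmain : ‖exp (-c) * exp (c + y) - 1 - b‖ ≤ Real.exp 5 * ‖(y : A)‖ ^ 2 := by
    simpa [hyb] using hmain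
  have h : exp (c + y) - exp c * exp b =
      exp c * ((exp (-c) * exp (c + y) - 1 - b) - (exp b - 1 - b)) := by
    rw [mul_sub, mul_sub, mul_sub, ← mul_assoc, exp_mul_exp_neg, mul_sub, mul_sub]
    noncomm_ring
  rw [h]
  have hyn' : ‖(y : A)‖ ≤ 2 * ‖b‖ := hyn
  calc _ ≤ ‖exp c‖ * (‖exp (-c) * exp (c + y) - 1 - b‖ + ‖exp b - 1 - b‖) :=
        (norm_mul_le _ _).trans (mul_le_mul_of_nonneg_left (norm_sub_le _ _) (norm_nonneg _))
    _ ≤ Real.exp 1 * (Real.exp 5 * (2 * ‖b‖) ^ 2 + Real.exp 4 * ‖b‖ ^ 2) := by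
      gcongr
      · exact norm_exp_le_of_le hc1
      · exact hmain.trans (by gcongr)
    _ = _ := by ring

end

section

open NormedSpace

variable {A : Type*} [NormedRing A] [NormedAlgebra ℂ A] [CompleteSpace A] [NormOneClass A]

theorem exists_exp_iterate {S : Submodule ℂ A} {δ K : ℝ} (hK : 0 ≤ K)
    (H : ∀ c ∈ S, ‖c‖ ≤ δ → ∀ b ∈ S, ‖b‖ ≤ 1 / 2 →
      ∃ y ∈ S, ‖y‖ ≤ 2 * ‖b‖ ∧ ‖exp (c + y) - exp c * exp b‖ ≤ K * ‖b‖ ^ 2)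
    {c₀ b : A} (hc₀ : c₀ ∈ S) (hb : b ∈ S) (hb2 : ‖b‖ ≤ 1 / 2) (n : ℕ)
    (hn : ‖c₀‖ + 2 * (n * ‖b‖) ≤ δ) :
    ∃ c ∈ S, ‖c‖ ≤ ‖c₀‖ + 2 * (n * ‖b‖) ∧
      ‖exp c - exp c₀ * exp b ^ n‖ ≤ n * (K * ‖b‖ ^ 2) * Real.exp ‖b‖ ^ n := by
  induction n with
  | zero => exact ⟨c₀, hc₀, by simp, by simp⟩
  | succ n ih =>
    push_cast at hn
    obtain ⟨c, hc, hcn, hce⟩ := ih (by nlinarith [norm_nonneg b])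
    obtain ⟨y, hy, hyn, hye⟩ := H c hc (hcn.trans (by nlinarith [norm_nonneg b])) b hb hb2
    refine ⟨c + y, S.add_mem hc hy, (norm_add_le _ _).trans ?_, ?_⟩
    · push_cast
      linarith
    · have h : exp (c + y) - exp c₀ * exp b ^ (n + 1) =
          (exp (c + y) - exp c * exp b) + (exp c - exp c₀ * exp b ^ n) * exp b := by
        rw [pow_succ]
        noncomm_ring
      have h1 : 1 ≤ Real.exp ‖b‖ := Real.one_le_exp (norm_nonneg b)
      rw [h]
      calc _ ≤ K * ‖b‖ ^ 2 + (n * (K * ‖b‖ ^ 2) * Real.exp ‖b‖ ^ n) * Real.exp ‖b‖ := by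
            refine (norm_add_le _ _).trans (add_le_add hye ((norm_mul_le _ _).trans ?_))
            gcongr
            exact norm_exp_le b
        _ ≤ K * ‖b‖ ^ 2 * Real.exp ‖b‖ ^ (n + 1) +
            (n * (K * ‖b‖ ^ 2) * Real.exp ‖b‖ ^ n) * Real.exp ‖b‖ := by
          have : K * ‖b‖ ^ 2 ≤ K * ‖b‖ ^ 2 * Real.exp ‖b‖ ^ (n + 1) :=
            le_mul_of_one_le_right (by positivity) (one_le_pow₀ h1)
          linarith
        _ = _ := by
          push_cast
          ring

theorem exists_exp_near_mul {S : Submodule ℂ A} {δ K : ℝ} (hδ : δ ≤ 1) (hK : 0 ≤ K)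
    (H : ∀ c ∈ S, ‖c‖ ≤ δ → ∀ b ∈ S, ‖b‖ ≤ 1 / 2 →
      ∃ y ∈ S, ‖y‖ ≤ 2 * ‖b‖ ∧ ‖exp (c + y) - exp c * exp b‖ ≤ K * ‖b‖ ^ 2)
    {c₀ b : A} (hc₀ : c₀ ∈ S) (hb : b ∈ S) (hn : ‖c₀‖ + 2 * ‖b‖ ≤ δ) {ε : ℝ} (hε : 0 < ε) :
    ∃ c ∈ S, ‖c‖ ≤ ‖c₀‖ + 2 * ‖b‖ ∧ ‖exp c - exp c₀ * exp b‖ < ε := by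
  obtain ⟨n, hn'⟩ := exists_nat_gt (K * ‖b‖ ^ 2 * Real.exp ‖b‖ / ε)
  have hn0 : (0 : ℝ) < n := lt_of_le_of_lt (by positivity) hn'
  have hn1 : n ≠ 0 := by rintro rfl; simp at hn0
  have hnC : (n : ℂ) ≠ 0 := Nat.cast_ne_zero.2 hn1
  set b' : A := (n : ℂ)⁻¹ • b
  have hb' : n * ‖b'‖ = ‖b‖ := by
    rw [norm_smul, norm_inv, Complex.norm_natCast]
    field_simp
  have hpow : exp b' ^ n = exp b := by
    let _ := NormedAlgebra.restrictScalars ℚ ℂ A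
    rw [← exp_nsmul, ← Nat.cast_smul_eq_nsmul ℂ, smul_smul, mul_inv_cancel₀ hnC, one_smul]
  obtain ⟨c, hc, hcn, hce⟩ := exists_exp_iterate hK H hc₀ (S.smul_mem _ hb : b' ∈ S) (by
    have : (1 : ℝ) ≤ n := by exact_mod_cast Nat.one_le_iff_ne_zero.2 hn1
    nlinarith [norm_nonneg b', norm_nonneg c₀]) n (by rwa [hb'])
  rw [hb'] at hcn
  rw [hpow, ← Real.exp_nat_mul, hb'] at hce
  refine ⟨c, hc, hcn, hce.trans_lt ?_⟩
  rw [div_lt_iff₀ hε] at hn'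
  have : n * (K * ‖b'‖ ^ 2) * Real.exp ‖b‖ = K * ‖b‖ ^ 2 * Real.exp ‖b‖ / n := by
    rw [← hb']
    field_simp
  rw [this, div_lt_iff₀ hn0]
  linarith

/-- A weak form of the Baker–Campbell–Hausdorff theorem. -/
theorem exists_exp_near_prod {S : Submodule ℂ A} (hS : IsClosed (S : Set A))
    (hlie : ∀ a ∈ S, ∀ b ∈ S, a * b - b * a ∈ S) : ∃ δ > 0, ∀ l : List A, (∀ b ∈ l, b ∈ S) →
      (l.map (‖·‖)).sum ≤ δ → ∀ ε > 0, ∃ c ∈ S, ‖c‖ ≤ 2 * (l.map (‖·‖)).sum ∧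
        ‖exp c - (l.map exp).prod‖ < ε := by
  obtain ⟨δ, hδ, hδ1, K, hK, H⟩ := exists_exp_add_eq hS hlie
  refine ⟨δ / 2, half_pos hδ, fun l => ?_⟩
  induction l using List.reverseRecOn with
  | nil => exact fun _ _ ε hε => ⟨0, S.zero_mem, by simp, by simpa using hε⟩
  | append_singleton l b ih =>
    intro hl hln ε hε
    simp only [List.map_append, List.map_cons, List.map_nil, List.sum_append, List.sum_cons,
      List.sum_nil, add_zero, List.prod_append, List.prod_cons, List.prod_nil, mul_one] at hln ⊢
    have hb := norm_nonneg b
    obtain ⟨c₀, hc₀, hc₀n, hc₀e⟩ := ih (fun b hb => hl b (by simp [hb])) (by linarith)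
      (ε / 2 / Real.exp ‖b‖) (by positivity)
    obtain ⟨c, hc, hcn, hce⟩ := exists_exp_near_mul hδ1 hK H hc₀ (hl b (by simp)) (by linarith)
      (half_pos hε)
    refine ⟨c, hc, by linarith, ?_⟩
    have h : exp c - (l.map exp).prod * exp b =
        (exp c - exp c₀ * exp b) + (exp c₀ - (l.map exp).prod) * exp b := by
      noncomm_ring
    rw [h]
    refine (norm_add_le _ _).trans_lt ?_
    have h2 : ‖(exp c₀ - (l.map exp).prod) * exp b‖ < ε / 2 := by
      refine (norm_mul_le _ _).trans_lt (lt_of_le_of_lt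
        (mul_le_mul_of_nonneg_left (norm_exp_le b) (norm_nonneg _)) ?_)
      rwa [← lt_div_iff₀ (Real.exp_pos _)]
    linarith

theorem SpectralBound.zero_mul {a g : A} (h : SpectralBound 0 a) (hc : Commute a g) :
    SpectralBound 0 (a * g) := by
  intro θ hθ
  obtain ⟨C, hC⟩ := h (θ / (‖g‖ + 1)) (by positivity)
  have hC0 : 0 ≤ C := by simpa using (norm_nonneg _).trans (hC 0)
  refine ⟨C, fun n => ?_⟩
  rw [hc.mul_pow]
  calc ‖a ^ n * g ^ n‖ ≤ (C * (θ / (‖g‖ + 1)) ^ n) * (‖g‖ + 1) ^ n := by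
        refine (norm_mul_le _ _).trans ?_
        gcongr
        · exact hC n
        · exact (norm_pow_le g n).trans (by gcongr; linarith)
    _ = _ := by
      rw [mul_assoc, ← mul_pow, div_mul_cancel₀ _ (by positivity)]

theorem exists_exp_sub_one_eq_mul (a : A) : ∃ g, Commute a g ∧ exp a - 1 = a * g := by
  have hs : Summable fun n : ℕ => (((n + 1).factorial : ℂ)⁻¹) • a ^ n := by
    refine Summable.of_norm_bounded (Real.summable_pow_div_factorial ‖a‖) fun n => ?_
    rw [norm_smul, norm_inv, Complex.norm_natCast, div_eq_inv_mul]
    gcongr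
    · exact n.le_succ
    · exact norm_pow_le a n
  have h1 := (hasSum_nat_add_iff' 1).2 (exp_series_hasSum_exp' (𝕂 := ℂ) a)
  have h2 := hs.hasSum.mul_left a
  refine ⟨_, Commute.tsum_right _ fun n => ((Commute.refl a).pow_right n).smul_right _,
    HasSum.unique ?_ h2⟩
  convert! h1 using 2 with n
  · rw [mul_smul_comm, pow_succ']
  · simp

/-- `exp a - 1` is quasinilpotent when `a` is. -/
theorem SpectralBound.exp_sub_one {a : A} (h : SpectralBound 0 a) :
    SpectralBound 0 (exp a - 1) := by
  obtain ⟨g, hc, hg⟩ := exists_exp_sub_one_eq_mul a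
  rw [hg]
  exact h.zero_mul hc

theorem SpectralBound.one_add {a : A} (h : SpectralBound 0 a) : SpectralBound 1 (1 + a) := by
  refine spectralBound_of_spectrum zero_le_one fun μ hμ => ?_
  have h1 : μ - 1 ∈ spectrum ℂ a := by
    rw [spectrum.mem_iff] at hμ ⊢
    rwa [map_sub, map_one, sub_sub]
  have h2 := h.norm_le le_rfl h1
  rw [norm_le_zero_iff, sub_eq_zero] at h2
  simp [h2]

/-- If `a ^ N` is small then the powers of `a` decay at the corresponding rate, with a constant
depending only on `N` and a bound for `a`. -/
theorem norm_pow_le_of_norm_pow_le {a : A} {θ R : ℝ} (hθ : 0 < θ) (hθR : θ ≤ R) (haR : ‖a‖ ≤ R)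
    {N : ℕ} (hN : 0 < N) (h : ‖a ^ N‖ ≤ θ ^ N) (n : ℕ) : ‖a ^ n‖ ≤ (R / θ) ^ N * θ ^ n := by
  have h1 : ‖a ^ n‖ ≤ (θ ^ N) ^ (n / N) * R ^ (n % N) := by
    conv_lhs => rw [← Nat.div_add_mod n N, pow_add, pow_mul]
    refine (norm_mul_le _ _).trans ?_
    gcongr
    · exact (norm_pow_le _ _).trans (by gcongr)
    · exact (norm_pow_le _ _).trans (by gcongr)
  have h2 : R ^ (n % N) = (R / θ) ^ (n % N) * θ ^ (n % N) := by
    rw [← mul_pow, div_mul_cancel₀ _ hθ.ne']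
  have h3 : (R / θ) ^ (n % N) ≤ (R / θ) ^ N :=
    pow_le_pow_right₀ ((one_le_div hθ).2 hθR) (Nat.mod_lt n hN).le
  calc _ ≤ _ := h1
    _ = (R / θ) ^ (n % N) * θ ^ n := by
      rw [h2, ← pow_mul, mul_left_comm, ← pow_add, Nat.div_add_mod]
    _ ≤ _ := by gcongr

theorem exists_uniform_norm_pow_le {T : Type*} [TopologicalSpace T] {s : Set T} (hs : IsCompact s)
    {f : T → A} (hf : Continuous f) (h : ∀ t ∈ s, SpectralBound 0 (f t)) {θ : ℝ} (hθ : 0 < θ) :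
    ∃ C, 0 ≤ C ∧ ∀ t ∈ s, ∀ n, ‖f t ^ n‖ ≤ C * θ ^ n := by
  obtain ⟨R, hR⟩ := (hs.image_of_continuousOn hf.continuousOn).isBounded.exists_norm_le
  have hR' : ∀ t ∈ s, ‖f t‖ ≤ max R θ := fun t ht =>
    (hR _ ⟨t, ht, rfl⟩).trans (le_max_left _ _)
  refine hs.induction_on (p := fun s' => ∃ C, 0 ≤ C ∧ ∀ t ∈ s' ∩ s, ∀ n, ‖f t ^ n‖ ≤ C * θ ^ n)
    ⟨0, le_rfl, by simp⟩ ?_ ?_ ?_ |>.imp fun C hC => ⟨hC.1, fun t ht => hC.2 t ⟨ht, ht⟩⟩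
  · rintro s' t' hst ⟨C, hC0, hC⟩
    exact ⟨C, hC0, fun t ht => hC t ⟨hst ht.1, ht.2⟩⟩
  · rintro s' t' ⟨C, hC0, hC⟩ ⟨D, hD0, hD⟩
    refine ⟨C + D, by positivity, ?_⟩
    rintro t ⟨ht | ht, hts⟩ n
    · exact (hC t ⟨ht, hts⟩ n).trans (by gcongr; linarith)
    · exact (hD t ⟨ht, hts⟩ n).trans (by gcongr; linarith)
  · intro t ht
    obtain ⟨C, hC⟩ := h t ht (θ / 2) (half_pos hθ)
    have hlim : Tendsto (fun n : ℕ => C * (1 / 2 : ℝ) ^ n) atTop (𝓝 0) := by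
      simpa using (tendsto_pow_atTop_nhds_zero_of_lt_one (r := (1 / 2 : ℝ)) (by norm_num)
        (by norm_num)).const_mul C
    obtain ⟨N, hN1, hN⟩ := ((hlim.eventually_lt_const zero_lt_one).and
      (eventually_gt_atTop 0)).exists
    have hlt : ‖f t ^ N‖ < θ ^ N := by
      refine (hC N).trans_lt ?_
      have : C * (θ / 2) ^ N = (C * (1 / 2) ^ N) * θ ^ N := by
        rw [mul_assoc, ← mul_pow]
        ring_nf
      rw [this]
      exact mul_lt_of_lt_one_left (by positivity) hN1
    refine ⟨{t' | ‖f t' ^ N‖ < θ ^ N}, mem_nhdsWithin_of_mem_nhds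
      ((hf.pow N).norm.tendsto t |>.eventually_lt_const hlt), (max R θ / θ) ^ N, ?_, ?_⟩
    · have := le_max_right R θ
      positivity
    · exact fun t' ht' => norm_pow_le_of_norm_pow_le hθ (le_max_right _ _) (hR' t' ht'.2) hN
        (le_of_lt ht'.1)

/-- An entire function with quasinilpotent values on a disc has quasinilpotent values. -/
theorem spectralBound_zero_of_differentiable {f : ℂ → A} (hf : Differentiable ℂ f) {δ : ℝ}
    (hδ : 0 < δ) (h : ∀ t, ‖t‖ ≤ δ → SpectralBound 0 (f t)) (t : ℂ) : SpectralBound 0 (f t) := by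
  rcases le_or_gt ‖t‖ δ with ht | ht
  · exact h t ht
  intro η hη
  set r := ‖t‖
  have hr : 0 < r := hδ.trans ht
  obtain ⟨M, hM⟩ := ((isCompact_closedBall (0 : ℂ) (2 * r)).image_of_continuousOn
    hf.continuous.continuousOn).isBounded.exists_norm_le
  have hM0 : 0 ≤ M := (norm_nonneg _).trans (hM (f 0) ⟨0, by simp [hr.le], rfl⟩)
  obtain ⟨s, hs⟩ : ∃ s : ℕ, M * (1 / 2 : ℝ) ^ s < η := by
    have : Tendsto (fun s : ℕ => M * (1 / 2 : ℝ) ^ s) atTop (𝓝 0) := by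
      simpa using (tendsto_pow_atTop_nhds_zero_of_lt_one (r := (1 / 2 : ℝ)) (by norm_num)
        (by norm_num)).const_mul M
    exact (this.eventually_lt_const hη).exists
  obtain ⟨C, hC0, hC⟩ := exists_uniform_norm_pow_le (isCompact_closedBall (0 : ℂ) δ)
    hf.continuous (fun z hz => h z (mem_closedBall_zero_iff.1 hz))
    (θ := η * (δ / r) ^ s) (by positivity)
  refine ⟨max C 1, fun n => ?_⟩
  let U : Set ℂ := {z | δ < ‖z‖ ∧ ‖z‖ < 2 * r}
  have hUo : IsOpen U := (isOpen_lt continuous_const continuous_norm).inter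
    (isOpen_lt continuous_norm continuous_const)
  have hUc : closure U ⊆ {z | δ ≤ ‖z‖ ∧ ‖z‖ ≤ 2 * r} :=
    closure_minimal (fun z hz => ⟨hz.1.le, hz.2.le⟩)
      ((isClosed_le continuous_const continuous_norm).inter
        (isClosed_le continuous_norm continuous_const))
  have hUb : Bornology.IsBounded U :=
    (Metric.isBounded_closedBall (x := (0 : ℂ)) (r := 2 * r)).subset
      fun z hz => mem_closedBall_zero_iff.2 hz.2.le
  have hd : DiffContOnCl ℂ (fun z => (z ^ (s * n))⁻¹ • f z ^ n) U := by
    refine DifferentiableOn.diffContOnCl fun z hz => ?_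
    have hz0 : z ≠ 0 := norm_pos_iff.1 (hδ.trans_le (hUc hz).1)
    exact (((differentiableAt_id.pow (s * n)).inv (pow_ne_zero _ hz0)).smul
      ((hf z).pow n)).differentiableWithinAt
  have hfr : ∀ z ∈ frontier U, ‖(z ^ (s * n))⁻¹ • f z ^ n‖ ≤ max C 1 * η ^ n * (r ^ (s * n))⁻¹ := by
    intro z hz
    rw [frontier, hUo.interior_eq] at hz
    have hz1 := hUc hz.1
    rw [norm_smul, norm_inv, norm_pow]
    rcases hz1.1.eq_or_lt with hzδ | hzδ
    · have := hC z (mem_closedBall_zero_iff.2 hzδ.ge) n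
      rw [← hzδ]
      calc _ ≤ (δ ^ (s * n))⁻¹ * (C * (η * (δ / r) ^ s) ^ n) := by gcongr
        _ = C * η ^ n * (r ^ (s * n))⁻¹ := by
          rw [mul_pow, ← pow_mul, div_pow]
          field_simp
        _ ≤ _ := by
          gcongr
          exact le_max_left _ _
    · have hzr : ‖z‖ = 2 * r := hz1.2.eq_or_lt.resolve_right fun h' => hz.2 ⟨hzδ, h'⟩
      have hfz : ‖f z ^ n‖ ≤ M ^ n := (norm_pow_le _ _).trans (by
        gcongr
        exact hM _ ⟨z, mem_closedBall_zero_iff.2 hzr.le, rfl⟩)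
      rw [hzr]
      calc _ ≤ ((2 * r) ^ (s * n))⁻¹ * M ^ n := by gcongr
        _ = 1 * (M * (1 / 2) ^ s) ^ n * (r ^ (s * n))⁻¹ := by
          rw [mul_pow M, ← pow_mul, mul_pow 2 r, one_div, inv_pow, mul_inv]
          ring
        _ ≤ _ := by
          gcongr
          exact le_max_right _ _
  have := Complex.norm_le_of_forall_mem_frontier_norm_le hUb hd hfr
    (subset_closure (⟨ht, by change r < 2 * r; linarith⟩ : t ∈ U))
  rw [norm_smul, norm_inv, norm_pow, mul_comm] at this
  exact le_of_mul_le_mul_right this (by positivity)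

end

section

variable {X : Type*} [NormedAddCommGroup X] [NormedSpace ℂ X] [CompleteSpace X] [Nontrivial X]

open NormedSpace

theorem isCompactOperator_exp_sub_one {a : X →L[ℂ] X} (ha : IsCompactOperator a) :
    IsCompactOperator (exp a - 1 : X →L[ℂ] X) := by
  obtain ⟨g, -, hg⟩ := exists_exp_sub_one_eq_mul a
  rw [hg]
  exact ha.comp_clm g

theorem isCompactOperator_prod_exp_sub_one {l : List (X →L[ℂ] X)}
    (hl : ∀ a ∈ l, IsCompactOperator a) :
    IsCompactOperator ((l.map exp).prod - 1 : X →L[ℂ] X) := by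
  induction l with
  | nil =>
    simp only [List.map_nil, List.prod_nil, sub_self]
    exact isCompactOperator_zero
  | cons a l ih =>
    rw [List.map_cons, List.prod_cons]
    have h : exp a * (l.map exp).prod - 1 =
        (exp a - 1) * (l.map exp).prod + ((l.map exp).prod - 1) := by noncomm_ring
    rw [h]
    exact ((isCompactOperator_exp_sub_one (hl a (by simp))).comp_clm _).add
      (ih fun b hb => hl b (by simp [hb]))

theorem differentiable_prod_exp_smul (l : List (X →L[ℂ] X)) :
    Differentiable ℂ fun t : ℂ => ((l.map (t • ·)).map exp).prod := by
  induction l with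
  | nil =>
    simp only [List.map_nil, List.prod_nil]
    exact differentiable_const _
  | cons a l ih =>
    simp only [List.map_cons, List.prod_cons]
    have h : Differentiable ℂ fun t : ℂ => exp (t • a) :=
      fun t => (hasDerivAt_exp_smul_const a t).differentiableAt
    exact h.mul ih

theorem spectralBound_prod_exp {S : Submodule ℂ (X →L[ℂ] X)}
    (hS : IsClosed (S : Set (X →L[ℂ] X))) (hlie : ∀ a ∈ S, ∀ b ∈ S, a * b - b * a ∈ S)
    (hc : ∀ a ∈ S, IsCompactOperator a) (hq : ∀ a ∈ S, SpectralBound 0 a)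
    {l : List (X →L[ℂ] X)} (hl : ∀ a ∈ l, a ∈ S) : SpectralBound 1 (l.map exp).prod := by
  obtain ⟨δ, hδ, H⟩ := exists_exp_near_prod hS hlie
  set σ := (l.map (‖·‖)).sum
  have hσ : 0 ≤ σ := List.sum_nonneg (by simp)
  have hmain := spectralBound_zero_of_differentiable
    ((differentiable_prod_exp_smul l).sub_const 1) (δ := δ / (σ + 1)) (by positivity)
    (fun t ht => ?_) 1
  · have h := hmain.one_add
    rw [add_sub_cancel] at h
    simpa using h
  · have hl' : ∀ a ∈ l.map (t • ·), a ∈ S := by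
      intro a ha
      obtain ⟨b, hb, rfl⟩ := List.mem_map.1 ha
      exact S.smul_mem _ (hl b hb)
    have hsum : ((l.map (t • ·)).map (‖·‖)).sum = ‖t‖ * σ := by
      rw [List.map_map, ← List.sum_map_mul_left]
      congr 1
      exact List.map_congr_left fun a _ => norm_smul t a
    have hle : ((l.map (t • ·)).map (‖·‖)).sum ≤ δ := by
      rw [hsum]
      rw [le_div_iff₀ (by positivity)] at ht
      nlinarith [norm_nonneg t]
    choose c hcS _hcn hcε using fun n : ℕ => H _ hl' hle (1 / ((n : ℝ) + 1)) (by positivity)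
    have hlim : Tendsto (fun n => exp (c n) - 1) atTop
        (𝓝 (((l.map (t • ·)).map exp).prod - 1)) := by
      refine Tendsto.sub_const ?_ 1
      rw [tendsto_iff_norm_sub_tendsto_zero]
      exact squeeze_zero (fun _ => norm_nonneg _) (fun n => (hcε n).le)
        tendsto_one_div_add_atTop_nhds_zero_nat
    exact SpectralBound.of_tendsto
      (isCompactOperator_prod_exp_sub_one fun a ha => hc a (hl' a ha)) hlim le_rfl
      (Eventually.of_forall fun n => (hq _ (hcS n)).exp_sub_one)

end

theorem exists_tendsto_ultrafilter {I Y : Type*} [TopologicalSpace Y] {K : Set Y}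
    (hK : IsCompact K) (U : Ultrafilter I) {f : I → Y} (hf : ∀ᶠ i in (U : Filter I), f i ∈ K) :
    ∃ a ∈ K, Tendsto f U (𝓝 a) :=
  hK.ultrafilter_le_nhds (U.map f) (le_principal_iff.2 hf)

theorem exists_tendsto_of_forall_eventually_norm_sub_le {I Y : Type*} [NormedAddCommGroup Y]
    [CompleteSpace Y] {U : Filter I} [U.NeBot] {f : I → Y}
    (hf : ∀ ε > 0, ∃ z, ∀ᶠ i in U, ‖f i - z‖ ≤ ε) : ∃ a, Tendsto f U (𝓝 a) := by
  refine cauchy_map_iff_exists_tendsto.1 (Metric.cauchy_iff.2 ⟨inferInstance, fun ε hε => ?_⟩)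
  obtain ⟨z, hz⟩ := hf (ε / 3) (by positivity)
  refine ⟨f '' {i | ‖f i - z‖ ≤ ε / 3}, image_mem_map hz, ?_⟩
  rintro _ ⟨i, hi, rfl⟩ _ ⟨k, hk, rfl⟩
  rw [Set.mem_ofPred_eq, ← dist_eq_norm] at hi hk
  have := dist_triangle_right (f i) (f k) z
  linarith

section

variable {X : Type*} [NormedAddCommGroup X] [NormedSpace ℂ X]

/-- The operator `s + k` attached to a pair `(s, k)`. -/
def affineOp (p : ℂ × (X →L[ℂ] X)) : X →L[ℂ] X := p.1 • 1 + p.2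

/-- The product of the operators attached to a list of pairs. -/
def word (l : List (ℂ × (X →L[ℂ] X))) : X →L[ℂ] X := (l.map affineOp).prod

theorem affineOp_apply (p : ℂ × (X →L[ℂ] X)) (x : X) : affineOp p x = p.1 • x + p.2 x := rfl

theorem continuous_affineOp : Continuous (affineOp : ℂ × (X →L[ℂ] X) → X →L[ℂ] X) := by
  unfold affineOp
  fun_prop

@[simp] theorem word_nil : word ([] : List (ℂ × (X →L[ℂ] X))) = 1 := rfl

theorem word_cons (p : ℂ × (X →L[ℂ] X)) (l : List (ℂ × (X →L[ℂ] X))) :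
    word (p :: l) = affineOp p * word l := by
  simp [word]

theorem word_append (l l' : List (ℂ × (X →L[ℂ] X))) : word (l ++ l') = word l * word l' := by
  simp [word]

theorem affineOp_smul (t : ℂ) (p : ℂ × (X →L[ℂ] X)) : affineOp (t • p) = t • affineOp p := by
  simp [affineOp, smul_smul]

theorem word_map_smul (t : ℂ) (l : List (ℂ × (X →L[ℂ] X))) :
    word (l.map (t • ·)) = t ^ l.length • word l := by
  induction l with
  | nil => simp
  | cons p l ih =>
    rw [List.map_cons, word_cons, ih, affineOp_smul, word_cons, List.length_cons,
      smul_mul_smul_comm,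
      pow_succ']

/-- A compact family of operators `s + k` with `‖s‖ ≤ τ < 1` and `k` compact. -/
structure CompactFamily (P : Set (ℂ × (X →L[ℂ] X))) (τ : ℝ) : Prop where
  isCompact : IsCompact P
  nonneg : 0 ≤ τ
  lt_one : τ < 1
  norm_le : ∀ p ∈ P, ‖p.1‖ ≤ τ
  compact : ∀ p ∈ P, IsCompactOperator p.2

/-- A sequence in the unit ball running backwards through a family of operators. -/
def IsOrbit (P : Set (ℂ × (X →L[ℂ] X))) (x : ℕ → X) : Prop :=
  ∀ m, ‖x m‖ ≤ 1 ∧ ∃ p ∈ P, x m = affineOp p (x (m + 1))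

theorem mapsTo_word {P : Set (ℂ × (X →L[ℂ] X))} {V : Submodule ℂ X}
    (hV : ∀ p ∈ P, ∀ v ∈ V, affineOp p v ∈ V) {l : List (ℂ × (X →L[ℂ] X))}
    (hl : ∀ p ∈ l, p ∈ P) {v : X} (hv : v ∈ V) : word l v ∈ V := by
  induction l with
  | nil => simpa using hv
  | cons p l ih =>
    rw [word_cons]
    exact hV p (hl p (by simp)) _ (ih fun q hq => hl q (by simp [hq]))

namespace CompactFamily

variable {P : Set (ℂ × (X →L[ℂ] X))} {τ : ℝ}

theorem exists_words (hP : CompactFamily P τ) (j : ℕ) :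
    ∃ Q : Set (ℂ × (X →L[ℂ] X)), IsCompact Q ∧ (∀ p ∈ Q, ‖p.1‖ ≤ τ ^ j) ∧
      (∀ p ∈ Q, IsCompactOperator p.2) ∧
      ∀ l : List (ℂ × (X →L[ℂ] X)), (∀ p ∈ l, p ∈ P) → l.length = j →
        ∃ p ∈ Q, word l = affineOp p := by
  induction j with
  | zero =>
    refine ⟨{(1, 0)}, isCompact_singleton, by simp, ?_, ?_⟩
    · rintro p rfl
      exact isCompactOperator_zero
    · intro l _ hl
      rw [List.length_eq_zero_iff] at hl
      exact ⟨(1, 0), rfl, by simp [hl, affineOp]⟩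
  | succ j ih =>
    obtain ⟨Q, hQ, hQn, hQc, hQw⟩ := ih
    let φ : (ℂ × (X →L[ℂ] X)) × (ℂ × (X →L[ℂ] X)) → ℂ × (X →L[ℂ] X) :=
      fun q => (q.1.1 * q.2.1, q.1.1 • q.2.2 + q.1.2 * affineOp q.2)
    have hφ : Continuous φ := by
      have := continuous_affineOp (X := X)
      fun_prop
    refine ⟨φ '' (P ×ˢ Q), (hP.isCompact.prod hQ).image hφ, ?_, ?_, ?_⟩
    · rintro _ ⟨⟨p, q⟩, ⟨hp, hq⟩, rfl⟩
      rw [pow_succ']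
      exact (norm_mul_le _ _).trans (mul_le_mul (hP.norm_le p hp) (hQn q hq) (norm_nonneg _)
        hP.nonneg)
    · rintro _ ⟨⟨p, q⟩, ⟨hp, hq⟩, rfl⟩
      exact ((hQc q hq).smul p.1).add ((hP.compact p hp).comp_clm (affineOp q))
    · intro l hl hlen
      cases l with
      | nil => simp at hlen
      | cons p l =>
        obtain ⟨q, hq, hw⟩ := hQw l (fun r hr => hl r (by simp [hr])) (by simpa using hlen)
        refine ⟨φ (p, q), ⟨(p, q), ⟨hl p (by simp), hq⟩, rfl⟩, ?_⟩
        rw [word_cons, hw]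
        ext x
        simp only [affineOp_apply, φ]
        change p.1 • (q.1 • x + q.2 x) + p.2 (q.1 • x + q.2 x) =
          (p.1 * q.1) • x + (p.1 • q.2 x + p.2 (q.1 • x + q.2 x))
        rw [smul_add, smul_smul, add_assoc]

theorem exists_norm_affineOp_le (hP : CompactFamily P τ) :
    ∃ B, 1 ≤ B ∧ ∀ l : List (ℂ × (X →L[ℂ] X)), (∀ p ∈ l, p ∈ P) → ‖word l‖ ≤ B ^ l.length := by
  obtain ⟨B, hB⟩ := (hP.isCompact.image continuous_affineOp).isBounded.exists_norm_le
  refine ⟨max B 1, le_max_right _ _, fun l => ?_⟩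
  induction l with
  | nil => exact fun _ => (ContinuousLinearMap.norm_id_le (𝕜 := ℂ) (E := X)).trans (by simp)
  | cons p l ih =>
    intro hl
    rw [word_cons, List.length_cons, pow_succ']
    exact (norm_mul_le _ _).trans (mul_le_mul
      ((hB _ ⟨p, hl p (by simp), rfl⟩).trans (le_max_left _ _))
      (ih fun q hq => hl q (by simp [hq])) (norm_nonneg _) (by positivity))

end CompactFamily

theorem exists_tendsto_apply {I : Type*} (U : Ultrafilter I) {Q : Set (ℂ × (X →L[ℂ] X))}
    (hQ : IsCompact Q) (hQc : ∀ p ∈ Q, IsCompactOperator p.2) {p : I → ℂ × (X →L[ℂ] X)} {y : I → X}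
    (hp : ∀ᶠ i in (U : Filter I), p i ∈ Q) {r : ℝ} (hy : ∀ᶠ i in (U : Filter I), ‖y i‖ ≤ r) :
    ∃ z, Tendsto (fun i => (p i).2 (y i)) U (𝓝 z) := by
  obtain ⟨q, hq, hpq⟩ := exists_tendsto_ultrafilter hQ U hp
  obtain ⟨K, hK, hqK⟩ := IsCompactOperator.image_closedBall_subset_compact (𝕜₁ := ℂ) (𝕜₂ := ℂ)
    (f := (q.2 : X →ₗ[ℂ] X)) (hQc q hq) r
  obtain ⟨z, -, hz⟩ := exists_tendsto_ultrafilter (f := fun i => q.2 (y i)) hK U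
    (hy.mono fun i hi => hqK ⟨y i, mem_closedBall_zero_iff.2 hi, rfl⟩)
  refine ⟨z, ?_⟩
  have h2 : Tendsto (fun i => (p i).2 - q.2) U (𝓝 0) := by
    simpa using ((continuous_snd.tendsto _).comp hpq).sub_const q.2
  have h3 : Tendsto (fun i => ((p i).2 - q.2) (y i)) U (𝓝 0) := by
    refine squeeze_zero_norm' (hy.mono fun i hi => ((p i).2 - q.2).le_opNorm_of_le hi) ?_
    simpa using h2.norm.mul_const r
  have h4 := h3.add hz
  rw [zero_add] at h4
  refine h4.congr fun i => ?_
  change (p i).2 (y i) - q.2 (y i) + q.2 (y i) = _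
  exact sub_add_cancel _ _

section

variable [CompleteSpace X] {P : Set (ℂ × (X →L[ℂ] X))} {τ : ℝ}

theorem CompactFamily.exists_tendsto (hP : CompactFamily P τ) {I : Type*} (U : Ultrafilter I)
    {x : I → X} (hx : ∀ j, ∀ᶠ i in (U : Filter I), ∃ l : List (ℂ × (X →L[ℂ] X)),
      (∀ p ∈ l, p ∈ P) ∧ l.length = j ∧ ∃ y, ‖y‖ ≤ 1 ∧ x i = word l y) :
    ∃ a, Tendsto x U (𝓝 a) := by
  refine exists_tendsto_of_forall_eventually_norm_sub_le fun ε hε => ?_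
  obtain ⟨j, hj⟩ := exists_pow_lt_of_lt_one (half_pos hε) hP.lt_one
  obtain ⟨Q, hQ, hQn, hQc, hQw⟩ := hP.exists_words j
  have h : ∀ i, ∃ p : ℂ × (X →L[ℂ] X), ∃ y : X, (∃ l : List (ℂ × (X →L[ℂ] X)),
      (∀ p ∈ l, p ∈ P) ∧ l.length = j ∧ ∃ y, ‖y‖ ≤ 1 ∧ x i = word l y) →
      p ∈ Q ∧ ‖y‖ ≤ 1 ∧ x i = affineOp p y := by
    intro i
    by_cases h : ∃ l : List (ℂ × (X →L[ℂ] X)),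
      (∀ p ∈ l, p ∈ P) ∧ l.length = j ∧ ∃ y, ‖y‖ ≤ 1 ∧ x i = word l y
    · obtain ⟨l, hl, hlj, y, hy, hxy⟩ := h
      obtain ⟨p, hp, hw⟩ := hQw l hl hlj
      exact ⟨p, y, fun _ => ⟨hp, hy, by rw [hxy, hw]⟩⟩
    · exact ⟨0, 0, fun h' => absurd h' h⟩
  choose p y hpy using h
  obtain ⟨z, hz⟩ := exists_tendsto_apply U hQ hQc ((hx j).mono fun i hi => (hpy i hi).1)
    ((hx j).mono fun i hi => (hpy i hi).2.1)
  refine ⟨z, ?_⟩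
  filter_upwards [hx j, Metric.tendsto_nhds.1 hz (ε / 2) (half_pos hε)] with i hi hiz
  obtain ⟨h1, h2, h3⟩ := hpy i hi
  rw [dist_eq_norm] at hiz
  rw [h3, affineOp_apply, add_sub_assoc]
  have h4 : ‖(p i).1 • y i‖ ≤ τ ^ j := by
    rw [norm_smul]
    exact (mul_le_of_le_one_right (norm_nonneg _) h2).trans (hQn _ h1)
  linarith [norm_add_le ((p i).1 • y i) ((p i).2 (y i) - z)]

theorem eventually_exists_word {I : Type*} {F : Filter I} {x : I → ℕ → X}
    (h : ∀ m, ∀ᶠ i in F, ∃ p ∈ P, x i m = affineOp p (x i (m + 1))) (j m : ℕ) :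
    ∀ᶠ i in F, ∃ l : List (ℂ × (X →L[ℂ] X)), (∀ p ∈ l, p ∈ P) ∧ l.length = j ∧
      x i m = word l (x i (m + j)) := by
  induction j generalizing m with
  | zero => exact Eventually.of_forall fun i => ⟨[], by simp, rfl, by simp⟩
  | succ j ih =>
    filter_upwards [h m, ih (m + 1)] with i hi hi'
    obtain ⟨p, hp, hxp⟩ := hi
    obtain ⟨l, hl, hlj, hxl⟩ := hi'
    refine ⟨p :: l, by simpa using ⟨hp, fun a b => hl (a, b)⟩, by simp [hlj], ?_⟩
    rw [word_cons, hxp, hxl, add_right_comm, add_assoc]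
    rfl

theorem IsOrbit.exists_word {x : ℕ → X} (hx : IsOrbit P x) (j m : ℕ) :
    ∃ l : List (ℂ × (X →L[ℂ] X)), (∀ p ∈ l, p ∈ P) ∧ l.length = j ∧
      x m = word l (x (m + j)) := by
  have := eventually_exists_word (F := (⊤ : Filter Unit)) (x := fun _ => x) (P := P)
    (fun m => Eventually.of_forall fun _ => (hx m).2) j m
  exact this.exists.elim fun _ h => h

theorem CompactFamily.exists_orbit (hP : CompactFamily P τ) {I : Type*} (U : Ultrafilter I)
    {x : I → ℕ → X} (hx : ∀ m, ∀ᶠ i in (U : Filter I), ‖x i m‖ ≤ 1)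
    (h : ∀ m, ∀ᶠ i in (U : Filter I), ∃ p ∈ P, x i m = affineOp p (x i (m + 1))) :
    ∃ a, IsOrbit P a ∧ ∀ m, Tendsto (fun i => x i m) U (𝓝 (a m)) := by
  have hlim : ∀ m, ∃ a, Tendsto (fun i => x i m) U (𝓝 a) := fun m => by
    refine hP.exists_tendsto U fun j => ?_
    filter_upwards [hx (m + j), eventually_exists_word h j m] with i hi ⟨l, hl, hlj, hxl⟩
    exact ⟨l, hl, hlj, _, hi, hxl⟩
  choose a ha using hlim
  refine ⟨a, fun m => ⟨le_of_tendsto (ha m).norm (hx m), ?_⟩, ha⟩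
  have hch : ∀ i, ∃ p, (∃ p ∈ P, x i m = affineOp p (x i (m + 1))) →
      p ∈ P ∧ x i m = affineOp p (x i (m + 1)) := by
    intro i
    by_cases h : ∃ p ∈ P, x i m = affineOp p (x i (m + 1))
    · exact ⟨h.choose, fun _ => h.choose_spec⟩
    · exact ⟨0, fun h' => absurd h' h⟩
  choose p hp using hch
  obtain ⟨q, hq, hpq⟩ := exists_tendsto_ultrafilter hP.isCompact U
    ((h m).mono fun i hi => (hp i hi).1)
  refine ⟨q, hq, tendsto_nhds_unique (ha m) ?_⟩
  refine ((isBoundedBilinearMap_apply (𝕜 := ℂ).continuous.tendsto _).comp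
    (((continuous_affineOp.tendsto _).comp hpq).prodMk_nhds (ha (m + 1)))).congr' ?_
  filter_upwards [h m] with i hi
  exact (hp i hi).2.symm

end

end

section

variable {X : Type*} [NormedAddCommGroup X] [NormedSpace ℂ X] {P : Set (ℂ × (X →L[ℂ] X))} {τ : ℝ}

theorem exists_near_maximal_word
    (hgrowth : ∀ t : ℝ, 0 ≤ t → t < 1 → ∃ C, ∀ l : List (ℂ × (X →L[ℂ] X)), (∀ p ∈ l, p ∈ P) →
      ‖word (l.map ((t : ℂ) • ·))‖ ≤ C) {V : Submodule ℂ X}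
    (hunb : ¬∃ C, ∀ l : List (ℂ × (X →L[ℂ] X)), (∀ p ∈ l, p ∈ P) → ∀ v ∈ V, ‖v‖ ≤ 1 →
      ‖word l v‖ ≤ C) (k : ℕ) :
    ∃ (t M : ℝ) (l : List (ℂ × (X →L[ℂ] X))) (y : X), 1 / 2 ≤ t ∧ t ≤ 1 ∧ (k : ℝ) + 1 ≤ M ∧
      (∀ l' : List (ℂ × (X →L[ℂ] X)), (∀ p ∈ l', p ∈ P) → ∀ v ∈ V, ‖v‖ ≤ 1 →
        ‖word (l'.map ((t : ℂ) • ·)) v‖ ≤ M) ∧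
      (∀ p ∈ l, p ∈ P) ∧ y ∈ V ∧ ‖y‖ ≤ 1 ∧ M / 2 ≤ ‖word (l.map ((t : ℂ) • ·)) y‖ := by
  push Not at hunb
  obtain ⟨l₀, hl₀, v₀, hv₀, hv₀1, hlt⟩ := hunb (k + 1)
  obtain ⟨t, ht, ht1, hkt⟩ : ∃ t : ℝ, 1 / 2 ≤ t ∧ t < 1 ∧
      (k : ℝ) + 1 < ‖word (l₀.map ((t : ℂ) • ·)) v₀‖ := by
    have hc : Tendsto (fun t : ℝ => ‖word (l₀.map ((t : ℂ) • ·)) v₀‖) (𝓝[<] 1)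
        (𝓝 ‖word l₀ v₀‖) := by
      have : Continuous fun t : ℝ => ‖((t : ℂ) ^ l₀.length • word l₀) v₀‖ := by
        change Continuous fun t : ℝ => ‖(t : ℂ) ^ l₀.length • word l₀ v₀‖
        fun_prop
      simp only [word_map_smul]
      have h := (this.tendsto 1).mono_left (nhdsWithin_le_nhds (s := Set.Iio 1))
      simpa using h
    have h1 : ∀ᶠ t : ℝ in 𝓝[<] 1, 1 / 2 ≤ t :=
      eventually_nhdsWithin_of_eventually_nhds (eventually_ge_nhds (by norm_num))
    obtain ⟨t, h1, h2, h3⟩ := (h1.and ((hc.eventually (lt_mem_nhds hlt)).and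
      self_mem_nhdsWithin)).exists
    exact ⟨t, h1, h3, h2⟩
  obtain ⟨C, hC⟩ := hgrowth t (by linarith) ht1
  set s : Set ℝ := {r | ∃ l : List (ℂ × (X →L[ℂ] X)), (∀ p ∈ l, p ∈ P) ∧ ∃ v ∈ V, ‖v‖ ≤ 1 ∧
    r = ‖word (l.map ((t : ℂ) • ·)) v‖}
  have hs : BddAbove s := by
    refine ⟨C, ?_⟩
    rintro _ ⟨l, hl, v, -, hv, rfl⟩
    exact (ContinuousLinearMap.le_opNorm_of_le _ hv).trans (by simpa using hC l hl)
  have hs0 : ‖word (l₀.map ((t : ℂ) • ·)) v₀‖ ∈ s := ⟨l₀, hl₀, v₀, hv₀, hv₀1, rfl⟩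
  have hk := hkt.trans_le (le_csSup hs hs0)
  have hpos : 0 < sSup s := lt_trans (by positivity) hk
  obtain ⟨_, ⟨l, hl, y, hy, hy1, rfl⟩, hly⟩ := exists_lt_of_lt_csSup ⟨_, hs0⟩ (half_lt_self hpos)
  exact ⟨t, sSup s, l, y, ht, ht1.le, hk.le,
    fun l' hl' v hv hv1 => le_csSup hs ⟨l', hl', v, hv, hv1, rfl⟩, hl, hy, hy1, hly.le⟩

variable [CompleteSpace X]

/-- If words are unbounded on an invariant subspace, that subspace is not a minimal one among
those carrying a backward orbit. -/
theorem CompactFamily.exists_smaller (hP : CompactFamily P τ)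
    (hstar : ∀ p ∈ P, ∀ t : ℝ, 0 ≤ t → t ≤ 1 → (t : ℂ) • p ∈ P)
    (hgrowth : ∀ t : ℝ, 0 ≤ t → t < 1 → ∃ C, ∀ l : List (ℂ × (X →L[ℂ] X)), (∀ p ∈ l, p ∈ P) →
      ‖word (l.map ((t : ℂ) • ·))‖ ≤ C) {V : Submodule ℂ X} (hVc : IsClosed (V : Set X))
    (hV : ∀ p ∈ P, ∀ v ∈ V, affineOp p v ∈ V)
    (hunb : ¬∃ C, ∀ l : List (ℂ × (X →L[ℂ] X)), (∀ p ∈ l, p ∈ P) → ∀ v ∈ V, ‖v‖ ≤ 1 →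
      ‖word l v‖ ≤ C) :
    ∃ Z : Submodule ℂ X, IsClosed (Z : Set X) ∧ Z < V ∧ (∀ p ∈ P, ∀ v ∈ Z, affineOp p v ∈ Z) ∧
      ∃ x, IsOrbit P x ∧ (∀ m, x m ∈ Z) ∧ 1 / 2 ≤ ‖x 0‖ := by
  choose t M l y ht ht1 hM hmax hl hy hy1 hly using exists_near_maximal_word hgrowth hunb
  have hM0 : ∀ k, 0 < M k := fun k => lt_of_lt_of_le (by positivity) (hM k)
  set U : Ultrafilter ℕ := Ultrafilter.of atTop
  have hU : (U : Filter ℕ) ≤ atTop := Ultrafilter.of_le atTop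
  have hMinv : Tendsto (fun k => (M k)⁻¹) U (𝓝 0) := by
    refine (tendsto_inv_atTop_zero.comp (tendsto_atTop_mono (fun k => ?_)
      tendsto_natCast_atTop_atTop)).mono_left hU
    linarith [hM k]
  have hscale : ∀ k, ∀ l' : List (ℂ × (X →L[ℂ] X)), (∀ p ∈ l', p ∈ P) →
      ∀ p ∈ l'.map ((t k : ℂ) • ·), p ∈ P := by
    intro k l' hl' p hp
    obtain ⟨q, hq, rfl⟩ := List.mem_map.1 hp
    exact hstar q (hl' q hq) _ (by linarith [ht k]) (ht1 k)
  have hbound : ∀ k, ∀ l' : List (ℂ × (X →L[ℂ] X)), (∀ p ∈ l', p ∈ P) → ∀ v ∈ V,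
      ‖word (l'.map ((t k : ℂ) • ·)) v‖ ≤ M k * ‖v‖ := by
    intro k l' hl' v hv
    rcases eq_or_ne v 0 with rfl | hv0
    · simp
    have hn : 0 < ‖v‖ := norm_pos_iff.2 hv0
    have h := hmax k l' hl' (((‖v‖⁻¹ : ℝ) : ℂ) • v) (V.smul_mem _ hv)
      (by simp [norm_smul, hn.ne'])
    rw [map_smul, norm_smul, Complex.norm_real, norm_inv, norm_norm] at h
    rwa [inv_mul_le_iff₀ hn, mul_comm] at h
  -- lengths tend to infinity
  have hlen : ∀ j : ℕ, ∀ᶠ k in (U : Filter ℕ), j < (l k).length := by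
    intro j
    obtain ⟨B, hB1, hB⟩ := hP.exists_norm_affineOp_le
    refine hU ?_
    obtain ⟨k₀, hk₀⟩ := exists_nat_gt (2 * B ^ j)
    filter_upwards [eventually_ge_atTop k₀] with k hk
    by_contra! hlt
    have h1 := (hly k).trans (ContinuousLinearMap.le_opNorm_of_le _ (hy1 k))
    have h2 := hB _ (hscale k (l k) (hl k))
    rw [List.length_map] at h2
    have h3 : B ^ (l k).length ≤ B ^ j := pow_le_pow_right₀ hB1 hlt
    have h4 : (k₀ : ℝ) ≤ k := by exact_mod_cast hk
    linarith [hM k]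
  set xk : ℕ → ℕ → X := fun k m =>
    (((M k)⁻¹ : ℝ) : ℂ) • word (((l k).drop m).map ((t k : ℂ) • ·)) (y k) with hxk
  have hxkV : ∀ k m, xk k m ∈ V := fun k m => V.smul_mem _ (mapsTo_word hV
    (hscale k _ fun p hp => hl k p (List.mem_of_mem_drop hp)) (hy k))
  have hnormM : ∀ k, ‖(((M k)⁻¹ : ℝ) : ℂ)‖ = (M k)⁻¹ := fun k => by
    rw [Complex.norm_real, Real.norm_of_nonneg (inv_nonneg.2 (hM0 k).le)]
  have hxk1 : ∀ k m, ‖xk k m‖ ≤ 1 := fun k m => by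
    rw [hxk]
    simp only
    rw [norm_smul, hnormM, inv_mul_le_iff₀ (hM0 k), mul_one]
    exact hmax k _ (fun p hp => hl k p (List.mem_of_mem_drop hp)) _ (hy k) (hy1 k)
  obtain ⟨x, hx, hxlim⟩ := hP.exists_orbit U (x := xk)
    (fun m => Eventually.of_forall fun k => hxk1 k m) (fun m => by
      filter_upwards [hlen m] with k hk
      refine ⟨(t k : ℂ) • (l k)[m], hstar _ (hl k _ (List.getElem_mem hk)) _ (by linarith [ht k])
        (ht1 k), ?_⟩
      simp only [hxk]
      rw [List.drop_eq_getElem_cons hk, List.map_cons, word_cons, map_smul]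
      rfl)
  have hx0 : 1 / 2 ≤ ‖x 0‖ := by
    refine ge_of_tendsto' (hxlim 0).norm fun k => ?_
    simp only [hxk, List.drop_zero]
    rw [norm_smul, hnormM, ← div_eq_inv_mul, le_div_iff₀ (hM0 k)]
    linarith [hly k]
  have hxV : ∀ m, x m ∈ V := fun m =>
    hVc.mem_of_tendsto (hxlim m) (Eventually.of_forall fun k => hxkV k m)
  obtain ⟨j, hj⟩ := exists_pow_lt_of_lt_one (show (0 : ℝ) < 1 / 4 by norm_num) hP.lt_one
  obtain ⟨Q, hQ, hQn, hQc, hQw⟩ := hP.exists_words j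
  set a : ℕ → X →L[ℂ] X := fun k =>
    (((M k)⁻¹ : ℝ) : ℂ) • word (((l k).take ((l k).length - j)).map ((t k : ℂ) • ·)) with ha
  have haV : ∀ k, ∀ v ∈ V, ‖a k v‖ ≤ ‖v‖ := fun k v hv => by
    change ‖(((M k)⁻¹ : ℝ) : ℂ) • word (((l k).take ((l k).length - j)).map ((t k : ℂ) • ·)) v‖ ≤ _
    rw [norm_smul, hnormM, inv_mul_le_iff₀ (hM0 k)]
    exact hbound k _ (fun p hp => hl k p (List.mem_of_mem_take hp)) v hv
  let Z : Submodule ℂ X :=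
    { carrier := {v | v ∈ V ∧ ∀ l' : List (ℂ × (X →L[ℂ] X)), (∀ p ∈ l', p ∈ P) →
        Tendsto (fun k => a k (word l' v)) U (𝓝 0)}
      zero_mem' := ⟨V.zero_mem, fun l' _ => by simp⟩
      add_mem' := fun {v w} hv hw => ⟨V.add_mem hv.1 hw.1, fun l' hl' => by
        simpa using (hv.2 l' hl').add (hw.2 l' hl')⟩
      smul_mem' := fun c v hv => ⟨V.smul_mem _ hv.1, fun l' hl' => by
        simpa using (hv.2 l' hl').const_smul c⟩ }
  have hZ : ∀ v, v ∈ Z ↔ v ∈ V ∧ ∀ l' : List (ℂ × (X →L[ℂ] X)), (∀ p ∈ l', p ∈ P) →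
        Tendsto (fun k => a k (word l' v)) U (𝓝 0) := fun v => Iff.rfl
  have happrox : ∀ v ∈ V, (∀ ε > 0, ∃ w : ℕ → X, (∀ k, w k ∈ V) ∧
      (∀ᶠ k in (U : Filter ℕ), ‖v - w k‖ < ε) ∧ ∀ l' : List (ℂ × (X →L[ℂ] X)),
      (∀ p ∈ l', p ∈ P) → Tendsto (fun k => a k (word l' (w k))) U (𝓝 0)) → v ∈ Z := by
    refine fun v hv H => ⟨hv, fun l' hl' => ?_⟩
    rw [Metric.tendsto_nhds]
    intro ε hε
    have hw0 := norm_nonneg (word l')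
    obtain ⟨w, hwV, hvw, hw⟩ := H (ε / 2 / (‖word l'‖ + 1)) (by positivity)
    filter_upwards [hvw, Metric.tendsto_nhds.1 (hw l' hl') (ε / 2) (half_pos hε)] with k h1 h2
    rw [dist_zero_right] at h2 ⊢
    have h3 := haV k _ (mapsTo_word hV hl' (V.sub_mem hv (hwV k)))
    have h4 := (word l').le_opNorm (v - w k)
    have h5 : a k (word l' v) = a k (word l' (v - w k)) + a k (word l' (w k)) := by
      rw [map_sub, map_sub, sub_add_cancel]
    rw [h5]
    rw [lt_div_iff₀ (by positivity)] at h1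
    have h6 := norm_add_le (a k (word l' (v - w k))) (a k (word l' (w k)))
    nlinarith [norm_nonneg (v - w k)]
  have hxZ : ∀ m, x m ∈ Z := by
    refine fun m => happrox _ (hxV m) fun ε hε => ⟨fun k => xk k m, fun k => hxkV k m, ?_, ?_⟩
    · filter_upwards [Metric.tendsto_nhds.1 (hxlim m) ε hε] with k hk
      rwa [dist_eq_norm, norm_sub_rev] at hk
    · intro l' hl'
      have hlim : Tendsto (fun k => 2 ^ l'.length * (M k)⁻¹) U (𝓝 0) := by
        simpa using hMinv.const_mul (2 ^ l'.length)
      refine squeeze_zero_norm (fun k => ?_) hlim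
      have htk : 0 < t k := by linarith [ht k]
      set w := (l k).take ((l k).length - j) ++ (l' ++ (l k).drop m) with hw
      have hwP : ∀ p ∈ w, p ∈ P := by
        intro p hp
        simp only [hw, List.mem_append] at hp
        rcases hp with hp | hp | hp
        · exact hl k p (List.mem_of_mem_take hp)
        · exact hl' p hp
        · exact hl k p (List.mem_of_mem_drop hp)
      have h1 := hmax k w hwP (y k) (hy k) (hy1 k)
      have h2 : word (w.map ((t k : ℂ) • ·)) (y k) = ((M k : ℂ) ^ 2 * (t k : ℂ) ^ l'.length) •
          a k (word l' (xk k m)) := by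
        have hMk : (M k : ℂ) ≠ 0 := by exact_mod_cast (hM0 k).ne'
        simp only [hw, List.map_append, word_append, word_map_smul (t k : ℂ) l', hxk, ha, map_smul]
        change word _ ((t k : ℂ) ^ l'.length • word l' (word _ (y k))) =
          ((M k : ℂ) ^ 2 * (t k : ℂ) ^ l'.length) • (((M k)⁻¹ : ℝ) : ℂ) •
            ((((M k)⁻¹ : ℝ) : ℂ) • word _ (word l' (word _ (y k))))
        rw [map_smul, smul_smul, smul_smul]
        congr 1
        push_cast
        field_simp
      rw [h2, norm_smul, norm_mul, norm_pow, norm_pow, Complex.norm_real, Complex.norm_real,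
        Real.norm_of_nonneg (hM0 k).le, Real.norm_of_nonneg htk.le] at h1
      have h3 : 1 ≤ 2 ^ l'.length * t k ^ l'.length := by
        rw [← mul_pow]
        exact one_le_pow₀ (by linarith [ht k])
      have hMk := hM0 k
      rw [← div_eq_mul_inv, le_div_iff₀ hMk]
      have h4 : M k * t k ^ l'.length * ‖a k (word l' (xk k m))‖ ≤ 1 := by
        refine le_of_mul_le_mul_left ?_ hMk
        linarith
      have h5 := mul_le_mul_of_nonneg_left h4 (show (0 : ℝ) ≤ 2 ^ l'.length by positivity)
      have h6 := mul_le_mul_of_nonneg_right h3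
        (mul_nonneg hMk.le (norm_nonneg (a k (word l' (xk k m)))))
      linarith
  have hZc : IsClosed (Z : Set X) := by
    refine isClosed_of_closure_subset fun v hv => ?_
    have hvV : v ∈ V := (closure_minimal (fun w hw => hw.1) hVc : closure (Z : Set X) ⊆ V) hv
    refine happrox v hvV fun ε hε => ?_
    obtain ⟨w, hw, hvw⟩ := Metric.mem_closure_iff.1 hv ε hε
    rw [dist_eq_norm] at hvw
    exact ⟨fun _ => w, fun _ => hw.1, Eventually.of_forall fun _ => hvw, hw.2⟩
  have hZinv : ∀ p ∈ P, ∀ v ∈ Z, affineOp p v ∈ Z := by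
    refine fun p hp v hv => ⟨hV p hp v hv.1, fun l' hl' => ?_⟩
    have h := hv.2 (l' ++ [p]) (by simpa [or_imp, forall_and] using ⟨fun a b => hl' (a, b), hp⟩)
    refine h.congr fun k => ?_
    rw [word_append, word_cons, word_nil, mul_one]
    rfl
  refine ⟨Z, hZc, lt_of_le_of_ne (fun v hv => hv.1) fun hZV => ?_, hZinv, x, hx, hxZ, hx0⟩
  have hq : ∀ k, ∃ q, j < (l k).length →
      q ∈ Q ∧ word (((l k).drop ((l k).length - j)).map ((t k : ℂ) • ·)) = affineOp q := by
    intro k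
    by_cases hk : j < (l k).length
    · obtain ⟨q, hq⟩ := hQw _ (hscale k _ fun p hp => hl k p
        (List.mem_of_mem_drop (i := (l k).length - j) hp)) (by simp; omega)
      exact ⟨q, fun _ => hq⟩
    · exact ⟨0, fun h => absurd h hk⟩
  choose q hq using hq
  obtain ⟨z, hz⟩ := exists_tendsto_apply U hQ hQc ((hlen j).mono fun k hk => (hq k hk).1)
    (Eventually.of_forall hy1)
  have hzkV : ∀ k, j < (l k).length → (q k).2 (y k) ∈ V := by
    intro k hk
    have h : affineOp (q k) (y k) ∈ V := by
      rw [← (hq k hk).2]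
      exact mapsTo_word hV (hscale k _ fun p hp => hl k p (List.mem_of_mem_drop hp)) (hy k)
    rw [affineOp_apply] at h
    exact (Submodule.add_mem_iff_right V (V.smul_mem _ (hy k))).1 h
  have hzV : z ∈ V := hVc.mem_of_tendsto hz ((hlen j).mono hzkV)
  rw [← hZV] at hzV
  have h0 := hzV.2 [] (by simp)
  obtain ⟨k, hk, h1, h2⟩ := ((hlen j).and ((Metric.tendsto_nhds.1 h0 (1 / 16) (by norm_num)).and
    (Metric.tendsto_nhds.1 hz (1 / 16) (by norm_num)))).exists
  rw [dist_zero_right] at h1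
  rw [dist_eq_norm] at h2
  have h3 := haV k _ (V.sub_mem (hzkV k hk) hzV.1)
  have h4 : xk k 0 = (q k).1 • a k (y k) + a k ((q k).2 (y k) - z) + a k z := by
    have : xk k 0 = a k (affineOp (q k) (y k)) := by
      rw [← (hq k hk).2]
      change (((M k)⁻¹ : ℝ) : ℂ) • word (((l k).drop 0).map ((t k : ℂ) • ·)) (y k) =
        (((M k)⁻¹ : ℝ) : ℂ) • (word (((l k).take ((l k).length - j)).map ((t k : ℂ) • ·)) *
        word (((l k).drop ((l k).length - j)).map ((t k : ℂ) • ·))) (y k)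
      rw [← word_append, ← List.map_append, List.take_append_drop, List.drop_zero]
    rw [this, affineOp_apply, map_add, map_smul, map_sub, add_assoc, sub_add_cancel]
  have h5 : 1 / 2 ≤ ‖xk k 0‖ := by
    simp only [hxk, List.drop_zero]
    rw [norm_smul, hnormM, ← div_eq_inv_mul, le_div_iff₀ (hM0 k)]
    linarith [hly k]
  have h6 : ‖(q k).1 • a k (y k)‖ ≤ 1 / 4 := by
    rw [norm_smul]
    exact (mul_le_of_le_one_right (norm_nonneg _) ((haV k _ (hy k)).trans (hy1 k))).trans
      ((hQn _ (hq k hk).1).trans hj.le)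
  rw [h4] at h5
  rw [word_nil] at h1
  have h7 : ‖a k z‖ < 1 / 16 := h1
  have h8 := norm_add₃_le (a := (q k).1 • a k (y k)) (b := a k ((q k).2 (y k) - z)) (c := a k z)
  linarith

end

section

variable {X : Type*} [NormedAddCommGroup X] [NormedSpace ℂ X] [CompleteSpace X]
  {P : Set (ℂ × (X →L[ℂ] X))} {τ : ℝ}

theorem exists_tendsto_mul_mul {I : Type*} (U : Ultrafilter I) {Q : Set (ℂ × (X →L[ℂ] X))}
    (hQ : IsCompact Q) (hQc : ∀ p ∈ Q, IsCompactOperator p.2) {p s : I → ℂ × (X →L[ℂ] X)}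
    {v : I → X →L[ℂ] X} (hp : ∀ᶠ i in (U : Filter I), p i ∈ Q)
    (hs : ∀ᶠ i in (U : Filter I), s i ∈ Q) {r : ℝ} (hv : ∀ᶠ i in (U : Filter I), ‖v i‖ ≤ r) :
    ∃ z, Tendsto (fun i => (p i).2 * v i * (s i).2) U (𝓝 z) := by
  obtain ⟨p', hp', hpl⟩ := exists_tendsto_ultrafilter hQ U hp
  obtain ⟨s', hs', hsl⟩ := exists_tendsto_ultrafilter hQ U hs
  have hp2 := (continuous_snd.tendsto _).comp hpl
  have hs2 := (continuous_snd.tendsto _).comp hsl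
  obtain ⟨K, hK, hKv⟩ := exists_isCompact_mul_mul (hQc p' hp') (hQc s' hs') r
  obtain ⟨z, -, hz⟩ := exists_tendsto_ultrafilter hK U (hv.mono fun i hi => hKv (v i) hi)
  refine ⟨z, ?_⟩
  have h1 : Tendsto (fun i => ‖(p i).2 - p'.2‖ * r * ‖(s i).2‖ + ‖p'.2‖ * r * ‖(s i).2 - s'.2‖) U
      (𝓝 0) := by
    have h := (((hp2.sub_const p'.2).norm.mul_const r).mul hs2.norm).add
      ((hs2.sub_const s'.2).norm.const_mul (‖p'.2‖ * r))
    simpa using h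
  have h2 : Tendsto (fun i => (p i).2 * v i * (s i).2 - p'.2 * v i * s'.2) U (𝓝 0) := by
    refine squeeze_zero_norm' (hv.mono fun i hi => ?_) h1
    have h3 : (p i).2 * v i * (s i).2 - p'.2 * v i * s'.2 =
        ((p i).2 - p'.2) * v i * (s i).2 + p'.2 * v i * ((s i).2 - s'.2) := by noncomm_ring
    rw [h3]
    refine (norm_add_le _ _).trans (add_le_add ?_ ?_)
    · refine (norm_mul_le _ _).trans (mul_le_mul_of_nonneg_right ?_ (norm_nonneg _))
      exact (norm_mul_le _ _).trans (mul_le_mul_of_nonneg_left hi (norm_nonneg _))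
    · refine (norm_mul_le _ _).trans (mul_le_mul_of_nonneg_right ?_ (norm_nonneg _))
      exact (norm_mul_le _ _).trans (mul_le_mul_of_nonneg_left hi (norm_nonneg _))
  simpa using h2.add hz

/-- Long words from a bounded semigroup generated by a compact family cluster in norm. -/
theorem CompactFamily.exists_tendsto_word (hP : CompactFamily P τ) {C : ℝ}
    (hC : ∀ l : List (ℂ × (X →L[ℂ] X)), (∀ p ∈ l, p ∈ P) → ‖word l‖ ≤ C) {I : Type*}
    (U : Ultrafilter I) {l : I → List (ℂ × (X →L[ℂ] X))} (hl : ∀ i, ∀ p ∈ l i, p ∈ P)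
    (hlen : Tendsto (fun i => (l i).length) U atTop) :
    ∃ e : X →L[ℂ] X, IsCompactOperator e ∧ Tendsto (fun i => word (l i)) U (𝓝 e) := by
  have hC0 : 0 ≤ C := (norm_nonneg _).trans (hC [] (by simp))
  obtain ⟨e, he⟩ : ∃ e : X →L[ℂ] X, Tendsto (fun i => word (l i)) U (𝓝 e) := by
    refine exists_tendsto_of_forall_eventually_norm_sub_le fun ε hε => ?_
    obtain ⟨j, hj⟩ := exists_pow_lt_of_lt_one (show 0 < ε / 2 / (3 * C + 1) by positivity)
      hP.lt_one
    have hτj := pow_nonneg hP.nonneg j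
    obtain ⟨Q, hQ, hQn, hQc, hQw⟩ := hP.exists_words j
    have hch : ∀ i, ∃ p s, ∃ v : X →L[ℂ] X, 2 * j ≤ (l i).length → p ∈ Q ∧ s ∈ Q ∧ ‖v‖ ≤ C ∧
        ‖v * affineOp s‖ ≤ C ∧ ‖affineOp p * v‖ ≤ C ∧
        word (l i) = affineOp p * v * affineOp s := by
      intro i
      by_cases hi : 2 * j ≤ (l i).length
      · set l₁ := (l i).take j with hl₁
        set l₂ := ((l i).drop j).take ((l i).length - 2 * j) with hl₂
        set l₃ := ((l i).drop j).drop ((l i).length - 2 * j) with hl₃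
        have h1 : ∀ p ∈ l₁, p ∈ P := fun p hp => hl i p (List.mem_of_mem_take hp)
        have h2 : ∀ p ∈ l₂, p ∈ P := fun p hp =>
          hl i p (List.mem_of_mem_drop (List.mem_of_mem_take hp))
        have h3 : ∀ p ∈ l₃, p ∈ P := fun p hp =>
          hl i p (List.mem_of_mem_drop (List.mem_of_mem_drop hp))
        obtain ⟨p, hp, hpw⟩ := hQw l₁ h1 (by simp [hl₁]; omega)
        obtain ⟨s, hs, hsw⟩ := hQw l₃ h3 (by simp [hl₃]; omega)
        refine ⟨p, s, word l₂, fun _ => ⟨hp, hs, hC _ h2, ?_, ?_, ?_⟩⟩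
        · rw [← hsw, ← word_append]
          exact hC _ fun q hq => (List.mem_append.1 hq).elim (h2 q) (h3 q)
        · rw [← hpw, ← word_append]
          exact hC _ fun q hq => (List.mem_append.1 hq).elim (h1 q) (h2 q)
        · rw [← hpw, ← hsw, mul_assoc, ← word_append, ← word_append, hl₂, hl₃,
            List.take_append_drop, hl₁, List.take_append_drop]
      · exact ⟨0, 0, 0, fun h => absurd h hi⟩
    choose p s v hpsv using hch
    have hev := hlen.eventually_ge_atTop (2 * j)
    obtain ⟨z, hz⟩ := exists_tendsto_mul_mul U hQ hQc (hev.mono fun i hi => (hpsv i hi).1)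
      (hev.mono fun i hi => (hpsv i hi).2.1) (hev.mono fun i hi => (hpsv i hi).2.2.1)
    refine ⟨z, ?_⟩
    filter_upwards [hev, Metric.tendsto_nhds.1 hz (ε / 2) (half_pos hε)] with i hi hiz
    rw [dist_eq_norm] at hiz
    obtain ⟨hp, hs, hv, hvs, hpv, hw⟩ := hpsv i hi
    have h1 : word (l i) - z = (p i).1 • (v i * affineOp (s i)) + (s i).1 • (affineOp (p i) * v i) -
        ((s i).1 * (p i).1) • v i + ((p i).2 * v i * (s i).2 - z) := by
      rw [hw]
      simp only [affineOp, add_mul, mul_add, smul_mul_assoc, mul_smul_comm, one_mul, mul_one,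
        smul_add, smul_smul, mul_comm (s i).1]
      abel
    have hp1 := hQn _ hp
    have hs1 := hQn _ hs
    have h2 : ‖(p i).1 • (v i * affineOp (s i))‖ ≤ τ ^ j * C := by
      rw [norm_smul]
      exact mul_le_mul hp1 hvs (norm_nonneg _) hτj
    have h3 : ‖(s i).1 • (affineOp (p i) * v i)‖ ≤ τ ^ j * C := by
      rw [norm_smul]
      exact mul_le_mul hs1 hpv (norm_nonneg _) hτj
    have h4 : ‖((s i).1 * (p i).1) • v i‖ ≤ τ ^ j * C := by
      rw [norm_smul, norm_mul]
      refine mul_le_mul ?_ hv (norm_nonneg _) hτj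
      exact (mul_le_of_le_one_right (norm_nonneg _)
        (hp1.trans (pow_le_one₀ hP.nonneg hP.lt_one.le))).trans hs1
    rw [lt_div_iff₀ (by positivity)] at hj
    rw [h1]
    have h5 := norm_add_le ((p i).1 • (v i * affineOp (s i)) + (s i).1 • (affineOp (p i) * v i) -
        ((s i).1 * (p i).1) • v i) ((p i).2 * v i * (s i).2 - z)
    have h6 := norm_sub_le ((p i).1 • (v i * affineOp (s i)) + (s i).1 • (affineOp (p i) * v i))
        (((s i).1 * (p i).1) • v i)
    have h7 := norm_add_le ((p i).1 • (v i * affineOp (s i))) ((s i).1 • (affineOp (p i) * v i))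
    linarith
  refine ⟨e, ?_, he⟩
  have hch : ∀ i, ∃ p : ℂ × (X →L[ℂ] X), ‖p.1‖ ≤ τ ^ (l i).length ∧ IsCompactOperator p.2 ∧
      word (l i) = affineOp p := by
    intro i
    obtain ⟨Q, hQ, hQn, hQc, hQw⟩ := hP.exists_words (l i).length
    obtain ⟨p, hp, hw⟩ := hQw (l i) (hl i) rfl
    exact ⟨p, hQn p hp, hQc p hp, hw⟩
  choose p hpn hpc hpw using hch
  have h1 : Tendsto (fun i => (p i).1 • (1 : X →L[ℂ] X)) U (𝓝 0) := by
    have h : Tendsto (fun i => (p i).1) U (𝓝 0) := squeeze_zero_norm hpn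
      ((tendsto_pow_atTop_nhds_zero_of_lt_one hP.nonneg hP.lt_one).comp hlen)
    simpa using h.smul_const (1 : X →L[ℂ] X)
  have h2 : Tendsto (fun i => (p i).2) U (𝓝 e) := by
    have h := he.sub h1
    rw [sub_zero] at h
    refine h.congr fun i => ?_
    rw [hpw, affineOp, add_sub_cancel_left]
  exact isClosed_setOfPred_isCompactOperator.mem_of_tendsto h2 (Eventually.of_forall hpc)

theorem CompactFamily.orbit_eq_zero (hP : CompactFamily P τ)
    (hspec : ∀ l : List (ℂ × (X →L[ℂ] X)), (∀ p ∈ l, p ∈ P) →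
      SpectralBound (τ ^ l.length) (word l)) {C : ℝ}
    (hC : ∀ l : List (ℂ × (X →L[ℂ] X)), (∀ p ∈ l, p ∈ P) → ‖word l‖ ≤ C) {x : ℕ → X}
    (hx : IsOrbit P x) : x 0 = 0 := by
  by_contra hx0
  have hC0 : 0 ≤ C := (norm_nonneg _).trans (hC [] (by simp))
  set U : Ultrafilter ℕ := Ultrafilter.of atTop
  have hU : (U : Filter ℕ) ≤ atTop := Ultrafilter.of_le atTop
  obtain ⟨a, ha⟩ := hP.exists_tendsto U (x := x) fun j => Eventually.of_forall fun m => by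
    obtain ⟨l, hl, hlj, hw⟩ := hx.exists_word j m
    exact ⟨l, hl, hlj, _, (hx _).1, hw⟩
  have ha0 : a ≠ 0 := by
    rintro rfl
    have h : ∀ m, ‖x 0‖ ≤ C * ‖x m‖ := fun m => by
      obtain ⟨l, hl, -, hw⟩ := hx.exists_word m 0
      rw [hw, zero_add]
      exact (word l).le_of_opNorm_le (hC l hl) _
    have h2 := ge_of_tendsto' (ha.norm.const_mul C) h
    simp only [norm_zero, mul_zero, norm_le_zero_iff] at h2
    exact hx0 h2
  have hword : ∀ k : ℕ, ∃ l : List (ℂ × (X →L[ℂ] X)), (∀ p ∈ l, p ∈ P) ∧ k ≤ l.length ∧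
      ‖word l a - a‖ ≤ (C + 1) * (1 / ((k : ℝ) + 1)) := by
    intro k
    have hball := Metric.tendsto_nhds.1 ha (1 / ((k : ℝ) + 1)) (by positivity)
    obtain ⟨m, hm⟩ := hball.exists
    obtain ⟨n, hn, hmn⟩ := (hball.and (hU (eventually_ge_atTop (m + k)))).exists
    obtain ⟨l, hl, hlj, hw⟩ := hx.exists_word (n - m) m
    rw [Nat.add_sub_cancel' (by omega)] at hw
    refine ⟨l, hl, by omega, ?_⟩
    rw [dist_eq_norm] at hm hn
    have h1 : word l a - a = (x m - a) - word l (x n - a) := by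
      rw [map_sub, ← hw]
      abel
    have h2 := (word l).le_of_opNorm_le (hC l hl) (x n - a)
    rw [h1]
    have h3 := norm_sub_le (x m - a) (word l (x n - a))
    nlinarith
  choose l hl hlen hla using hword
  obtain ⟨e, he, hlim⟩ := hP.exists_tendsto_word hC U hl
    ((tendsto_atTop_mono hlen tendsto_id).mono_left hU)
  have hs : SpectralBound τ e := by
    refine SpectralBound.of_tendsto he hlim hP.nonneg (hU ?_)
    filter_upwards [eventually_ge_atTop 1] with k hk
    refine (hspec (l k) (hl k)).mono ?_
    exact pow_le_of_le_one hP.nonneg hP.lt_one.le (by have := hlen k; omega)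
  have hea : e a = (1 : ℂ) • a := by
    have h1 : Tendsto (fun k => word (l k) a) U (𝓝 (e a)) :=
      ((ContinuousLinearMap.apply ℂ X a).continuous.tendsto e).comp hlim
    have h2 : Tendsto (fun k => word (l k) a - a) U (𝓝 0) := by
      refine squeeze_zero_norm hla ?_
      have h := (tendsto_one_div_add_atTop_nhds_zero_nat (𝕜 := ℝ)).const_mul (C + 1)
      rw [mul_zero] at h
      exact h.mono_left hU
    rw [one_smul]
    exact sub_eq_zero.1 (tendsto_nhds_unique (h1.sub_const a) h2)
  have h := hs.norm_le hP.nonneg (mem_spectrum_of_apply_eq_smul ha0 hea)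
  rw [norm_one] at h
  exact absurd hP.lt_one h.not_gt

end

section

variable {X : Type*} [NormedAddCommGroup X] [NormedSpace ℂ X]
  {P : Set (ℂ × (X →L[ℂ] X))} {τ : ℝ}

theorem CompactFamily.exists_restrict (hP : CompactFamily P τ) {V : Submodule ℂ X}
    (hVc : IsClosed (V : Set X)) (hV : ∀ p ∈ P, ∀ v ∈ V, affineOp p v ∈ V) :
    ∃ R : Set (ℂ × (V →L[ℂ] V)), CompactFamily R τ ∧
      (∀ p ∈ P, ∃ p' ∈ R, ∀ v : V, (affineOp p' v : X) = affineOp p v) ∧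
      ∀ p' ∈ R, ∃ p ∈ P, ∀ v : V, (affineOp p' v : X) = affineOp p v := by
  have hV2 : ∀ p : P, ∀ v : V, (p.1.2 ∘L V.subtypeL) v ∈ V := fun p v => by
    have h := hV p.1 p.2 v v.2
    rw [affineOp_apply] at h
    exact (Submodule.add_mem_iff_right V (V.smul_mem _ v.2)).1 h
  let φ : P → V →L[ℂ] V := fun p => (p.1.2 ∘L V.subtypeL).codRestrict V (hV2 p)
  have hφ : Continuous φ := by
    suffices h : LipschitzWith 1 φ from h.continuous
    refine LipschitzWith.of_dist_le_mul fun p q => ?_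
    rw [NNReal.coe_one, one_mul, dist_eq_norm]
    have h2 : ‖φ p - φ q‖ ≤ ‖p.1.2 - q.1.2‖ :=
      ContinuousLinearMap.opNorm_le_bound _ (norm_nonneg _) fun v =>
        (p.1.2 - q.1.2).le_opNorm (v : X)
    refine h2.trans ?_
    rw [Subtype.dist_eq, dist_eq_norm]
    exact norm_snd_le (p.1 - q.1)
  have hcP : CompactSpace P := isCompact_iff_compactSpace.1 hP.isCompact
  have hval : ∀ p : P, ∀ v : V,
      (affineOp ((p.1.1, φ p) : ℂ × (V →L[ℂ] V)) v : X) = affineOp p.1 v := fun p v => rfl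
  refine ⟨Set.range fun p : P => (p.1.1, φ p), ⟨?_, hP.nonneg, hP.lt_one, ?_, ?_⟩, ?_, ?_⟩
  · exact isCompact_range ((continuous_fst.comp continuous_subtype_val).prodMk hφ)
  · rintro _ ⟨p, rfl⟩
    exact hP.norm_le _ p.2
  · rintro _ ⟨p, rfl⟩
    exact ((hP.compact _ p.2).comp_clm V.subtypeL).codRestrict (hV2 p) hVc
  · exact fun p hp => ⟨_, ⟨⟨p, hp⟩, rfl⟩, hval ⟨p, hp⟩⟩
  · rintro _ ⟨p, rfl⟩
    exact ⟨p, p.2, hval p⟩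

theorem exists_word_eq {V : Submodule ℂ X} {R : Set (ℂ × (V →L[ℂ] V))}
    (hR : ∀ p' ∈ R, ∃ p ∈ P, ∀ v : V, (affineOp p' v : X) = affineOp p v)
    (l' : List (ℂ × (V →L[ℂ] V))) (hl' : ∀ p ∈ l', p ∈ R) :
    ∃ l : List (ℂ × (X →L[ℂ] X)), (∀ p ∈ l, p ∈ P) ∧ l.length = l'.length ∧
      ∀ v : V, (word l' v : X) = word l v := by
  induction l' with
  | nil => exact ⟨[], by simp, rfl, fun v => rfl⟩
  | cons p' l' ih =>
    obtain ⟨l, hl, hlen, hw⟩ := ih fun q hq => hl' q (by simp [hq])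
    obtain ⟨p, hp, hpw⟩ := hR p' (hl' p' (by simp))
    refine ⟨p :: l, by simpa using ⟨hp, fun a b => hl (a, b)⟩, by simp [hlen], fun v => ?_⟩
    rw [word_cons, word_cons]
    change (affineOp p' (word l' v) : X) = affineOp p (word l v)
    rw [hpw, hw]

theorem SpectralBound.of_restrict {V : Submodule ℂ X} {a : X →L[ℂ] X} {b : V →L[ℂ] V} {r : ℝ}
    (h : SpectralBound r a) (hab : ∀ v : V, (b v : X) = a v) : SpectralBound r b := by
  intro θ hθ
  obtain ⟨C, hC⟩ := h θ hθ
  refine ⟨C, fun n => le_trans ?_ (hC n)⟩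
  have hpow : ∀ n : ℕ, ∀ v : V, ((b ^ n) v : X) = (a ^ n) v := by
    intro n
    induction n with
    | zero => exact fun v => rfl
    | succ n ih =>
      intro v
      rw [pow_succ, pow_succ]
      change ((b ^ n) (b v) : X) = (a ^ n) (a v)
      rw [ih, hab]
  refine ContinuousLinearMap.opNorm_le_bound _ (norm_nonneg _) fun v => ?_
  change ‖((b ^ n) v : X)‖ ≤ _
  rw [hpow]
  exact (a ^ n).le_opNorm _

variable [CompleteSpace X]

theorem CompactFamily.orbit_eq_zero_of_bounded_on (hP : CompactFamily P τ)
    (hspec : ∀ l : List (ℂ × (X →L[ℂ] X)), (∀ p ∈ l, p ∈ P) →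
      SpectralBound (τ ^ l.length) (word l)) {V : Submodule ℂ X} (hVc : IsClosed (V : Set X))
    (hV : ∀ p ∈ P, ∀ v ∈ V, affineOp p v ∈ V) {C : ℝ}
    (hC : ∀ l : List (ℂ × (X →L[ℂ] X)), (∀ p ∈ l, p ∈ P) → ∀ v ∈ V, ‖v‖ ≤ 1 → ‖word l v‖ ≤ C)
    {x : ℕ → X} (hx : IsOrbit P x) (hxV : ∀ m, x m ∈ V) : x 0 = 0 := by
  have : CompleteSpace V := hVc.completeSpace_coe
  have hC0 : 0 ≤ C := by simpa using hC [] (by simp) 0 V.zero_mem (by simp)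
  obtain ⟨R, hR, hPR, hRP⟩ := hP.exists_restrict hVc hV
  have h := hR.orbit_eq_zero (x := fun m => ⟨x m, hxV m⟩) (C := C) ?_ ?_ ?_
  · exact congrArg Subtype.val h
  · intro l' hl'
    obtain ⟨l, hl, hlen, hw⟩ := exists_word_eq hRP l' hl'
    rw [← hlen]
    exact (hspec l hl).of_restrict hw
  · intro l' hl'
    obtain ⟨l, hl, hlen, hw⟩ := exists_word_eq hRP l' hl'
    refine ContinuousLinearMap.opNorm_le_of_unit_norm hC0 fun v hv => ?_
    change ‖(word l' v : X)‖ ≤ _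
    rw [hw]
    exact hC l hl v v.2 hv.le
  · intro m
    obtain ⟨h1, p, hp, hxm⟩ := hx m
    obtain ⟨p', hp', hpp⟩ := hPR p hp
    exact ⟨h1, p', hp', Subtype.ext (hxm.trans (hpp ⟨x (m + 1), hxV (m + 1)⟩).symm)⟩

theorem CompactFamily.orbit_eq_zero_of_growth (hP : CompactFamily P τ)
    (hstar : ∀ p ∈ P, ∀ t : ℝ, 0 ≤ t → t ≤ 1 → (t : ℂ) • p ∈ P)
    (hgrowth : ∀ t : ℝ, 0 ≤ t → t < 1 → ∃ C, ∀ l : List (ℂ × (X →L[ℂ] X)), (∀ p ∈ l, p ∈ P) →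
      ‖word (l.map ((t : ℂ) • ·))‖ ≤ C)
    (hspec : ∀ l : List (ℂ × (X →L[ℂ] X)), (∀ p ∈ l, p ∈ P) →
      SpectralBound (τ ^ l.length) (word l)) {x : ℕ → X} (hx : IsOrbit P x) : x 0 = 0 := by
  by_contra hx0
  set c := min (1 / 2) ‖x 0‖
  have hc : 0 < c := lt_min (by norm_num) (norm_pos_iff.2 hx0)
  let F : Set (Submodule ℂ X)ᵒᵈ := {V | IsClosed ((OrderDual.ofDual V : Submodule ℂ X) : Set X) ∧
    (∀ p ∈ P, ∀ v ∈ OrderDual.ofDual V, affineOp p v ∈ OrderDual.ofDual V) ∧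
    ∃ y, IsOrbit P y ∧ (∀ m, y m ∈ OrderDual.ofDual V) ∧ c ≤ ‖y 0‖}
  obtain ⟨V, ⟨hVc, hV, y, hy, hyV, hyc⟩, hmax⟩ : ∃ V, Maximal (· ∈ F) V := by
    refine zorn_le₀ F fun s hs hchain => ?_
    rcases s.eq_empty_or_nonempty with rfl | hne
    · exact ⟨OrderDual.toDual ⊤, ⟨isClosed_univ, fun _ _ _ _ => trivial, x, hx, fun _ => trivial,
        min_le_right _ _⟩, by simp⟩
    · have : Nonempty s := hne.to_subtype
      have hdir : IsDirectedOrder s := ⟨fun a b => by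
        rcases hchain.total a.2 b.2 with h | h
        · exact ⟨b, h, le_rfl⟩
        · exact ⟨a, le_rfl, h⟩⟩
      choose y hy hyV hyc using fun V : s => (hs V.2).2.2
      set U : Ultrafilter s := Ultrafilter.of atTop
      have hU : (U : Filter s) ≤ atTop := Ultrafilter.of_le atTop
      obtain ⟨a, ha, hlim⟩ := hP.exists_orbit U (x := y)
        (fun m => Eventually.of_forall fun i => (hy i m).1)
        (fun m => Eventually.of_forall fun i => (hy i m).2)
      have haV : ∀ V : s, ∀ m, a m ∈ OrderDual.ofDual V.1 := by
        refine fun V m => (hs V.2).1.mem_of_tendsto (hlim m) (hU ?_)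
        filter_upwards [eventually_ge_atTop V] with W hW
        exact (show OrderDual.ofDual W.1 ≤ OrderDual.ofDual V.1 from hW) (hyV W m)
      refine ⟨OrderDual.toDual (⨅ V : s, OrderDual.ofDual V.1), ⟨?_, ?_, a, ha, ?_, ?_⟩, ?_⟩
      · rw [OrderDual.ofDual_toDual, Submodule.coe_iInf]
        exact isClosed_iInter fun V => (hs V.2).1
      · intro p hp v hv
        rw [OrderDual.ofDual_toDual, Submodule.mem_iInf] at hv ⊢
        exact fun V => (hs V.2).2.1 p hp v (hv V)
      · intro m
        rw [OrderDual.ofDual_toDual, Submodule.mem_iInf]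
        exact fun V => haV V m
      · exact ge_of_tendsto' (hlim 0).norm hyc
      · exact fun W hW => iInf_le (fun V : s => OrderDual.ofDual V.1) ⟨W, hW⟩
  by_cases hb : ∃ C, ∀ l : List (ℂ × (X →L[ℂ] X)), (∀ p ∈ l, p ∈ P) →
      ∀ v ∈ OrderDual.ofDual V, ‖v‖ ≤ 1 → ‖word l v‖ ≤ C
  · obtain ⟨C, hC⟩ := hb
    have h := hP.orbit_eq_zero_of_bounded_on hspec hVc hV hC hy hyV
    rw [h, norm_zero] at hyc
    exact absurd hc hyc.not_gt
  · obtain ⟨Z, hZc, hZV, hZ, z, hz, hzZ, hz0⟩ := hP.exists_smaller hstar hgrowth hVc hV hb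
    have h := hmax (y := OrderDual.toDual Z) ⟨hZc, hZ, z, hz, hzZ, (min_le_left _ _).trans hz0⟩
      (show Z ≤ OrderDual.ofDual V from hZV.le)
    exact hZV.not_ge h

end

section

variable {X : Type*} [NormedAddCommGroup X] [NormedSpace ℂ X] [CompleteSpace X]

theorem CompactFamily.exists_forall_norm_word_lt {P : Set (ℂ × (X →L[ℂ] X))} {τ : ℝ}
    (hP : CompactFamily P τ) (hstar : ∀ p ∈ P, ∀ t : ℝ, 0 ≤ t → t ≤ 1 → (t : ℂ) • p ∈ P)
    (hgrowth : ∀ t : ℝ, 0 ≤ t → t < 1 → ∃ C, ∀ l : List (ℂ × (X →L[ℂ] X)), (∀ p ∈ l, p ∈ P) →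
      ‖word (l.map ((t : ℂ) • ·))‖ ≤ C)
    (hspec : ∀ l : List (ℂ × (X →L[ℂ] X)), (∀ p ∈ l, p ∈ P) →
      SpectralBound (τ ^ l.length) (word l)) :
    ∃ n, ∀ l : List (ℂ × (X →L[ℂ] X)), (∀ p ∈ l, p ∈ P) → l.length = n → ‖word l‖ < 1 / 2 := by
  by_contra! hlong
  suffices h : ∃ x, IsOrbit P x ∧ x 0 ≠ 0 by
    obtain ⟨x, hx, hx0⟩ := h
    exact hx0 (hP.orbit_eq_zero_of_growth hstar hgrowth hspec hx)
  by_cases hb : ∃ C, ∀ l : List (ℂ × (X →L[ℂ] X)), (∀ p ∈ l, p ∈ P) →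
      ∀ v ∈ (⊤ : Submodule ℂ X), ‖v‖ ≤ 1 → ‖word l v‖ ≤ C
  · obtain ⟨C, hC⟩ := hb
    have hC0 : 0 ≤ C := by simpa using hC [] (by simp) 0 trivial (by simp)
    choose l hl hlen hnorm using hlong
    have hy : ∀ k, ∃ y : X, ‖y‖ ≤ 1 ∧ 1 / 4 ≤ ‖word (l k) y‖ := by
      intro k
      by_contra! h
      have := ContinuousLinearMap.opNorm_le_of_unit_norm (f := word (l k)) (C := 1 / 4)
        (by norm_num) fun x hx => (h x hx.le).le
      linarith [hnorm k]
    choose y hy1 hy using hy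
    have hC1 : (0 : ℝ) < C + 1 := by linarith
    set U : Ultrafilter ℕ := Ultrafilter.of atTop
    have hU : (U : Filter ℕ) ≤ atTop := Ultrafilter.of_le atTop
    have hn : ‖(((C + 1)⁻¹ : ℝ) : ℂ)‖ = (C + 1)⁻¹ := by
      rw [Complex.norm_real, Real.norm_of_nonneg (by positivity)]
    obtain ⟨x, hx, hlim⟩ := hP.exists_orbit U
      (x := fun k m => (((C + 1)⁻¹ : ℝ) : ℂ) • word ((l k).drop m) (y k))
      (fun m => Eventually.of_forall fun k => by
        rw [norm_smul, hn, inv_mul_le_iff₀ hC1, mul_one]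
        have := hC _ (fun p hp => hl k p (List.mem_of_mem_drop (i := m) hp)) (y k) trivial (hy1 k)
        linarith)
      (fun m => by
        refine hU ?_
        filter_upwards [eventually_gt_atTop m] with k hk
        rw [← hlen k] at hk
        refine ⟨(l k)[m], hl k _ (List.getElem_mem hk), ?_⟩
        rw [List.drop_eq_getElem_cons hk, word_cons, map_smul]
        rfl)
    refine ⟨x, hx, fun h0 => ?_⟩
    have h := ge_of_tendsto' (hlim 0).norm (b := (C + 1)⁻¹ * (1 / 4)) fun k => by
      rw [norm_smul, hn, List.drop_zero]
      exact mul_le_mul_of_nonneg_left (hy k) (by positivity)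
    rw [h0, norm_zero] at h
    have : 0 < (C + 1)⁻¹ * (1 / 4) := by positivity
    linarith
  · obtain ⟨Z, -, -, -, x, hx, -, hx0⟩ := hP.exists_smaller hstar hgrowth (V := ⊤)
      isClosed_univ (fun _ _ _ _ => trivial) hb
    refine ⟨x, hx, fun h => ?_⟩
    rw [h, norm_zero] at hx0
    norm_num at hx0

theorem bounded_words_of_length {A : Type*} [NormedRing A] {G : Set A} {B t : ℝ} {n : ℕ}
    (hn : n ≠ 0) (ht : 0 ≤ t)
    (hB : ∀ l : List A, (∀ g ∈ l, g ∈ G) → l.length < n → t ^ l.length * ‖l.prod‖ ≤ B)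
    (h : ∀ l : List A, (∀ g ∈ l, g ∈ G) → l.length = n → t ^ n * ‖l.prod‖ ≤ 1) (l : List A)
    (hl : ∀ g ∈ l, g ∈ G) : t ^ l.length * ‖l.prod‖ ≤ B := by
  induction hk : l.length using Nat.strong_induction_on generalizing l with
  | h k ih =>
    by_cases hlt : l.length < n
    · exact hk ▸ hB l hl hlt
    · have h1 := h (l.take n) (fun g hg => hl g (List.mem_of_mem_take hg)) (by simp; omega)
      have h2 := ih (k - n) (by omega) (l.drop n) (fun g hg => hl g (List.mem_of_mem_drop hg))
        (by simp; omega)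
      have h3 : k = n + (k - n) := by omega
      calc t ^ k * ‖l.prod‖ = t ^ n * t ^ (k - n) * ‖(l.take n).prod * (l.drop n).prod‖ := by
            rw [List.prod_take_mul_prod_drop, ← pow_add, ← h3]
        _ ≤ t ^ n * t ^ (k - n) * (‖(l.take n).prod‖ * ‖(l.drop n).prod‖) :=
            mul_le_mul_of_nonneg_left (norm_mul_le _ _) (by positivity)
        _ = (t ^ n * ‖(l.take n).prod‖) * (t ^ (k - n) * ‖(l.drop n).prod‖) := by ring
        _ ≤ 1 * (t ^ (k - n) * ‖(l.drop n).prod‖) :=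
            mul_le_mul_of_nonneg_right h1 (by positivity)
        _ ≤ B := by rwa [one_mul]

theorem norm_prod_le_pow {A : Type*} [NormedRing A] [NormOneClass A] {G : Set A} {B : ℝ}
    (hB : 0 ≤ B) (hG : ∀ g ∈ G, ‖g‖ ≤ B) (l : List A) (hl : ∀ g ∈ l, g ∈ G) :
    ‖l.prod‖ ≤ B ^ l.length := by
  induction l with
  | nil => simp
  | cons g l ih =>
    rw [List.prod_cons, List.length_cons, pow_succ']
    exact (norm_mul_le _ _).trans (mul_le_mul (hG g (hl g (by simp)))
      (ih fun a ha => hl a (by simp [ha])) (norm_nonneg _) hB)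

/-- The compact family of operators `sτg` with `s ∈ [0, 1]` and `g ∈ G`. -/
def scaledFamily (G : Set (X →L[ℂ] X)) (τ : ℝ) : Set (ℂ × (X →L[ℂ] X)) :=
  (fun q : ℝ × (X →L[ℂ] X) => (((q.1 * τ : ℝ) : ℂ), ((q.1 * τ : ℝ) : ℂ) • (q.2 - 1))) ''
    (Set.Icc 0 1 ×ˢ G)

variable {G : Set (X →L[ℂ] X)} {τ : ℝ}

theorem compactFamily_scaledFamily (hG : IsCompact G)
    (hc : ∀ g ∈ G, IsCompactOperator (g - 1 : X →L[ℂ] X))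
    (hτ : 0 ≤ τ) (hτ1 : τ < 1) : CompactFamily (scaledFamily G τ) τ := by
  refine ⟨(isCompact_Icc.prod hG).image (by fun_prop), hτ, hτ1, ?_, ?_⟩
  · rintro _ ⟨⟨s, g⟩, ⟨hs, -⟩, rfl⟩
    change ‖((s * τ : ℝ) : ℂ)‖ ≤ τ
    rw [Complex.norm_real, Real.norm_of_nonneg (mul_nonneg hs.1 hτ)]
    exact mul_le_of_le_one_left hτ hs.2
  · rintro _ ⟨⟨s, g⟩, ⟨-, hg⟩, rfl⟩
    exact (hc g hg).smul ((s * τ : ℝ) : ℂ)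

theorem star_scaledFamily : ∀ p ∈ scaledFamily G τ, ∀ t : ℝ, 0 ≤ t → t ≤ 1 →
    (t : ℂ) • p ∈ scaledFamily G τ := by
  rintro _ ⟨⟨s, g⟩, ⟨hs, hg⟩, rfl⟩ t ht ht1
  refine ⟨(t * s, g), ⟨⟨mul_nonneg ht hs.1, mul_le_one₀ ht1 hs.1 hs.2⟩, hg⟩, ?_⟩
  simp [smul_smul, mul_assoc]

theorem exists_word_scaledFamily (hτ : 0 ≤ τ) (l : List (ℂ × (X →L[ℂ] X)))
    (hl : ∀ p ∈ l, p ∈ scaledFamily G τ) :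
    ∃ c : ℂ, ‖c‖ ≤ τ ^ l.length ∧ ∃ l' : List (X →L[ℂ] X), (∀ g ∈ l', g ∈ G) ∧
      l'.length = l.length ∧ word l = c • l'.prod := by
  induction l with
  | nil => exact ⟨1, by simp, [], by simp, rfl, by simp⟩
  | cons p l ih =>
    obtain ⟨c, hc, l', hl', hlen, hw⟩ := ih fun q hq => hl q (by simp [hq])
    obtain ⟨⟨s, g⟩, ⟨hs, hg⟩, rfl⟩ := hl p (by simp)
    refine ⟨((s * τ : ℝ) : ℂ) * c, ?_, g :: l', ?_, by simp [hlen], ?_⟩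
    · rw [norm_mul, Complex.norm_real, Real.norm_of_nonneg (mul_nonneg hs.1 hτ), List.length_cons,
        pow_succ']
      exact mul_le_mul (mul_le_of_le_one_left hτ hs.2) hc (norm_nonneg _) hτ
    · intro a ha
      rcases List.mem_cons.1 ha with rfl | ha
      exacts [hg, hl' a ha]
    · rw [word_cons, hw, List.prod_cons, ← smul_mul_smul_comm]
      congr 1
      simp [affineOp, smul_sub]

theorem exists_word_scaledFamily_eq (l : List (X →L[ℂ] X)) (hl : ∀ g ∈ l, g ∈ G) :
    ∃ l' : List (ℂ × (X →L[ℂ] X)), (∀ p ∈ l', p ∈ scaledFamily G τ) ∧ l'.length = l.length ∧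
      word l' = (τ : ℂ) ^ l.length • l.prod := by
  induction l with
  | nil => exact ⟨[], by simp, rfl, by simp⟩
  | cons g l ih =>
    obtain ⟨l', hl', hlen, hw⟩ := ih fun a ha => hl a (by simp [ha])
    refine ⟨((τ : ℂ), (τ : ℂ) • (g - 1)) :: l', ?_, by simp [hlen], ?_⟩
    · intro p hp
      rcases List.mem_cons.1 hp with rfl | hp
      · exact ⟨(1, g), ⟨by simp, hl g (by simp)⟩, by simp⟩
      · exact hl' p hp
    · rw [word_cons, hw, List.prod_cons, List.length_cons, pow_succ', ← smul_mul_smul_comm]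
      congr 1
      simp [affineOp, smul_sub]

theorem SpectralBound.smul {A : Type*} [NormedRing A] [NormedAlgebra ℂ A] {a : A} {c : ℂ} {r : ℝ}
    (h : SpectralBound 1 a) (hr : 0 ≤ r) (hc : ‖c‖ ≤ r) : SpectralBound r (c • a) := by
  rcases hr.eq_or_lt with rfl | hr
  · have : c = 0 := norm_le_zero_iff.1 hc
    subst this
    intro θ hθ
    refine ⟨‖(1 : A)‖, fun n => ?_⟩
    cases n with
    | zero => simp
    | succ n => simp [pow_succ]; positivity
  · intro θ hθ
    obtain ⟨C, hC⟩ := h (θ / r) (by rwa [lt_div_iff₀ hr, one_mul])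
    refine ⟨C, fun n => ?_⟩
    rw [smul_pow, norm_smul, norm_pow]
    have h1 : ‖c‖ ^ n ≤ r ^ n := pow_le_pow_left₀ (norm_nonneg _) hc n
    refine (mul_le_mul h1 (hC n) (norm_nonneg _) (by positivity)).trans (le_of_eq ?_)
    rw [div_pow]
    field_simp

/-- A joint spectral radius formula for compact perturbations of the identity all of whose
products have spectral radius at most one. -/
theorem bounded_words [Nontrivial X] (hG : IsCompact G)
    (hc : ∀ g ∈ G, IsCompactOperator (g - 1 : X →L[ℂ] X))
    (hspec : ∀ l : List (X →L[ℂ] X), (∀ g ∈ l, g ∈ G) → SpectralBound 1 l.prod) {t : ℝ}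
    (ht : 0 ≤ t) (ht1 : t < 1) :
    ∃ C, ∀ l : List (X →L[ℂ] X), (∀ g ∈ l, g ∈ G) → t ^ l.length * ‖l.prod‖ ≤ C := by
  by_contra hcon
  set Θ : Set ℝ := {t | 0 ≤ t ∧ ∃ C, ∀ l : List (X →L[ℂ] X), (∀ g ∈ l, g ∈ G) →
    t ^ l.length * ‖l.prod‖ ≤ C}
  have hdown : ∀ s ∈ Θ, ∀ u, 0 ≤ u → u ≤ s → u ∈ Θ := by
    rintro s ⟨hs, C, hC⟩ u hu hus
    refine ⟨hu, C, fun l hl => le_trans ?_ (hC l hl)⟩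
    exact mul_le_mul_of_nonneg_right (pow_le_pow_left₀ hu hus _) (norm_nonneg _)
  have hlt : ∀ s ∈ Θ, s ≤ t := fun s hs => by
    by_contra! h
    exact hcon (hdown s hs t ht h.le).2
  have hbdd : BddAbove Θ := ⟨t, hlt⟩
  obtain ⟨B₀, hB₀⟩ := hG.isBounded.exists_norm_le
  set B := max B₀ 1
  have hB1 : 1 ≤ B := le_max_right _ _
  have hB0 : 0 < B := by linarith
  have hB : ∀ l : List (X →L[ℂ] X), (∀ g ∈ l, g ∈ G) → ‖l.prod‖ ≤ B ^ l.length :=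
    norm_prod_le_pow hB0.le fun g hg => (hB₀ g hg).trans (le_max_left _ _)
  have hBΘ : B⁻¹ ∈ Θ := by
    refine ⟨by positivity, 1, fun l hl => ?_⟩
    rw [inv_pow, inv_mul_le_iff₀ (by positivity), mul_one]
    exact hB l hl
  set τ := sSup Θ
  have hτ0 : 0 < τ := lt_of_lt_of_le (by positivity) (le_csSup hbdd hBΘ)
  have hτ1 : τ < 1 := (csSup_le ⟨_, hBΘ⟩ hlt).trans_lt ht1
  have hgrowth : ∀ s : ℝ, 0 ≤ s → s < 1 → ∃ C, ∀ l : List (ℂ × (X →L[ℂ] X)),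
      (∀ p ∈ l, p ∈ scaledFamily G τ) → ‖word (l.map ((s : ℂ) • ·))‖ ≤ C := by
    intro s hs hs1
    have hsτ : s * τ < τ := mul_lt_of_lt_one_left hτ0 hs1
    obtain ⟨r, hr, hsr⟩ := exists_lt_of_lt_csSup ⟨_, hBΘ⟩ hsτ
    obtain ⟨-, C, hC⟩ := hdown r hr _ (mul_nonneg hs hτ0.le) hsr.le
    refine ⟨C, fun l hl => ?_⟩
    obtain ⟨c, hcn, l', hl', hlen, hw⟩ := exists_word_scaledFamily hτ0.le l hl
    refine le_trans ?_ (hC l' hl')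
    rw [word_map_smul, hw, norm_smul, norm_smul, norm_pow, Complex.norm_real,
      Real.norm_of_nonneg hs, ← mul_assoc, mul_pow, hlen]
    exact mul_le_mul_of_nonneg_right (mul_le_mul_of_nonneg_left hcn (by positivity))
      (norm_nonneg _)
  have hword : ∀ l : List (ℂ × (X →L[ℂ] X)), (∀ p ∈ l, p ∈ scaledFamily G τ) →
      SpectralBound (τ ^ l.length) (word l) := by
    intro l hl
    obtain ⟨c, hcn, l', hl', hlen, hw⟩ := exists_word_scaledFamily hτ0.le l hl
    rw [hw]
    exact (hspec l' hl').smul (by positivity) hcn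
  obtain ⟨n, hn⟩ := (compactFamily_scaledFamily hG hc hτ0.le hτ1).exists_forall_norm_word_lt
    star_scaledFamily hgrowth hword
  have hn0 : n ≠ 0 := by
    rintro rfl
    have := hn [] (by simp) rfl
    rw [word_nil, norm_one] at this
    norm_num at this
  have hcont : Tendsto (fun u : ℝ => (u / τ) ^ n) (𝓝[>] τ) (𝓝 1) := by
    have h : Continuous fun u : ℝ => (u / τ) ^ n := by fun_prop
    have h2 := (h.tendsto τ).mono_left (nhdsWithin_le_nhds (s := Set.Ioi τ))
    simpa [div_self hτ0.ne'] using h2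
  obtain ⟨u, hu2, hτu⟩ := ((hcont.eventually (gt_mem_nhds (show (1 : ℝ) < 2 by norm_num))).and
    self_mem_nhdsWithin).exists
  have hτu : τ < u := hτu
  have hu0 : 0 < u := hτ0.trans hτu
  refine absurd (le_csSup hbdd (⟨hu0.le, (max u 1 * B) ^ n, ?_⟩ : u ∈ Θ)) hτu.not_ge
  refine bounded_words_of_length hn0 hu0.le (fun l hl hln => ?_) fun l hl hln => ?_
  · have h1 : 1 ≤ max u 1 * B := one_le_mul_of_one_le_of_one_le (le_max_right _ _) hB1
    refine le_trans ?_ (pow_le_pow_right₀ h1 hln.le)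
    rw [mul_pow]
    exact mul_le_mul (pow_le_pow_left₀ hu0.le (le_max_left _ _) _) (hB l hl) (norm_nonneg _)
      (by positivity)
  · obtain ⟨l', hl', hlen, hw⟩ := exists_word_scaledFamily_eq (τ := τ) l hl
    have h1 := hn l' hl' (hlen.trans hln)
    rw [hw, norm_smul, norm_pow, Complex.norm_real, Real.norm_of_nonneg hτ0.le, hln] at h1
    rw [div_pow, div_lt_iff₀ (by positivity)] at hu2
    nlinarith [norm_nonneg l.prod]

end

section

open NormedSpace

theorem norm_mul_mul_le_of_exp {A : Type*} [NormedRing A] [NormedAlgebra ℂ A] [CompleteSpace A]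
    {a b c : A} {T M : ℝ} (hT : 0 < T)
    (h : ∀ z : ℂ, ‖z‖ ≤ T → ‖b * (exp (z • a) * c)‖ ≤ M) : ‖b * (a * c)‖ ≤ M / T := by
  have hderiv : ∀ z : ℂ, HasDerivAt (fun z : ℂ => b * (exp (z • a) * c))
      (b * (exp (z • a) * a * c)) z := fun z =>
    ((hasDerivAt_exp_smul_const a z).mul_const c).const_mul b
  have hd : Differentiable ℂ fun z : ℂ => b * (exp (z • a) * c) :=
    fun z => (hderiv z).differentiableAt
  have h0 := Complex.norm_deriv_le_of_forall_mem_sphere_norm_le (c := 0) hT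
    hd.diffContOnCl fun z hz => h z (by
      rw [mem_sphere_zero_iff_norm] at hz
      exact hz.le)
  rwa [(hderiv 0).deriv, zero_smul, exp_zero, one_mul] at h0

variable {X : Type*} [NormedAddCommGroup X] [NormedSpace ℂ X] [CompleteSpace X] [Nontrivial X]

theorem exists_norm_prod_le {S : Submodule ℂ (X →L[ℂ] X)}
    (hS : IsClosed (S : Set (X →L[ℂ] X))) (hlie : ∀ a ∈ S, ∀ b ∈ S, a * b - b * a ∈ S)
    (hc : ∀ a ∈ S, IsCompactOperator a) (hq : ∀ a ∈ S, SpectralBound 0 a)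
    {H : Set (X →L[ℂ] X)} (hH : IsCompact H) (hHS : H ⊆ S) {ε : ℝ} (hε : 0 < ε) :
    ∃ C, ∀ l : List (X →L[ℂ] X), (∀ a ∈ l, a ∈ H) → ‖l.prod‖ ≤ C * ε ^ l.length := by
  set T := 2 / ε
  have hT : 0 < T := by positivity
  let G : Set (X →L[ℂ] X) := (fun q : ℂ × (X →L[ℂ] X) => exp (q.1 • q.2)) ''
    (Metric.closedBall 0 T ×ˢ H)
  have hG : IsCompact G := by
    refine ((isCompact_closedBall (0 : ℂ) T).prod hH).image ?_
    let _ := NormedAlgebra.restrictScalars ℚ ℂ (X →L[ℂ] X)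
    exact NormedSpace.exp_continuous.comp (continuous_fst.smul continuous_snd)
  have hlift : ∀ l : List (X →L[ℂ] X), (∀ g ∈ l, g ∈ G) →
      ∃ l' : List (X →L[ℂ] X), (∀ a ∈ l', a ∈ S) ∧ l = l'.map exp := by
    intro l
    induction l with
    | nil => exact fun _ => ⟨[], by simp, rfl⟩
    | cons g l ih =>
      intro hl
      obtain ⟨l', hl', rfl⟩ := ih fun a ha => hl a (by simp [ha])
      obtain ⟨⟨z, a⟩, ⟨-, ha⟩, rfl⟩ := hl g (by simp)
      refine ⟨(z • a) :: l', fun b hb => ?_, rfl⟩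
      rcases List.mem_cons.1 hb with rfl | hb
      exacts [S.smul_mem z (hHS ha), hl' b hb]
  obtain ⟨C, hC⟩ := bounded_words hG (t := 1 / 2)
    (by
      rintro _ ⟨⟨z, a⟩, ⟨-, ha⟩, rfl⟩
      exact isCompactOperator_exp_sub_one (hc _ (S.smul_mem z (hHS ha))))
    (fun l hl => by
      obtain ⟨l', hl', rfl⟩ := hlift l hl
      exact spectralBound_prod_exp hS hlie hc hq hl')
    (by norm_num) (by norm_num)
  have key : ∀ l : List (X →L[ℂ] X), (∀ a ∈ l, a ∈ H) → ∀ l' : List (X →L[ℂ] X),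
      (∀ g ∈ l', g ∈ G) →
      ‖l.prod * l'.prod‖ ≤ C * 2 ^ (l.length + l'.length) / T ^ l.length := by
    intro l
    induction l using List.reverseRecOn with
    | nil =>
      intro _ l' hl'
      have h := hC l' hl'
      rw [one_div, inv_pow, inv_mul_le_iff₀ (by positivity)] at h
      simpa [mul_comm] using h
    | append_singleton l a ih =>
      intro hl l' hl'
      have haH : a ∈ H := hl a (by simp)
      have h := norm_mul_mul_le_of_exp (a := a) (b := l.prod) (c := l'.prod)
        (M := C * 2 ^ (l.length + (l'.length + 1)) / T ^ l.length) hT fun z hz => by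
        have h2 := ih (fun b hb => hl b (by simp [hb])) (exp (z • a) :: l') fun g hg => by
          rcases List.mem_cons.1 hg with rfl | hg
          exacts [⟨(z, a), ⟨mem_closedBall_zero_iff.2 hz, haH⟩, rfl⟩, hl' g hg]
        rwa [List.prod_cons, List.length_cons] at h2
      rw [List.prod_append, List.prod_singleton, mul_assoc]
      refine h.trans (le_of_eq ?_)
      rw [List.length_append, List.length_singleton, div_div, ← pow_succ]
      ring_nf
  refine ⟨C, fun l hl => ?_⟩
  have h := key l hl [] (by simp)
  rw [List.prod_nil, mul_one, List.length_nil, add_zero, mul_div_assoc, ← div_pow] at h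
  have h2 : 2 / T = ε := by
    simp only [T]
    field_simp
  rwa [h2] at h

end

section

variable {X : Type*} [NormedAddCommGroup X] [NormedSpace ℂ X]

/-- Left multiplication of `z` by words in `H` decays at rate `ε`. -/
def WordBounded (H : Set (X →L[ℂ] X)) (ε D : ℝ) (z : X →L[ℂ] X) : Prop :=
  ∀ l : List (X →L[ℂ] X), (∀ a ∈ l, a ∈ H) → ‖l.prod * z‖ ≤ D * ε ^ l.length

theorem WordBounded.mul {H : Set (X →L[ℂ] X)} {ε D : ℝ} {a z : X →L[ℂ] X}
    (h : WordBounded H ε D z) (ha : a ∈ H) : WordBounded H ε (ε * D) (a * z) := by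
  intro l hl
  have h1 := h (l ++ [a]) fun b hb => by
    rcases List.mem_append.1 hb with hb | hb
    · exact hl b hb
    · rwa [List.mem_singleton.1 hb]
  rw [List.prod_append, List.prod_singleton, mul_assoc, List.length_append,
    List.length_singleton, pow_succ] at h1
  linarith

theorem WordBounded.mono {H : Set (X →L[ℂ] X)} {ε D D' : ℝ} {z : X →L[ℂ] X} (hε : 0 ≤ ε)
    (h : WordBounded H ε D z) (hD : D ≤ D') : WordBounded H ε D' z :=
  fun l hl => (h l hl).trans (by gcongr)

theorem exists_wordBounded_of_mem_adjoin {S : Submodule ℂ (X →L[ℂ] X)} {T : X →L[ℂ] X}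
    (hT : T ∈ Algebra.adjoin ℂ (S : Set (X →L[ℂ] X))) :
    ∃ H : Set (X →L[ℂ] X), H.Finite ∧ H ⊆ S ∧ ∃ B : ℝ, 0 ≤ B ∧
      ∀ H', H ⊆ H' → ∀ ε : ℝ, 0 ≤ ε → ε ≤ 1 → ∀ D, 0 ≤ D → ∀ z,
        WordBounded H' ε D z → WordBounded H' ε (B * D) (T * z) := by
  induction hT using Algebra.adjoin_induction with
  | mem a ha =>
    refine ⟨{a}, Set.finite_singleton a, Set.singleton_subset_iff.2 ha, 1, zero_le_one, ?_⟩
    intro H' hH' ε hε hε1 D hD z hz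
    exact (hz.mul (hH' rfl)).mono hε (by gcongr)
  | algebraMap r =>
    refine ⟨∅, Set.finite_empty, Set.empty_subset _, ‖r‖, norm_nonneg r, ?_⟩
    intro H' _ ε hε _ D hD z hz l hl
    rw [Algebra.algebraMap_eq_smul_one, smul_mul_assoc, one_mul, mul_smul_comm, norm_smul,
      mul_assoc]
    exact mul_le_mul_of_nonneg_left (hz l hl) (norm_nonneg r)
  | add a b _ _ iha ihb =>
    obtain ⟨H₁, hf₁, hs₁, B₁, hB₁, h₁⟩ := iha
    obtain ⟨H₂, hf₂, hs₂, B₂, hB₂, h₂⟩ := ihb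
    refine ⟨H₁ ∪ H₂, hf₁.union hf₂, Set.union_subset hs₁ hs₂, B₁ + B₂, add_nonneg hB₁ hB₂, ?_⟩
    intro H' hH' ε hε hε1 D hD z hz l hl
    have k₁ := h₁ H' (Set.subset_union_left.trans hH') ε hε hε1 D hD z hz l hl
    have k₂ := h₂ H' (Set.subset_union_right.trans hH') ε hε hε1 D hD z hz l hl
    rw [add_mul, mul_add]
    refine (norm_add_le _ _).trans ?_
    linarith
  | mul a b _ _ iha ihb =>
    obtain ⟨H₁, hf₁, hs₁, B₁, hB₁, h₁⟩ := iha
    obtain ⟨H₂, hf₂, hs₂, B₂, hB₂, h₂⟩ := ihb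
    refine ⟨H₁ ∪ H₂, hf₁.union hf₂, Set.union_subset hs₁ hs₂, B₁ * B₂, mul_nonneg hB₁ hB₂, ?_⟩
    intro H' hH' ε hε hε1 D hD z hz
    rw [mul_assoc, mul_assoc]
    exact h₁ H' (Set.subset_union_left.trans hH') ε hε hε1 _ (mul_nonneg hB₂ hD) _
      (h₂ H' (Set.subset_union_right.trans hH') ε hε hε1 D hD z hz)

theorem Irreducible.exists_mem_adjoin_mem_ball {S : Submodule ℂ (X →L[ℂ] X)}
    (hirr : Irreducible S) {y : X} (hy : y ≠ 0) (u : X) {δ : ℝ} (hδ : 0 < δ) :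
    ∃ T ∈ Algebra.adjoin ℂ (S : Set (X →L[ℂ] X)), T y ∈ Metric.ball u δ := by
  let M : Submodule ℂ X := (Subalgebra.toSubmodule (Algebra.adjoin ℂ (S : Set (X →L[ℂ] X)))).map
    ((ContinuousLinearMap.apply ℂ X y : (X →L[ℂ] X) →L[ℂ] X) : (X →L[ℂ] X) →ₗ[ℂ] X)
  have hM : ∀ x, x ∈ M ↔ ∃ T ∈ Algebra.adjoin ℂ (S : Set (X →L[ℂ] X)), T y = x :=
    fun x => Iff.rfl
  have hinv : ∀ A ∈ S, ∀ x ∈ M.topologicalClosure, A x ∈ M.topologicalClosure := by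
    intro A hA x hx
    refine map_mem_closure A.continuous hx fun z hz => ?_
    obtain ⟨T, hT, rfl⟩ := (hM z).1 hz
    exact (hM _).2 ⟨A * T, mul_mem (Algebra.subset_adjoin hA) hT, rfl⟩
  have hyM : y ∈ M.topologicalClosure :=
    M.le_topologicalClosure ((hM y).2 ⟨1, one_mem _, rfl⟩)
  rcases hirr _ M.isClosed_topologicalClosure hinv with h | h
  · rw [h] at hyM
    exact absurd ((Submodule.mem_bot ℂ).1 hyM) hy
  · have hu : u ∈ closure (M : Set X) := by
      change u ∈ M.topologicalClosure
      rw [h]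
      trivial
    obtain ⟨x, hx, hxu⟩ := Metric.mem_closure_iff.1 hu δ hδ
    obtain ⟨T, hT, rfl⟩ := (hM x).1 hx
    exact ⟨T, hT, by rwa [Metric.mem_ball, dist_comm]⟩

variable [CompleteSpace X] [Nontrivial X]

/-- Hilden's argument, with the decay of words in place of the decay of powers. -/
theorem Irreducible.eq_bot {S : Submodule ℂ (X →L[ℂ] X)} (hirr : Irreducible S)
    (hS : IsClosed (S : Set (X →L[ℂ] X))) (hlie : ∀ a ∈ S, ∀ b ∈ S, a * b - b * a ∈ S)
    (hc : ∀ a ∈ S, IsCompactOperator a) (hq : ∀ a ∈ S, SpectralBound 0 a) : S = ⊥ := by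
  by_contra hne
  obtain ⟨K, hKS, hK0⟩ := S.ne_bot_iff.1 hne
  obtain ⟨u, hu⟩ : ∃ u, K u ≠ 0 := by
    by_contra! h
    exact hK0 (ContinuousLinearMap.ext h)
  have hu0 : 0 < ‖u‖ := norm_pos_iff.2 fun h => hu (by rw [h, map_zero])
  have hKu : 0 < ‖K u‖ := norm_pos_iff.2 hu
  have hKn : 0 < ‖K‖ := norm_pos_iff.2 hK0
  obtain ⟨δ, hδ, hδm⟩ := exists_between (lt_min hu0 (div_pos hKu hKn))
  obtain ⟨hδu, hδK⟩ := lt_min_iff.1 hδm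
  rw [lt_div_iff₀ hKn] at hδK
  obtain ⟨Q, hQ, hKQ⟩ := IsCompactOperator.image_closedBall_subset_compact
    (𝕜₁ := ℂ) (𝕜₂ := ℂ) (f := (K : X →ₗ[ℂ] X)) (hc K hKS) (‖u‖ + δ)
  have hQ' : IsCompact (Q ∩ {y | ‖K u‖ - δ * ‖K‖ ≤ ‖y‖}) :=
    hQ.inter_right (isClosed_le continuous_const continuous_norm)
  have hmaps : ∀ x ∈ Metric.closedBall u δ, K x ∈ Q ∩ {y | ‖K u‖ - δ * ‖K‖ ≤ ‖y‖} := by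
    intro x hx
    have hxu : ‖x - u‖ ≤ δ := by rwa [← dist_eq_norm]
    refine ⟨hKQ ⟨x, mem_closedBall_zero_iff.2 ?_, rfl⟩, ?_⟩
    · linarith [norm_le_norm_add_norm_sub' x u]
    · have h1 := K.le_opNorm (x - u)
      have h2 : ‖K u‖ ≤ ‖K x‖ + ‖K (x - u)‖ := by
        rw [map_sub, norm_sub_rev]
        exact norm_le_norm_add_norm_sub' _ _
      have h3 := mul_le_mul_of_nonneg_left hxu hKn.le
      change ‖K u‖ - δ * ‖K‖ ≤ ‖K x‖
      linarith
  have hex : ∀ y : X, ∃ T ∈ Algebra.adjoin ℂ (S : Set (X →L[ℂ] X)),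
      y ≠ 0 → T y ∈ Metric.ball u δ := by
    intro y
    by_cases hy : y = 0
    · exact ⟨1, one_mem _, fun h => absurd hy h⟩
    · obtain ⟨T, hT, hTy⟩ := hirr.exists_mem_adjoin_mem_ball hy u hδ
      exact ⟨T, hT, fun _ => hTy⟩
  choose T hT hTball using hex
  choose H hHf hHS B hB hHB using fun y => exists_wordBounded_of_mem_adjoin (hT y)
  obtain ⟨t, htQ, ht⟩ := hQ'.elim_nhds_subcover (fun y => T y ⁻¹' Metric.ball u δ) (by
    rintro y ⟨-, hy⟩
    refine (Metric.isOpen_ball.preimage (T y).continuous).mem_nhds (hTball y ?_)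
    rintro rfl
    have hy' : ‖K u‖ - δ * ‖K‖ ≤ ‖(0 : X)‖ := hy
    rw [norm_zero] at hy'
    linarith)
  set H' : Set (X →L[ℂ] X) := insert K (⋃ y ∈ t, H y)
  have hH'f : H'.Finite := (t.finite_toSet.biUnion fun y _ => hHf y).insert K
  have hH'S : H' ⊆ S := Set.insert_subset hKS (Set.iUnion₂_subset fun y _ => hHS y)
  set b := ∑ y ∈ t, B y
  have hb : 0 ≤ b := Finset.sum_nonneg fun y _ => hB y
  set ε : ℝ := 1 / (2 * (b + 1))
  have hε : 0 < ε := by positivity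
  have hbε : b * ε ≤ 1 / 2 := by
    simp only [ε]
    rw [mul_one_div, div_le_div_iff₀ (by positivity) two_pos]
    linarith
  have hε1 : ε ≤ 1 := by
    simp only [ε]
    rw [div_le_one (by positivity)]
    linarith
  obtain ⟨C, hC⟩ := exists_norm_prod_le hS hlie hc hq hH'f.isCompact hH'S hε
  have hC0 : 0 ≤ C := by
    have h := hC [] (by simp)
    rw [List.length_nil, pow_zero, mul_one] at h
    exact (norm_nonneg _).trans h
  have hiter : ∀ n : ℕ, ∃ w : X →L[ℂ] X, w u ∈ Metric.closedBall u δ ∧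
      WordBounded H' ε (C * (1 / 2) ^ n) w := by
    intro n
    induction n with
    | zero =>
      refine ⟨1, Metric.mem_closedBall_self hδ.le, fun l hl => ?_⟩
      rw [mul_one, pow_zero, mul_one]
      exact hC l hl
    | succ n ih =>
      obtain ⟨w, hwu, hw⟩ := ih
      obtain ⟨y, hyt, hy⟩ := Set.mem_iUnion₂.1 (ht (hmaps _ hwu))
      refine ⟨T y * (K * w), Metric.ball_subset_closedBall hy, ?_⟩
      have h1 := hHB y H' ((Set.subset_biUnion_of_mem (u := H) hyt).trans (Set.subset_insert _ _))
        ε hε.le hε1 _ (by positivity) _ (hw.mul (Set.mem_insert K _))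
      refine h1.mono hε.le ?_
      have hBy : B y ≤ b := Finset.single_le_sum (fun y _ => hB y) hyt
      calc B y * (ε * (C * (1 / 2) ^ n)) ≤ b * (ε * (C * (1 / 2) ^ n)) := by gcongr
        _ = (b * ε) * (C * (1 / 2) ^ n) := by ring
        _ ≤ 1 / 2 * (C * (1 / 2) ^ n) := by gcongr
        _ = C * (1 / 2) ^ (n + 1) := by ring
  have hlim : Tendsto (fun n : ℕ => C * (1 / 2 : ℝ) ^ n * ‖u‖) atTop (𝓝 (C * 0 * ‖u‖)) :=
    ((tendsto_pow_atTop_nhds_zero_of_lt_one (by norm_num) (by norm_num)).const_mul C).mul_const _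
  have hge : ∀ n : ℕ, ‖u‖ - δ ≤ C * (1 / 2 : ℝ) ^ n * ‖u‖ := by
    intro n
    obtain ⟨w, hwu, hw⟩ := hiter n
    have h1 := hw [] (by simp)
    rw [List.prod_nil, one_mul, List.length_nil, pow_zero, mul_one] at h1
    have h2 : ‖u - w u‖ ≤ δ := by rwa [← dist_eq_norm, dist_comm]
    have h3 := w.le_of_opNorm_le h1 u
    linarith [norm_le_norm_add_norm_sub' u (w u)]
  have h := ge_of_tendsto' hlim hge
  rw [mul_zero, zero_mul] at h
  linarith

theorem not_irreducible_bot (hX : 2 ≤ Module.rank ℂ X) :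
    ¬ Irreducible (⊥ : Submodule ℂ (X →L[ℂ] X)) := by
  intro hirr
  obtain ⟨x, hx⟩ := exists_ne (0 : X)
  have hinv : ∀ A ∈ (⊥ : Submodule ℂ (X →L[ℂ] X)), ∀ y ∈ ℂ ∙ x, A y ∈ ℂ ∙ x := by
    intro A hA y _
    rw [(Submodule.mem_bot ℂ).1 hA]
    exact Submodule.zero_mem _
  rcases hirr (ℂ ∙ x) (Submodule.closed_of_finiteDimensional _) hinv with h | h
  · exact hx (Submodule.span_singleton_eq_bot.1 h)
  · have h1 : Module.rank ℂ X ≤ 1 := by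
      rw [← rank_top, ← h]
      simpa using rank_span_le (R := ℂ) ({x} : Set X)
    exact absurd (hX.trans h1) (by norm_num)

end

end LieReducible

/-- A Lie algebra of compact operators (on a space of dimension at least 2) with
submultiplicative spectrum is reducible. -/
theorem lie_algebra_submultiplicative_reducible
    {X : Type*} [NormedAddCommGroup X] [NormedSpace ℂ X] [CompleteSpace X]
    (hdim : 2 ≤ Module.rank ℂ X)
    (L : Submodule ℂ (X →L[ℂ] X))
    (hLie : ∀ A ∈ L, ∀ B ∈ L, A * B - B * A ∈ L)
    (hcompact : ∀ A ∈ L, IsCompactOperator A)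
    (hsubmul : ∀ A ∈ L, ∀ B ∈ L, ∀ mu ∈ spectrum ℂ (A * B),
      ∃ α ∈ spectrum ℂ A, ∃ β ∈ spectrum ℂ B, mu = α * β) :
    ∃ M : Submodule ℂ X, IsClosed (M : Set X) ∧ M ≠ ⊥ ∧ M ≠ ⊤ ∧
      ∀ A ∈ L, ∀ x ∈ M, A x ∈ M := by
  by_contra hnot
  have hirr₀ : LieReducible.Irreducible L := by
    intro M hM hinv
    by_contra! h
    exact hnot ⟨M, hM, h.1, h.2, hinv⟩
  have hirr := hirr₀.mono L.le_topologicalClosure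
  have hL := LieReducible.submulLie_topologicalClosure hLie hcompact hsubmul
  by_cases hX : FiniteDimensional ℂ X
  · have h := hirr.rank_le_one hL
    rw [← Module.finrank_eq_rank] at hdim
    have h2 : 2 ≤ Module.finrank ℂ X := by exact_mod_cast hdim
    omega
  · have hnt : Nontrivial X := by
      by_contra hs
      rw [not_nontrivial_iff_subsingleton] at hs
      exact hX inferInstance
    have hS := L.isClosed_topologicalClosure
    have hbot := hirr.eq_bot hS hL.lie hL.compact
      fun a ha => hirr.spectralBound_zero hX hS hL ha
    rw [hbot] at hirr
    exact LieReducible.not_irreducible_bot hdim hirr
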